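/- arXiv:2203.02983 — 2 statements merged into one kernel-verified Lean document; each statement's English description precedes it below -/
import Mathlib

section
/- Let C ⊆ ℝ^d be a cone with nonempty interior and F₀ : ℝ^d → ℝ^d a C¹ map with DF₀(x) strongly positive for every x; assume F₀ is pointwise dissipative. Then there is an integer m > 0 such that the set Q₀ := {x ∈ ℝ^d : ω(x,F₀) is a linearly stable cycle of F₀ of minimal period at most m} has full Lebesgue measure in ℝ^d. -/
open Filter Topology MeasureTheory Set Bornology Metric
open scoped ENNReal NNReal

noncomputable section

section Defs

variable {X : Type*} [NormedAddCommGroup X] [NormedSpace ℝ X]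

/-- A cone in a Banach space: a closed convex set with `r • C ⊆ C` for all `r > 0`
and `C ∩ (-C) = {0}`. -/
def IsCone (C : Set X) : Prop :=
  IsClosed C ∧ Convex ℝ C ∧ (∀ r : ℝ, 0 < r → ∀ x ∈ C, r • x ∈ C) ∧ C ∩ (-C) = {0}

/-- `(X, C)` is strongly ordered: `C` is a cone with nonempty interior. -/
def StronglyOrderedCone (C : Set X) : Prop :=
  IsCone C ∧ (interior C).Nonempty

/-- `x < y` in the order induced by the cone `C`. -/
def coneLT (C : Set X) (x y : X) : Prop := y - x ∈ C \ {0}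

/-- `x ≤ y` in the order induced by the cone `C`. -/
def coneLE (C : Set X) (x y : X) : Prop := y - x ∈ C

/-- `x ≪ y` in the order induced by the cone `C`. -/
def coneLLT (C : Set X) (x y : X) : Prop := y - x ∈ interior C

/-- A bounded linear operator is strongly positive (w.r.t. the cone `C`) if
`T v ≫ 0` whenever `v > 0`. -/
def StronglyPositive (C : Set X) (T : X →L[ℝ] X) : Prop :=
  ∀ v : X, v ∈ C \ {0} → T v ∈ interior C

/-- A map between normed spaces is compact if it sends bounded sets to relatively
compact sets. -/
def IsCompactMap {Y Z : Type*} [NormedAddCommGroup Y] [NormedAddCommGroup Z]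
    (f : Y → Z) : Prop :=
  ∀ B : Set Y, IsBounded B → IsCompact (closure (f '' B))

/-- `h` is pointwise dissipative: some nonempty bounded set `B` attracts every point. -/
def PointwiseDissipative (h : X → X) : Prop :=
  ∃ B : Set X, B.Nonempty ∧ IsBounded B ∧
    ∀ x : X, Tendsto (fun n : ℕ => infDist (h^[n] x) B) atTop (nhds 0)

/-- The set `A` attracts the set `B` under iteration of `h`. -/
def AttractsSet (h : X → X) (A B : Set X) : Prop :=
  ∀ ε : ℝ, 0 < ε → ∃ N : ℕ, ∀ n : ℕ, N ≤ n → ∀ x ∈ B, infDist (h^[n] x) A < ε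

/-- `A` is an attractor of `h`: the maximal compact invariant set attracting every
bounded set. -/
def IsAttractor (h : X → X) (A : Set X) : Prop :=
  A.Nonempty ∧ IsCompact A ∧ h '' A = A ∧
    (∀ B : Set X, IsBounded B → AttractsSet h A B) ∧
    (∀ A' : Set X, IsCompact A' → h '' A' = A' → A' ⊆ A)

/-- The ω-limit set `ω(x,h) = ⋂ₖ closure {hⁿ x : n ≥ k}`. -/
def omegaMap (h : X → X) (x : X) : Set X :=
  ⋂ k : ℕ, closure {y : X | ∃ n : ℕ, k ≤ n ∧ y = h^[n] x}

/-- The largest Lyapunov exponent `λ_max(x,h) = liminf (log ‖Dhⁿ(x)‖)/n` (in `EReal`). -/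
def lambdaMax (h : X → X) (x : X) : EReal :=
  atTop.liminf fun n : ℕ => ((Real.log ‖fderiv ℝ (h^[n]) x‖ / n : ℝ) : EReal)

/-- The principal Lyapunov exponent `λ₁(x,h) = limsup (log ‖Dhⁿ(x)‖)/n` (in `EReal`). -/
def lambdaOne (h : X → X) (x : X) : EReal :=
  atTop.limsup fun n : ℕ => ((Real.log ‖fderiv ℝ (h^[n]) x‖ / n : ℝ) : EReal)

/-- `S` is a linearly stable cycle of `h` of minimal period `p`: `S` is the orbit of a
`p`-periodic point `z` with spectral radius of `Dhᵖ(z)` at most `1`. -/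
def IsLinStableCycle (h : X → X) (p : ℕ) (S : Set X) : Prop :=
  ∃ z : X, h^[p] z = z ∧ (∀ l : ℕ, 0 < l → l < p → h^[l] z ≠ z) ∧
    spectralRadius ℝ (fderiv ℝ (h^[p]) z) ≤ 1 ∧ S = {y : X | ∃ n : ℕ, y = h^[n] z}

/-- `S` is a linearly stable cycle of `h` of minimal period at most `m`. -/
def IsLinStableCycleLe (h : X → X) (m : ℕ) (S : Set X) : Prop :=
  ∃ p : ℕ, 0 < p ∧ p ≤ m ∧ IsLinStableCycle h p S

/-- Semiflow axioms for `Φ : ℝ → X → X` (restricted to nonnegative times). -/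
def IsSemiflow (Φ : ℝ → X → X) : Prop :=
  (∀ x : X, Φ 0 x = x) ∧
    (∀ s t : ℝ, 0 ≤ s → 0 ≤ t → ∀ x : X, Φ (t + s) x = Φ t (Φ s x)) ∧
    ContinuousOn (fun p : ℝ × X => Φ p.1 p.2) (Ici (0 : ℝ) ×ˢ (univ : Set X))

/-- The ω-limit set of `x` under a semiflow. -/
def omegaFlow (Φ : ℝ → X → X) (x : X) : Set X :=
  ⋂ s : ℝ, closure {y : X | ∃ t : ℝ, s ≤ t ∧ y = Φ t x}

/-- The largest Lyapunov exponent of `x` w.r.t. a semiflow. -/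
def lambdaMaxFlow (Φ : ℝ → X → X) (x : X) : EReal :=
  atTop.liminf fun t : ℝ => ((Real.log ‖fderiv ℝ (Φ t) x‖ / t : ℝ) : EReal)

/-- The principal Lyapunov exponent of `x` w.r.t. a semiflow. -/
def lambdaOneFlow (Φ : ℝ → X → X) (x : X) : EReal :=
  atTop.limsup fun t : ℝ => ((Real.log ‖fderiv ℝ (Φ t) x‖ / t : ℝ) : EReal)

end Defs

section Shy

variable {X : Type*} [NormedAddCommGroup X] [NormedSpace ℝ X] [MeasurableSpace X]

/-- A Borel set `W` is shy if there is a nonzero compactly supported Borel measure `μ`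
with `μ(x + W) = 0` for every `x`. -/
def IsShy (W : Set X) : Prop :=
  MeasurableSet W ∧
    ∃ μ : Measure X, μ ≠ 0 ∧ (∃ K : Set X, IsCompact K ∧ μ Kᶜ = 0) ∧
      ∀ x : X, μ ((fun w => x + w) '' W) = 0

/-- `W` is prevalent in `V` if `V \ W` is shy. -/
def IsPrevalentIn (V W : Set X) : Prop := IsShy (V \ W)

end Shy

namespace MonotoneMap

variable {E : Type*} [NormedAddCommGroup E] [NormedSpace ℝ E]

/-- A closed convex cone `C` with an order unit `e` and a strictly positive functional `φ`,
normalised so that `φ` dominates the norm on `C`. -/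
structure ConeFrame (C : Set E) (e : E) (φ : E →L[ℝ] ℝ) (M : ℝ) : Prop where
  isClosed : IsClosed C
  add_mem : ∀ {x y : E}, x ∈ C → y ∈ C → x + y ∈ C
  smul_mem : ∀ {r : ℝ} {x : E}, 0 ≤ r → x ∈ C → r • x ∈ C
  norm_le : ∀ {v : E}, v ∈ C → ‖v‖ ≤ φ v
  sub_mem : ∀ v : E, (M * ‖v‖) • e - v ∈ C
  one_le : 1 ≤ M
  unit_mem : e ∈ C
  pos : 0 < φ e

section Cone

variable {C : Set E}

theorem IsCone.zero_mem (hC : IsCone C) : (0 : E) ∈ C := by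
  have h : (0 : E) ∈ C ∩ (-C) := by rw [hC.2.2.2]; rfl
  exact h.1

theorem IsCone.smul_mem (hC : IsCone C) {r : ℝ} {x : E} (hr : 0 ≤ r) (hx : x ∈ C) :
    r • x ∈ C := by
  rcases hr.eq_or_lt with rfl | hr
  · simpa using IsCone.zero_mem hC
  · exact hC.2.2.1 r hr x hx

theorem IsCone.add_mem (hC : IsCone C) {x y : E} (hx : x ∈ C) (hy : y ∈ C) : x + y ∈ C := by
  have h := hC.2.1 hx hy (by norm_num : (0 : ℝ) ≤ 1 / 2) (by norm_num : (0 : ℝ) ≤ 1 / 2)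
    (by norm_num)
  have h2 := hC.2.2.1 2 (by norm_num) _ h
  convert h2 using 1
  module

theorem IsCone.exists_nonneg_functional (hC : IsCone C) {v : E} (hv : v ∈ C) (hv0 : v ≠ 0) :
    ∃ φ : E →L[ℝ] ℝ, (∀ x ∈ C, 0 ≤ φ x) ∧ 0 < φ v := by
  have hnv : -v ∉ C := by
    intro h
    have h1 : v ∈ C ∩ (-C) := ⟨hv, h⟩
    rw [hC.2.2.2] at h1
    exact hv0 h1
  obtain ⟨φ, u, h1, h2⟩ := geometric_hahn_banach_point_closed hC.2.1 hC.1 hnv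
  have hu : u < 0 := by simpa using h2 0 (IsCone.zero_mem hC)
  refine ⟨φ, fun x hx => ?_, ?_⟩
  · by_contra! hneg
    have h3 := h2 _ (IsCone.smul_mem hC (div_nonneg_of_nonpos hu.le hneg.le) hx)
    rw [map_smul, smul_eq_mul, div_mul_cancel₀ _ hneg.ne] at h3
    exact lt_irrefl _ h3
  · rw [map_neg] at h1
    linarith

theorem IsCone.exists_strictlyPositive_functional [FiniteDimensional ℝ E] (hC : IsCone C) :
    ∃ φ : E →L[ℝ] ℝ, ∀ v ∈ C, ‖v‖ ≤ φ v := by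
  have hcomp : IsCompact (C ∩ sphere (0 : E) 1) := by
    have := FiniteDimensional.proper_real E
    exact (isCompact_sphere 0 1).inter_left hC.1
  have hex : ∃ φ : E →L[ℝ] ℝ, (∀ x ∈ C, 0 ≤ φ x) ∧ ∀ v ∈ C ∩ sphere (0 : E) 1, 0 < φ v := by
    refine hcomp.induction_on (p := fun s => ∃ φ : E →L[ℝ] ℝ, (∀ x ∈ C, 0 ≤ φ x) ∧
      ∀ v ∈ s ∩ C, 0 < φ v) ⟨0, by simp⟩ ?_ ?_ ?_ |>.imp
      fun φ h => ⟨h.1, fun v hv => h.2 v ⟨hv, hv.1⟩⟩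
    · rintro s t hst ⟨φ, h1, h2⟩
      exact ⟨φ, h1, fun v hv => h2 v ⟨hst hv.1, hv.2⟩⟩
    · rintro s t ⟨φ, h1, h2⟩ ⟨ψ, h3, h4⟩
      refine ⟨φ + ψ, fun x hx => add_nonneg (h1 x hx) (h3 x hx), ?_⟩
      rintro v ⟨hv | hv, hvC⟩
      · exact add_pos_of_pos_of_nonneg (h2 v ⟨hv, hvC⟩) (h3 v hvC)
      · exact add_pos_of_nonneg_of_pos (h1 v hvC) (h4 v ⟨hv, hvC⟩)
    · rintro x ⟨hxC, hx1⟩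
      obtain ⟨φ, h1, h2⟩ := IsCone.exists_nonneg_functional hC hxC
        (ne_zero_of_mem_unit_sphere ⟨x, hx1⟩)
      refine ⟨{y | 0 < φ y}, mem_nhdsWithin_of_mem_nhds ?_, φ, h1, fun v hv => hv.1⟩
      exact (isOpen_lt continuous_const φ.continuous).mem_nhds h2
  obtain ⟨φ, h0, h1⟩ := hex
  obtain ⟨κ, hκ, h2⟩ : ∃ κ : ℝ, 0 < κ ∧ ∀ v ∈ C ∩ sphere (0 : E) 1, κ ≤ φ v := by
    rcases (C ∩ sphere (0 : E) 1).eq_empty_or_nonempty with h | h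
    · exact ⟨1, one_pos, by simp [h]⟩
    · obtain ⟨v, hv, hmin⟩ := hcomp.exists_isMinOn h φ.continuous.continuousOn
      exact ⟨φ v, h1 v hv, fun w hw => hmin hw⟩
  refine ⟨κ⁻¹ • φ, fun v hv => ?_⟩
  rcases eq_or_ne v 0 with rfl | hv0
  · simp
  have hn : 0 < ‖v‖ := norm_pos_iff.2 hv0
  have h3 := h2 (‖v‖⁻¹ • v) ⟨IsCone.smul_mem hC (by positivity) hv, by
    simp [norm_smul, hn.ne']⟩
  rw [map_smul, smul_eq_mul, inv_mul_eq_div, le_div_iff₀ hn] at h3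
  change ‖v‖ ≤ κ⁻¹ * φ v
  rwa [inv_mul_eq_div, le_div_iff₀' hκ]

theorem exists_coneFrame [FiniteDimensional ℝ E] [Nontrivial E] (hC : StronglyOrderedCone C) :
    ∃ (e : E) (φ : E →L[ℝ] ℝ) (M : ℝ), e ∈ interior C ∧ ConeFrame C e φ M := by
  obtain ⟨hC, e, he⟩ := hC
  obtain ⟨φ, hφ⟩ := IsCone.exists_strictlyPositive_functional hC
  obtain ⟨r, hr, hball⟩ := Metric.isOpen_iff.1 isOpen_interior e he
  have heC : e ∈ C := interior_subset he
  have hunit : ∀ v : E, (max 1 (2 / r) * ‖v‖) • e - v ∈ C := by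
    intro v
    rcases eq_or_ne v 0 with rfl | hv0
    · simpa using IsCone.zero_mem hC
    have hn : 0 < ‖v‖ := norm_pos_iff.2 hv0
    have h1 : e - (r / (2 * ‖v‖)) • v ∈ C := by
      refine interior_subset (hball ?_)
      rw [mem_ball_iff_norm, sub_sub_cancel_left, norm_neg, norm_smul, Real.norm_of_nonneg
        (by positivity)]
      field_simp
      linarith
    have h2 := IsCone.smul_mem hC (by positivity : 0 ≤ 2 / r * ‖v‖) h1
    have h3 := IsCone.smul_mem hC (by
      have := le_max_right 1 (2 / r)
      have : 0 ≤ max 1 (2 / r) - 2 / r := by linarith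
      positivity : 0 ≤ (max 1 (2 / r) - 2 / r) * ‖v‖) heC
    convert IsCone.add_mem hC h2 h3 using 1
    rw [smul_sub, smul_smul, show 2 / r * ‖v‖ * (r / (2 * ‖v‖)) = 1 by field_simp]
    module
  have he0 : e ≠ 0 := by
    rintro rfl
    obtain ⟨v, hv⟩ := exists_ne (0 : E)
    have h1 := hunit v
    have h2 := hunit (-v)
    simp only [smul_zero, zero_sub, neg_neg] at h1 h2
    have h3 : v ∈ C ∩ (-C) := ⟨h2, h1⟩
    rw [hC.2.2.2] at h3
    exact hv h3
  exact ⟨e, φ, max 1 (2 / r), he, hC.1, IsCone.add_mem hC, IsCone.smul_mem hC, hφ _, hunit,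
    le_max_left _ _, heC, (norm_pos_iff.2 he0).trans_le (hφ e heC)⟩

end Cone

namespace ConeFrame

variable {C : Set E} {e : E} {φ : E →L[ℝ] ℝ} {M : ℝ}

theorem zero_mem (h : ConeFrame C e φ M) : (0 : E) ∈ C := by
  simpa using h.smul_mem le_rfl h.unit_mem

theorem M_pos (h : ConeFrame C e φ M) : 0 < M := one_pos.trans_le h.one_le

theorem nonneg (h : ConeFrame C e φ M) {v : E} (hv : v ∈ C) : 0 ≤ φ v :=
  (norm_nonneg v).trans (h.norm_le hv)

theorem add_unit_mem (h : ConeFrame C e φ M) (v : E) : v + (M * ‖v‖) • e ∈ C := by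
  simpa [add_comm] using h.sub_mem (-v)

theorem smul_unit_sub_mem (h : ConeFrame C e φ M) {v : E} {r : ℝ} (hr : M * ‖v‖ ≤ r) :
    r • e - v ∈ C := by
  convert h.add_mem (h.sub_mem v) (h.smul_mem (sub_nonneg.2 hr) h.unit_mem) using 1
  module

theorem le_of_sub_mem (h : ConeFrame C e φ M) {x y : E} (hxy : y - x ∈ C) : φ x ≤ φ y := by
  have := h.nonneg hxy
  rwa [map_sub, sub_nonneg] at this

theorem eq_zero_of_mem_neg_mem (h : ConeFrame C e φ M) {v : E} (h1 : v ∈ C) (h2 : -v ∈ C) :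
    v = 0 := by
  have h3 := h.norm_le h1
  have h4 := h.norm_le h2
  rw [map_neg, norm_neg] at h4
  exact norm_le_zero_iff.1 (by linarith)

theorem convex (h : ConeFrame C e φ M) : Convex ℝ C := fun _ hx _ hy _ _ ha hb _ =>
  h.add_mem (h.smul_mem ha hx) (h.smul_mem hb hy)

/-- Normality of the cone: order intervals `[-t u, t u]` are bounded. -/
theorem norm_le_of_mem_interval (h : ConeFrame C e φ M) {u w : E} {t : ℝ} (ht : 0 ≤ t)
    (hu : u ∈ C) (h1 : w + t • u ∈ C) (h2 : t • u - w ∈ C) : ‖w‖ ≤ 3 * t * φ u := by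
  have h3 := h.norm_le h1
  have h4 := h.nonneg h2
  have h5 := h.norm_le (h.smul_mem ht hu)
  have h6 : ‖w‖ ≤ ‖w + t • u‖ + ‖t • u‖ := by
    simpa using norm_sub_le (w + t • u) (t • u)
  simp only [map_add, map_sub, map_smul, smul_eq_mul] at h3 h4 h5
  nlinarith

end ConeFrame

/-- Uniform positivity of an operator with lower bound `c` and norm bound `L`. -/
structure UnifPos (C : Set E) (e : E) (c L : ℝ) (T : E →L[ℝ] E) : Prop where
  lower : ∀ v ∈ C, T v - (c * ‖v‖) • e ∈ C
  norm_le : ‖T‖ ≤ L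

namespace UnifPos

variable {C : Set E} {e : E} {φ : E →L[ℝ] ℝ} {M c L : ℝ} {T : E →L[ℝ] E}

theorem map_mem (hT : UnifPos C e c L T) (h : ConeFrame C e φ M) (hc : 0 < c) {v : E}
    (hv : v ∈ C) : T v ∈ C := by
  simpa using h.add_mem (hT.lower v hv)
    (h.smul_mem (by positivity : 0 ≤ c * ‖v‖) h.unit_mem)

theorem apply_le (hT : UnifPos C e c L T) (v : E) : ‖T v‖ ≤ L * ‖v‖ :=
  T.le_of_opNorm_le hT.norm_le v

/-- One application of a uniformly positive operator improves a lower bound by a fixed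
proportion of the oscillation. -/
theorem sub_mem_of_large (hT : UnifPos C e c L T) (h : ConeFrame C e φ M) (hc : 0 < c)
    (hL : 1 ≤ L) {u p : E} {D : ℝ} (hD : 0 ≤ D) (hp : p ∈ C)
    (hpu : D * ‖u‖ ≤ 2 * ‖p‖) : T p - (c / (2 * M * L) * D) • T u ∈ C := by
  have hM := h.M_pos
  have h1 := hT.lower p hp
  have h2 : (M * (L * ‖u‖)) • e - T u ∈ C :=
    h.smul_unit_sub_mem (mul_le_mul_of_nonneg_left (hT.apply_le u) hM.le)
  have h3 := h.smul_mem (by positivity : 0 ≤ c / (2 * M * L) * D) h2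
  have h4 := h.smul_mem (by nlinarith : 0 ≤ c * ‖p‖ - c * (D * ‖u‖) / 2) h.unit_mem
  convert h.add_mem (h.add_mem h1 h3) h4 using 1
  rw [smul_sub, smul_smul, show c / (2 * M * L) * D * (M * (L * ‖u‖)) = c * (D * ‖u‖) / 2 by
    field_simp]
  module

theorem oscillation_step (hT : UnifPos C e c L T) (h : ConeFrame C e φ M) (hc : 0 < c)
    (hL : 1 ≤ L) {u w : E} {α β : ℝ} (hαβ : α ≤ β) (h1 : w - α • u ∈ C)
    (h2 : β • u - w ∈ C) : ∃ α' β' : ℝ, β' - α' = (1 - c / (2 * M * L)) * (β - α) ∧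
      T w - α' • T u ∈ C ∧ β' • T u - T w ∈ C := by
  have hsum : (β - α) * ‖u‖ ≤ ‖w - α • u‖ + ‖β • u - w‖ := by
    have h3 := norm_add_le (w - α • u) (β • u - w)
    rw [show w - α • u + (β • u - w) = (β - α) • u by module, norm_smul,
      Real.norm_of_nonneg (sub_nonneg.2 hαβ)] at h3
    exact h3
  have g1 := hT.map_mem h hc h1
  have g2 := hT.map_mem h hc h2
  rcases le_total ‖β • u - w‖ ‖w - α • u‖ with hle | hle
  · refine ⟨α + c / (2 * M * L) * (β - α), β, by ring, ?_, by simpa using g2⟩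
    have h5 := hT.sub_mem_of_large h hc hL (u := u) (sub_nonneg.2 hαβ) h1 (by linarith)
    convert h5 using 1
    simp only [map_sub, map_smul]
    module
  · refine ⟨α, β - c / (2 * M * L) * (β - α), by ring, by simpa using g1, ?_⟩
    have h5 := hT.sub_mem_of_large h hc hL (u := u) (sub_nonneg.2 hαβ) h2 (by linarith)
    convert h5 using 1
    simp only [map_sub, map_smul]
    module

end UnifPos

section Contraction

variable {C : Set E} {e : E} {φ : E →L[ℝ] ℝ} {M c L : ℝ}

theorem contraction_factor_mem (h : ConeFrame C e φ M) (hc : 0 < c) (hc1 : c ≤ 1)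
    (hL : 1 ≤ L) : 0 < 1 - c / (2 * M * L) ∧ 1 - c / (2 * M * L) < 1 := by
  have hM := h.one_le
  have hML : 1 ≤ M * L := one_le_mul_of_one_le_of_one_le hM hL
  constructor
  · rw [sub_pos, div_lt_one (by positivity)]
    linarith
  · have : 0 < c / (2 * M * L) := by positivity
    linarith

theorem oscillation_contraction (h : ConeFrame C e φ M) (hc : 0 < c) (hc1 : c ≤ 1) (hL : 1 ≤ L)
    {T : ℕ → E →L[ℝ] E} (hT : ∀ n, UnifPos C e c L (T n)) {u w : ℕ → E}
    (hu : ∀ n, u (n + 1) = T n (u n)) (hw : ∀ n, w (n + 1) = T n (w n)) {α β : ℝ}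
    (hαβ : α ≤ β) (h1 : w 0 - α • u 0 ∈ C) (h2 : β • u 0 - w 0 ∈ C) (n : ℕ) :
    ∃ α' β' : ℝ, β' - α' = (1 - c / (2 * M * L)) ^ n * (β - α) ∧
      w n - α' • u n ∈ C ∧ β' • u n - w n ∈ C := by
  induction n with
  | zero => exact ⟨α, β, by simp, h1, h2⟩
  | succ n ih =>
    obtain ⟨α', β', h3, h4, h5⟩ := ih
    have hγ := (contraction_factor_mem h hc hc1 hL).1
    have hle : α' ≤ β' := by
      have : 0 ≤ (1 - c / (2 * M * L)) ^ n * (β - α) :=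
        mul_nonneg (pow_nonneg hγ.le n) (sub_nonneg.2 hαβ)
      linarith
    obtain ⟨α'', β'', h6, h7, h8⟩ := (hT n).oscillation_step h hc hL hle h4 h5
    rw [← hu, ← hw] at h7 h8
    exact ⟨α'', β'', by rw [h6, h3]; ring, h7, h8⟩

/-- Exponential separation: a solution that never becomes comparable with `0` is exponentially
small compared to the positive solution starting at `e`. -/
theorem norm_le_of_not_comparable (h : ConeFrame C e φ M) (hc : 0 < c) (hc1 : c ≤ 1)
    (hL : 1 ≤ L) {T : ℕ → E →L[ℝ] E} (hT : ∀ n, UnifPos C e c L (T n)) {u w : ℕ → E}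
    (hu0 : u 0 = e) (hu : ∀ n, u (n + 1) = T n (u n)) (hw : ∀ n, w (n + 1) = T n (w n))
    (hpos : ∀ n, w n ∉ C) (hneg : ∀ n, -w n ∉ C) (n : ℕ) :
    ‖w n‖ ≤ 6 * M * ‖w 0‖ * (1 - c / (2 * M * L)) ^ n * φ (u n) := by
  have huC : ∀ n, u n ∈ C := by
    intro n
    induction n with
    | zero => rw [hu0]; exact h.unit_mem
    | succ n ih => rw [hu]; exact (hT n).map_mem h hc ih
  have hM := h.M_pos
  obtain ⟨α, β, h1, h2, h3⟩ := oscillation_contraction h hc hc1 hL hT hu hw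
    (α := -(M * ‖w 0‖)) (β := M * ‖w 0‖) (by have : 0 ≤ M * ‖w 0‖ := by positivity
                                             linarith)
    (by rw [hu0, neg_smul, sub_neg_eq_add]; exact h.add_unit_mem _)
    (by rw [hu0]; exact h.sub_mem _) n
  have hα : α < 0 := by
    by_contra! hα
    refine hpos n ?_
    simpa using h.add_mem h2 (h.smul_mem hα (huC n))
  have hβ : 0 < β := by
    by_contra! hβ
    refine hneg n ?_
    convert h.add_mem h3 (h.smul_mem (neg_nonneg.2 hβ) (huC n)) using 1
    module
  have h4 : ‖w n‖ ≤ 3 * (β - α) * φ (u n) := by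
    refine h.norm_le_of_mem_interval (by linarith) (huC n) ?_ ?_
    · convert h.add_mem h2 (h.smul_mem hβ.le (huC n)) using 1
      module
    · convert h.add_mem h3 (h.smul_mem (neg_nonneg.2 hα.le) (huC n)) using 1
      module
  rw [h1] at h4
  linarith

end Contraction

section MeanValue

variable {F : E → E}

theorem exists_mem_sub_eq_apply [CompleteSpace E] (hF : ContDiff ℝ 1 F) {S : Set (E →L[ℝ] E)}
    (hS : Convex ℝ S) (hSc : IsClosed S) {a b : E}
    (h : ∀ x ∈ segment ℝ a b, fderiv ℝ F x ∈ S) : ∃ T ∈ S, F b - F a = T (b - a) := by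
  have hline : Continuous fun s : ℝ => a + s • (b - a) := by fun_prop
  have hg : Continuous fun s : ℝ => fderiv ℝ F (a + s • (b - a)) :=
    (hF.continuous_fderiv one_ne_zero).comp hline
  have hint : IntegrableOn (fun s : ℝ => fderiv ℝ F (a + s • (b - a))) (Ioc 0 1) :=
    (hg.integrableOn_Icc (a := 0) (b := 1)).mono_set Ioc_subset_Icc_self
  have : IsProbabilityMeasure (volume.restrict (Ioc (0 : ℝ) 1)) := ⟨by simp⟩
  refine ⟨∫ s in Ioc (0 : ℝ) 1, fderiv ℝ F (a + s • (b - a)),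
    hS.integral_mem hSc ?_ hint, ?_⟩
  · refine (ae_restrict_iff' measurableSet_Ioc).2 (Eventually.of_forall fun s hs => h _ ?_)
    rw [segment_eq_image']
    exact ⟨s, Ioc_subset_Icc_self hs, rfl⟩
  · rw [ContinuousLinearMap.integral_apply hint, ← intervalIntegral.integral_of_le zero_le_one,
      intervalIntegral.integral_eq_sub_of_hasDerivAt (f := fun s : ℝ => F (a + s • (b - a)))]
    · simp
    · intro s _
      have h1 : HasDerivAt (fun s : ℝ => a + s • (b - a)) (b - a) s := by
        simpa using ((hasDerivAt_id s).smul_const (b - a)).const_add a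
      exact ((hF.differentiable one_ne_zero _).hasFDerivAt).comp_hasDerivAt s h1
    · exact (hg.clm_apply continuous_const).intervalIntegrable _ _

theorem contDiff_iterate (hF : ContDiff ℝ 1 F) (n : ℕ) : ContDiff ℝ 1 F^[n] := by
  induction n with
  | zero => exact contDiff_id
  | succ n ih => exact ih.comp hF

theorem fderiv_iterate_add (hF : ContDiff ℝ 1 F) (m n : ℕ) (x v : E) :
    fderiv ℝ F^[m + n] x v = fderiv ℝ F^[m] (F^[n] x) (fderiv ℝ F^[n] x v) := by
  rw [Function.iterate_add, fderiv_comp x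
    ((contDiff_iterate hF m).differentiable one_ne_zero _)
    ((contDiff_iterate hF n).differentiable one_ne_zero _)]
  rfl

theorem fderiv_iterate_succ (hF : ContDiff ℝ 1 F) (n : ℕ) (x v : E) :
    fderiv ℝ F^[n + 1] x v = fderiv ℝ F (F^[n] x) (fderiv ℝ F^[n] x v) := by
  rw [add_comm, fderiv_iterate_add hF 1 n]
  rfl

theorem fderiv_iterate_zero (x v : E) : fderiv ℝ F^[0] x v = v := by
  simp [Function.iterate_zero]

end MeanValue

theorem UnifPos.convex_setOf {C : Set E} {e : E} {φ : E →L[ℝ] ℝ} {M : ℝ}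
    (h : ConeFrame C e φ M) (c L : ℝ) : Convex ℝ {T | UnifPos C e c L T} := by
  intro T (hT : UnifPos C e c L T) S (hS : UnifPos C e c L S) a b ha hb hab
  refine ⟨fun v hv => ?_, ?_⟩
  · convert h.add_mem (h.smul_mem ha (hT.lower v hv)) (h.smul_mem hb (hS.lower v hv)) using 1
    have hb' : b = 1 - a := by linarith
    subst hb'
    simp only [add_apply, smul_apply]
    module
  · have := convex_closedBall (0 : E →L[ℝ] E) L (mem_closedBall_zero_iff.2 hT.norm_le)
      (mem_closedBall_zero_iff.2 hS.norm_le) ha hb hab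
    exact mem_closedBall_zero_iff.1 this

theorem UnifPos.isClosed_setOf {C : Set E} (hC : IsClosed C) (e : E) (c L : ℝ) :
    IsClosed {T | UnifPos C e c L T} := by
  have : {T | UnifPos C e c L T} =
      (⋂ v ∈ C, (fun T : E →L[ℝ] E => T v - (c * ‖v‖) • e) ⁻¹' C) ∩ closedBall 0 L := by
    ext T
    simp only [mem_ofPred_eq, mem_inter_iff, mem_iInter, mem_preimage, mem_closedBall_zero_iff]
    exact ⟨fun h => ⟨h.1, h.2⟩, fun h => ⟨h.1, h.2⟩⟩
  rw [this]
  refine (isClosed_biInter fun v _ => hC.preimage ?_).inter isClosed_closedBall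
  fun_prop

/-- A `C¹` map whose derivative is positive, and uniformly positive on a compact convex set
`K`. -/
structure PosMap (C : Set E) (e : E) (φ : E →L[ℝ] ℝ) (M c L : ℝ) (K : Set E) (F : E → E) :
    Prop where
  frame : ConeFrame C e φ M
  contDiff : ContDiff ℝ 1 F
  c_pos : 0 < c
  c_le : c ≤ 1
  le_L : 1 ≤ L
  isCompact : IsCompact K
  convex : Convex ℝ K
  unifPos : ∀ x ∈ K, UnifPos C e c L (fderiv ℝ F x)
  map_mem : ∀ x, ∀ v ∈ C, fderiv ℝ F x v ∈ C
  unit_le : ∀ x, ∃ κ : ℝ, 0 ≤ κ ∧ κ • fderiv ℝ F x e - e ∈ C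

namespace PosMap

variable {C : Set E} {e : E} {φ : E →L[ℝ] ℝ} {M c L : ℝ} {K : Set E} {F : E → E}

theorem fderiv_iterate_mem (H : PosMap C e φ M c L K F) (n : ℕ) (x : E) {v : E} (hv : v ∈ C) :
    fderiv ℝ F^[n] x v ∈ C := by
  induction n with
  | zero => rwa [fderiv_iterate_zero]
  | succ n ih => rw [fderiv_iterate_succ H.contDiff]; exact H.map_mem _ _ ih

theorem monotone [CompleteSpace E] (H : PosMap C e φ M c L K F) {a b : E} (hab : b - a ∈ C) :
    F b - F a ∈ C := by
  have hclosed : IsClosed {T : E →L[ℝ] E | ∀ v ∈ C, T v ∈ C} := by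
    simp only [ofPred_forall]
    exact isClosed_biInter fun v _ => H.frame.isClosed.preimage (by fun_prop)
  have hconv : Convex ℝ {T : E →L[ℝ] E | ∀ v ∈ C, T v ∈ C} :=
    fun T hT S hS a b ha hb _ v hv =>
      H.frame.add_mem (H.frame.smul_mem ha (hT v hv)) (H.frame.smul_mem hb (hS v hv))
  obtain ⟨T, hT, h⟩ := exists_mem_sub_eq_apply H.contDiff hconv hclosed (a := a) (b := b)
    fun x _ => H.map_mem x
  rw [h]
  exact hT _ hab

theorem iterate_monotone [CompleteSpace E] (H : PosMap C e φ M c L K F) {a b : E}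
    (hab : b - a ∈ C) (n : ℕ) : F^[n] b - F^[n] a ∈ C := by
  induction n with
  | zero => exact hab
  | succ n ih =>
    rw [Function.iterate_succ_apply', Function.iterate_succ_apply']
    exact H.monotone ih

theorem norm_functional_pos (H : PosMap C e φ M c L K F) : 0 < ‖φ‖ := by
  rw [norm_pos_iff]
  rintro rfl
  exact lt_irrefl _ H.frame.pos

theorem exists_lower_bound (H : PosMap C e φ M c L K F) : ∃ σ : ℝ, 0 < σ ∧
    ∀ x, (∀ n, F^[n] x ∈ K) → ∀ n,
      fderiv ℝ F^[n] x e - (σ * φ (fderiv ℝ F^[n] x e)) • e ∈ C := by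
  have hφ := H.norm_functional_pos
  have hL : 0 < L := one_pos.trans_le H.le_L
  have he := H.frame.pos
  have hc := H.c_pos
  refine ⟨min (φ e)⁻¹ (c / (‖φ‖ * L)), by positivity, fun x hx n => ?_⟩
  set σ := min (φ e)⁻¹ (c / (‖φ‖ * L))
  cases n with
  | zero =>
    have h1 : σ * φ e ≤ 1 := by
      rw [← le_div_iff₀ he, one_div]
      exact min_le_left _ _
    rw [fderiv_iterate_zero]
    convert H.frame.smul_mem (sub_nonneg.2 h1) H.frame.unit_mem using 1
    module
  | succ n =>
    rw [fderiv_iterate_succ H.contDiff]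
    set v := fderiv ℝ F^[n] x e
    have hv : v ∈ C := H.fderiv_iterate_mem n x H.frame.unit_mem
    have h1 := (H.unifPos _ (hx n)).lower v hv
    have h2 : σ * φ (fderiv ℝ F (F^[n] x) v) ≤ c * ‖v‖ := by
      have h3 : φ (fderiv ℝ F (F^[n] x) v) ≤ ‖φ‖ * (L * ‖v‖) :=
        (le_abs_self _).trans ((φ.le_opNorm _).trans
          (mul_le_mul_of_nonneg_left ((H.unifPos _ (hx n)).apply_le v) hφ.le))
      have h4 : 0 ≤ φ (fderiv ℝ F (F^[n] x) v) := H.frame.nonneg (H.map_mem _ _ hv)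
      calc σ * φ (fderiv ℝ F (F^[n] x) v)
          ≤ c / (‖φ‖ * L) * (‖φ‖ * (L * ‖v‖)) :=
            mul_le_mul (min_le_right _ _) h3 h4 (by positivity)
        _ = c * ‖v‖ := by field_simp
    convert H.frame.add_mem h1 (H.frame.smul_mem (sub_nonneg.2 h2) H.frame.unit_mem) using 1
    module

theorem exists_growth_lower_bound (H : PosMap C e φ M c L K F) : ∃ κ : ℝ, 0 < κ ∧ κ < 1 ∧
    ∀ x, (∀ n, F^[n] x ∈ K) → ∀ n,
      κ * φ (fderiv ℝ F^[n] x e) ≤ φ (fderiv ℝ F^[n + 1] x e) := by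
  have hφ := H.norm_functional_pos
  have he := H.frame.pos
  have hc := H.c_pos
  refine ⟨min (1 / 2) (c * φ e / ‖φ‖), by positivity, by
    have := min_le_left (1 / 2) (c * φ e / ‖φ‖); linarith, fun x hx n => ?_⟩
  rw [fderiv_iterate_succ H.contDiff]
  set v := fderiv ℝ F^[n] x e
  have hv : v ∈ C := H.fderiv_iterate_mem n x H.frame.unit_mem
  have h1 := H.frame.le_of_sub_mem ((H.unifPos _ (hx n)).lower v hv)
  rw [map_smul, smul_eq_mul] at h1
  refine le_trans ?_ h1
  have h2 : φ v ≤ ‖φ‖ * ‖v‖ := (le_abs_self _).trans (φ.le_opNorm v)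
  calc min (1 / 2) (c * φ e / ‖φ‖) * φ v ≤ c * φ e / ‖φ‖ * (‖φ‖ * ‖v‖) :=
        mul_le_mul (min_le_right _ _) h2 (H.frame.nonneg hv) (by positivity)
    _ = c * ‖v‖ * φ e := by field_simp

/-- If the growth after time `i` along the orbit of `x` is at most `θ ^ n`, then the derivatives
at `F^[i] x` grow at most like `θ ^ n`. -/
theorem fderiv_le_of_growth (H : PosMap C e φ M c L K F) {σ : ℝ} (hσ : 0 < σ) {x : E} {i : ℕ}
    (hlow : fderiv ℝ F^[i] x e - (σ * φ (fderiv ℝ F^[i] x e)) • e ∈ C)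
    (hpos : 0 < φ (fderiv ℝ F^[i] x e)) {θ : ℝ}
    (hgood : ∀ n, φ (fderiv ℝ F^[i + n] x e) ≤ θ ^ n * φ (fderiv ℝ F^[i] x e)) (n : ℕ) :
    φ (fderiv ℝ F^[n] (F^[i] x) e) ≤ σ⁻¹ * θ ^ n := by
  have h1 := H.frame.le_of_sub_mem (x := (σ * φ (fderiv ℝ F^[i] x e)) •
    fderiv ℝ F^[n] (F^[i] x) e) (y := fderiv ℝ F^[n] (F^[i] x) (fderiv ℝ F^[i] x e)) (by
      rw [← map_smul, ← map_sub]
      exact H.fderiv_iterate_mem n _ hlow)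
  rw [← fderiv_iterate_add H.contDiff, add_comm n i, map_smul, smul_eq_mul] at h1
  have h2 := h1.trans (hgood n)
  rw [inv_mul_eq_div, le_div_iff₀ hσ]
  refine le_of_mul_le_mul_right ?_ hpos
  linarith

theorem perturb_le (H : PosMap C e φ M c L K F) {A T : E →L[ℝ] E} (hA : UnifPos C e c L A)
    {θ ε : ℝ} (hθ : 1 ≤ θ) (hε : M * ε ≤ (θ - 1) * c) (hT : ‖T - A‖ ≤ ε) {v : E} (hv : v ∈ C) :
    θ • A v - T v ∈ C := by
  have hM := H.frame.M_pos
  have h1 : ((θ - 1) * (c * ‖v‖)) • e - (T - A) v ∈ C := by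
    refine H.frame.smul_unit_sub_mem ?_
    have h2 := (T - A).le_of_opNorm_le hT v
    nlinarith [norm_nonneg v, mul_le_mul_of_nonneg_left h2 hM.le]
  convert H.frame.add_mem h1 (H.frame.smul_mem (sub_nonneg.2 hθ) (hA.lower v hv)) using 1
  simp only [sub_apply]
  module

theorem exists_mean_operator [CompleteSpace E] (H : PosMap C e φ M c L K F) {ε : ℝ}
    (hε : 0 < ε) : ∃ δ : ℝ, 0 < δ ∧ ∀ a ∈ K, ∀ b ∈ K, ∃ T : E →L[ℝ] E, UnifPos C e c L T ∧
      (‖b - a‖ ≤ δ → ‖T - fderiv ℝ F a‖ ≤ ε) ∧ F b - F a = T (b - a) := by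
  have huc := H.isCompact.uniformContinuousOn_of_continuous
    (H.contDiff.continuous_fderiv one_ne_zero).continuousOn
  obtain ⟨δ, hδ, h⟩ := Metric.uniformContinuousOn_iff_le.1 huc ε hε
  refine ⟨δ, hδ, fun a ha b hb => ?_⟩
  have hseg := H.convex.segment_subset ha hb
  by_cases hab : ‖b - a‖ ≤ δ
  · have hball : ∀ x ∈ segment ℝ a b, fderiv ℝ F x ∈ closedBall (fderiv ℝ F a) ε := by
      intro x hx
      refine h x (hseg hx) a ha ?_
      rw [segment_eq_image'] at hx
      obtain ⟨s, hs, rfl⟩ := hx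
      rw [dist_eq_norm, add_sub_cancel_left, norm_smul, Real.norm_of_nonneg hs.1]
      exact (mul_le_of_le_one_left (norm_nonneg _) hs.2).trans hab
    obtain ⟨T, hT, hTab⟩ := exists_mem_sub_eq_apply H.contDiff
      ((UnifPos.convex_setOf H.frame c L).inter (convex_closedBall (fderiv ℝ F a) ε))
      ((UnifPos.isClosed_setOf H.frame.isClosed e c L).inter isClosed_closedBall)
      (a := a) (b := b) fun x hx => ⟨H.unifPos x (hseg hx), hball x hx⟩
    exact ⟨T, hT.1, fun _ => by simpa [dist_eq_norm] using hT.2, hTab⟩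
  · obtain ⟨T, hT, hTab⟩ := exists_mem_sub_eq_apply H.contDiff
      (UnifPos.convex_setOf H.frame c L) (UnifPos.isClosed_setOf H.frame.isClosed e c L)
      (a := a) (b := b) fun x hx => H.unifPos x (hseg hx)
    exact ⟨T, hT, fun h => absurd h hab, hTab⟩

/-- Two nearby orbits, one of which has slow derivative growth, either become comparable or
approach each other at a summable rate. -/
theorem exists_comparable_or_summable [CompleteSpace E] (H : PosMap C e φ M c L K F) :
    ∃ θ : ℝ, 1 < θ ∧ ∀ B : ℝ, 0 < B → ∃ ε : ℝ, 0 < ε ∧ ∀ a b : E,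
      (∀ n, F^[n] a ∈ K) → (∀ n, F^[n] b ∈ K) → ‖b - a‖ ≤ ε →
      (∀ n, φ (fderiv ℝ F^[n] a e) ≤ B * θ ^ n) →
      (∃ n, F^[n] b - F^[n] a ∈ C ∨ F^[n] a - F^[n] b ∈ C) ∨
        Summable fun n => ‖F^[n] b - F^[n] a‖ := by
  obtain ⟨hγ0, hγ1⟩ := contraction_factor_mem H.frame H.c_pos H.c_le H.le_L
  set γ := 1 - c / (2 * M * L) with hγ
  have hM := H.frame.M_pos
  have hc := H.c_pos
  set θ := 1 + (1 - γ) / 3 with hθdef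
  have hθ : 1 < θ := by linarith
  have hq1 : γ * θ ^ 2 < 1 := by
    have h0 : 0 < 1 - γ := by linarith
    have : γ * θ ^ 2 = 1 - (1 - γ) / 3 - 5 * (1 - γ) ^ 2 / 9 - (1 - γ) ^ 3 / 9 := by
      rw [hθdef]; ring
    have h2 : 0 < (1 - γ) ^ 2 := by positivity
    have h3 : 0 < (1 - γ) ^ 3 := by positivity
    linarith
  set q := γ * θ ^ 2 with hq
  have hq0 : 0 < q := by positivity
  refine ⟨θ, hθ, fun B hB => ?_⟩
  obtain ⟨δ, hδ, hmean⟩ := H.exists_mean_operator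
    (ε := (θ - 1) * c / M) (div_pos (mul_pos (by linarith) hc) hM)
  refine ⟨δ / (6 * M * B), by positivity, fun a b ha hb hab hgood => ?_⟩
  by_contra! hcon
  obtain ⟨hcomp, hsum⟩ := hcon
  choose T hT hTclose hTeq using fun n => hmean (F^[n] a) (ha n) (F^[n] b) (hb n)
  let u : ℕ → E := fun n => Nat.rec e (fun n v => T n v) n
  have hu : ∀ n, u (n + 1) = T n (u n) := fun n => rfl
  have hw : ∀ n, F^[n + 1] b - F^[n + 1] a = T n (F^[n] b - F^[n] a) := fun n => by
    rw [Function.iterate_succ_apply', Function.iterate_succ_apply', hTeq]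
  have hsep := norm_le_of_not_comparable H.frame hc H.c_le H.le_L hT (u := u)
    (w := fun n => F^[n] b - F^[n] a) rfl hu hw (fun n => (hcomp n).1)
    (fun n => by simpa using (hcomp n).2)
  have hbound : ∀ n, θ ^ n • fderiv ℝ F^[n] a e - u n ∈ C →
      ‖F^[n] b - F^[n] a‖ ≤ 6 * M * B * ‖b - a‖ * q ^ n := by
    intro n hn
    have h1 := H.frame.le_of_sub_mem hn
    rw [map_smul, smul_eq_mul] at h1
    have h2 : φ (u n) ≤ θ ^ n * (B * θ ^ n) :=
      h1.trans (mul_le_mul_of_nonneg_left (hgood n) (by positivity))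
    calc ‖F^[n] b - F^[n] a‖ ≤ 6 * M * ‖b - a‖ * γ ^ n * φ (u n) := hsep n
      _ ≤ 6 * M * ‖b - a‖ * γ ^ n * (θ ^ n * (B * θ ^ n)) :=
        mul_le_mul_of_nonneg_left h2 (by positivity)
      _ = 6 * M * B * ‖b - a‖ * q ^ n := by
        rw [hq, mul_pow, ← pow_mul, mul_comm 2 n, pow_mul]; ring
  have hC1 : 6 * M * B * ‖b - a‖ ≤ δ := by
    rwa [le_div_iff₀ (by positivity), mul_comm] at hab
  have hmain : ∀ n, θ ^ n • fderiv ℝ F^[n] a e - u n ∈ C := by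
    intro n
    induction n with
    | zero =>
      rw [fderiv_iterate_zero, pow_zero, one_smul]
      simpa [u] using H.frame.zero_mem
    | succ n ih =>
      have h1 : ‖F^[n] b - F^[n] a‖ ≤ δ :=
        ((hbound n ih).trans (mul_le_of_le_one_right (by positivity)
          (pow_le_one₀ hq0.le hq1.le))).trans hC1
      have h2 := H.perturb_le (H.unifPos _ (ha n)) hθ.le (by field_simp; rfl)
        (hTclose n h1) (H.fderiv_iterate_mem n a H.frame.unit_mem)
      have h3 := (hT n).map_mem H.frame hc ih
      rw [hu, fderiv_iterate_succ H.contDiff]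
      convert H.frame.add_mem (H.frame.smul_mem (by positivity : 0 ≤ θ ^ n) h2) h3 using 1
      rw [map_sub, map_smul, pow_succ]
      module
  exact hsum (Summable.of_nonneg_of_le (fun n => norm_nonneg _) (fun n => hbound n (hmain n))
    ((summable_geometric_of_lt_one hq0.le hq1).mul_left _))

end PosMap

section GrowthTimes

/-- The sequence `s` grows at most like `θ ^ n` after time `i`. -/
def IsSlowTime (s : ℕ → ℝ) (θ : ℝ) (i : ℕ) : Prop :=
  ∀ n, s (i + n) ≤ θ ^ n * s i

variable {s : ℕ → ℝ} {κ θ : ℝ}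

open Classical in
/-- A Pliss-type estimate: rare slow times force fast growth. -/
theorem exists_large_value (hκ : 0 < κ) (hκ1 : κ < 1) (hθ : 1 < θ) (hpos : ∀ n, 0 < s n)
    (hs : ∀ n, κ * s n ≤ s (n + 1)) (i : ℕ) :
    ∃ j, i ≤ j ∧
      (κ / θ) ^ ((Finset.range i).filter (IsSlowTime s θ)).card * s 0 * θ ^ j ≤ s j := by
  have hθ0 : 0 < θ := one_pos.trans hθ
  have hρ0 : 0 < κ / θ := div_pos hκ hθ0
  have hρ1 : κ / θ ≤ 1 := (div_le_one hθ0).2 (hκ1.trans hθ).le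
  induction i with
  | zero => exact ⟨0, le_rfl, by simp⟩
  | succ i ih =>
    obtain ⟨j, hij, hj⟩ := ih
    have hmono : ∀ t : ℝ, 0 ≤ t →
        (κ / θ) ^ ((Finset.range (i + 1)).filter (IsSlowTime s θ)).card * s 0 * t ≤
        (κ / θ) ^ ((Finset.range i).filter (IsSlowTime s θ)).card * s 0 * t := by
      intro t ht
      have := pow_le_pow_of_le_one hρ0.le hρ1 (Finset.card_le_card
        (Finset.filter_subset_filter (IsSlowTime s θ) (Finset.range_mono (Nat.le_succ i))))
      gcongr
      exact (hpos 0).le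
    rcases hij.eq_or_lt with rfl | hij
    · by_cases hi : IsSlowTime s θ i
      · refine ⟨i + 1, le_rfl, le_trans ?_ (hs i)⟩
        rw [Finset.range_add_one, Finset.filter_insert, if_pos hi, Finset.card_insert_of_notMem
          (by simp), pow_succ, pow_succ]
        calc _ = κ * ((κ / θ) ^ ((Finset.range i).filter (IsSlowTime s θ)).card * s 0 * θ ^ i) := by
              field_simp
          _ ≤ _ := mul_le_mul_of_nonneg_left hj hκ.le
      · unfold IsSlowTime at hi
        push Not at hi
        obtain ⟨n, hn⟩ := hi
        rcases Nat.eq_zero_or_pos n with rfl | hn0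
        · simp at hn
        refine ⟨i + n, by omega, (hmono _ (by positivity)).trans (le_trans ?_ hn.le)⟩
        rw [pow_add]
        calc _ = θ ^ n * ((κ / θ) ^ ((Finset.range i).filter (IsSlowTime s θ)).card * s 0 *
              θ ^ i) := by ring
          _ ≤ _ := mul_le_mul_of_nonneg_left hj (by positivity)
    · exact ⟨j, hij, (hmono _ (by positivity)).trans hj⟩

theorem exists_slowTime_ge (hκ : 0 < κ) (hκ1 : κ < 1) (hθ : 1 < θ) (hpos : ∀ n, 0 < s n)
    (hs : ∀ n, κ * s n ≤ s (n + 1)) (hlim : Tendsto (fun n => s n / θ ^ n) atTop (𝓝 0))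
    (N : ℕ) : ∃ i, N ≤ i ∧ IsSlowTime s θ i := by
  classical
  by_contra! hcon
  have hθ0 : 0 < θ := one_pos.trans hθ
  have hρ0 : 0 < κ / θ := div_pos hκ hθ0
  have hρ1 : κ / θ ≤ 1 := (div_le_one hθ0).2 (hκ1.trans hθ).le
  have h0 : 0 < (κ / θ) ^ N * s 0 := mul_pos (pow_pos hρ0 N) (hpos 0)
  obtain ⟨n, hn⟩ := eventually_atTop.1 (hlim.eventually_lt_const h0)
  obtain ⟨j, hnj, hj⟩ := exists_large_value hκ hκ1 hθ hpos hs n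
  have hcard : ((Finset.range n).filter (IsSlowTime s θ)).card ≤ N := by
    calc _ ≤ (Finset.range N).card := Finset.card_le_card fun i hi => by
          rw [Finset.mem_filter] at hi
          rw [Finset.mem_range]
          by_contra! hNi
          exact hcon i hNi hi.2
      _ = N := Finset.card_range N
  have h1 := hn j hnj
  rw [div_lt_iff₀ (by positivity)] at h1
  have h2 := pow_le_pow_of_le_one hρ0.le hρ1 hcard
  have h3 := (hpos 0).le
  have h4 : (κ / θ) ^ N * s 0 * θ ^ j ≤
      (κ / θ) ^ ((Finset.range n).filter (IsSlowTime s θ)).card * s 0 * θ ^ j := by gcongr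
  linarith

omit [NormedSpace ℝ E] in
theorem exists_card_bound {K : Set E} (hK : IsCompact K) {ε : ℝ} (hε : 0 < ε) :
    ∃ N : ℕ, ∀ (S : Finset ℕ) (f : ℕ → E), (∀ i ∈ S, f i ∈ K) → N < S.card →
      ∃ i ∈ S, ∃ j ∈ S, i < j ∧ ‖f j - f i‖ ≤ ε := by
  obtain ⟨t, ht, hcov⟩ := Metric.totallyBounded_iff.1 hK.totallyBounded (ε / 2) (half_pos hε)
  refine ⟨ht.toFinset.card, fun S f hf hcard => ?_⟩
  have hex : ∀ i, ∃ y, i ∈ S → y ∈ t ∧ dist (f i) y < ε / 2 := by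
    intro i
    by_cases hi : i ∈ S
    · obtain ⟨y, hy, hd⟩ := mem_iUnion₂.1 (hcov (hf i hi))
      exact ⟨y, fun _ => ⟨hy, hd⟩⟩
    · exact ⟨0, fun h => absurd h hi⟩
  choose g hg using hex
  obtain ⟨i, hi, j, hj, hij, hgij⟩ := Finset.exists_ne_map_eq_of_card_lt_of_maps_to hcard
    (f := g) fun i hi => by simpa using (hg i hi).1
  have hd : ‖f j - f i‖ ≤ ε := by
    rw [← dist_eq_norm]
    have h1 := (hg i hi).2
    have h2 := (hg j hj).2
    rw [hgij] at h1
    have := dist_triangle_right (f j) (f i) (g j)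
    linarith
  rcases hij.lt_or_gt with h | h
  · exact ⟨i, hi, j, hj, h, hd⟩
  · exact ⟨j, hj, i, hi, h, by rwa [norm_sub_rev]⟩

end GrowthTimes

section MonotoneSequences

variable {C : Set E} {e : E} {φ : E →L[ℝ] ℝ} {M : ℝ}

theorem ConeFrame.exists_tendsto_of_monotone [CompleteSpace E] (h : ConeFrame C e φ M)
    {a : ℕ → E} (ha : ∀ n, a (n + 1) - a n ∈ C) {R : ℝ} (hR : ∀ n, ‖a n‖ ≤ R) :
    ∃ z, Tendsto a atTop (𝓝 z) := by
  refine cauchySeq_tendsto_of_complete (cauchySeq_of_summable_dist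
    (summable_of_sum_range_le (c := ‖φ‖ * R + ‖φ‖ * R) (fun n => dist_nonneg) fun n => ?_))
  have hφ : ∀ n, |φ (a n)| ≤ ‖φ‖ * R := fun n =>
    (φ.le_opNorm _).trans (mul_le_mul_of_nonneg_left (hR n) (norm_nonneg _))
  calc ∑ i ∈ Finset.range n, dist (a i) (a i.succ)
      ≤ ∑ i ∈ Finset.range n, (φ (a (i + 1)) - φ (a i)) := by
        refine Finset.sum_le_sum fun i _ => ?_
        rw [dist_comm, dist_eq_norm, ← map_sub]
        exact h.norm_le (ha i)
    _ = φ (a n) - φ (a 0) := Finset.sum_range_sub (fun i => φ (a i)) n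
    _ ≤ ‖φ‖ * R + ‖φ‖ * R := by
        have h1 := (abs_le.1 (hφ n)).2
        have h2 := (abs_le.1 (hφ 0)).1
        linarith

theorem ConeFrame.exists_tendsto_of_antitone [CompleteSpace E] (h : ConeFrame C e φ M)
    {a : ℕ → E} (ha : ∀ n, a n - a (n + 1) ∈ C) {R : ℝ} (hR : ∀ n, ‖a n‖ ≤ R) :
    ∃ z, Tendsto a atTop (𝓝 z) := by
  obtain ⟨z, hz⟩ := h.exists_tendsto_of_monotone (a := fun n => -a n) (R := R)
    (fun n => by simpa [add_comm, sub_eq_add_neg] using ha n) (by simpa using hR)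
  exact ⟨-z, by simpa using hz.neg⟩

theorem ConeFrame.sub_mem_of_le (h : ConeFrame C e φ M) {a : ℕ → E}
    (ha : ∀ n, a (n + 1) - a n ∈ C) {m n : ℕ} (hmn : m ≤ n) : a n - a m ∈ C := by
  induction n, hmn using Nat.le_induction with
  | base => simpa using h.zero_mem
  | succ n _ ih => simpa using h.add_mem (ha n) ih

theorem ConeFrame.eq_of_monotone_of_eq (h : ConeFrame C e φ M) {a : ℕ → E}
    (ha : ∀ n, a (n + 1) - a n ∈ C) {n : ℕ} (hn : 0 < n) (h0 : a n = a 0) : a 1 = a 0 := by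
  have h1 : a n - a 1 ∈ C := h.sub_mem_of_le ha hn
  rw [h0, ← neg_sub] at h1
  exact sub_eq_zero.1 (h.eq_zero_of_mem_neg_mem (ha 0) h1)

theorem ConeFrame.eq_of_antitone_of_eq (h : ConeFrame C e φ M) {a : ℕ → E}
    (ha : ∀ n, a n - a (n + 1) ∈ C) {n : ℕ} (hn : 0 < n) (h0 : a n = a 0) : a 1 = a 0 := by
  have := h.eq_of_monotone_of_eq (a := fun n => -a n)
    (fun n => by simpa [add_comm, sub_eq_add_neg] using ha n) hn (by simpa using h0)
  simpa using this

end MonotoneSequences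

/-- The derivative growth along the orbit of `x` is subexponential. -/
def SlowGrowth (e : E) (φ : E →L[ℝ] ℝ) (F : E → E) (x : E) : Prop :=
  ∀ θ : ℝ, 1 < θ → Tendsto (fun n => φ (fderiv ℝ F^[n] x e) / θ ^ n) atTop (𝓝 0)

theorem iterate_comm {α : Type*} (F : α → α) (m n : ℕ) (x : α) : F^[m] (F^[n] x) = F^[n] (F^[m] x) := by
  rw [← Function.iterate_add_apply, add_comm, Function.iterate_add_apply]

namespace PosMap

variable {C : Set E} {e : E} {φ : E →L[ℝ] ℝ} {M c L : ℝ} {K : Set E} {F : E → E}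

theorem nonneg_fderiv (H : PosMap C e φ M c L K F) (n : ℕ) (x : E) :
    0 ≤ φ (fderiv ℝ F^[n] x e) :=
  H.frame.nonneg (H.fderiv_iterate_mem n x H.frame.unit_mem)

theorem slowGrowth_map (H : PosMap C e φ M c L K F) {x : E} (hx : SlowGrowth e φ F x) :
    SlowGrowth e φ F (F x) := by
  intro θ hθ
  have hθ0 : 0 < θ := one_pos.trans hθ
  obtain ⟨κ, hκ, hle⟩ := H.unit_le x
  have h1 : ∀ n, φ (fderiv ℝ F^[n] (F x) e) / θ ^ n ≤
      κ * θ * (φ (fderiv ℝ F^[n + 1] x e) / θ ^ (n + 1)) := by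
    intro n
    have h2 := H.fderiv_iterate_mem n (F x) hle
    rw [map_sub, map_smul] at h2
    have h3 := H.frame.le_of_sub_mem h2
    have h4 : fderiv ℝ F^[n] (F x) (fderiv ℝ F x e) = fderiv ℝ F^[n + 1] x e :=
      (fderiv_iterate_add H.contDiff n 1 x e).symm
    rw [h4, map_smul, smul_eq_mul] at h3
    calc _ ≤ κ * φ (fderiv ℝ F^[n + 1] x e) / θ ^ n := by gcongr
      _ = _ := by rw [pow_succ]; field_simp
  refine squeeze_zero (fun n => div_nonneg (H.nonneg_fderiv n _) (by positivity)) h1 ?_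
  simpa using ((hx θ hθ).comp (tendsto_add_atTop_nat 1)).const_mul (κ * θ)

theorem slowGrowth_iterate (H : PosMap C e φ M c L K F) {x : E} (hx : SlowGrowth e φ F x)
    (m : ℕ) : SlowGrowth e φ F (F^[m] x) := by
  induction m with
  | zero => exact hx
  | succ m ih => rw [Function.iterate_succ_apply']; exact H.slowGrowth_map ih

theorem pos_fderiv (H : PosMap C e φ M c L K F) {x : E} (hx : ∀ n, F^[n] x ∈ K) (n : ℕ) :
    0 < φ (fderiv ℝ F^[n] x e) := by
  obtain ⟨κ, hκ, -, h⟩ := H.exists_growth_lower_bound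
  induction n with
  | zero => rw [fderiv_iterate_zero]; exact H.frame.pos
  | succ n ih => exact (mul_pos hκ ih).trans_le (h x hx n)

theorem exists_tendsto (H : PosMap C e φ M c L K F) [CompleteSpace E] {x : E}
    (hx : ∀ n, F^[n] x ∈ K) (hslow : SlowGrowth e φ F x) :
    ∃ m p z, 0 < p ∧ Tendsto (fun k => F^[p * k] (F^[m] x)) atTop (𝓝 z) := by
  obtain ⟨κ, hκ, hκ1, hgrow⟩ := H.exists_growth_lower_bound
  obtain ⟨σ, hσ, hlow⟩ := H.exists_lower_bound
  obtain ⟨θ, hθ, hθε⟩ := H.exists_comparable_or_summable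
  obtain ⟨ε, hε, hclose⟩ := hθε σ⁻¹ (inv_pos.2 hσ)
  obtain ⟨N, hN⟩ := exists_card_bound H.isCompact hε
  have hinf : {i | IsSlowTime (fun n => φ (fderiv ℝ F^[n] x e)) θ i}.Infinite :=
    Nat.frequently_atTop_iff_infinite.1 (frequently_atTop.2
      (exists_slowTime_ge hκ hκ1 hθ (H.pos_fderiv hx) (hgrow x hx) (hslow θ hθ)))
  obtain ⟨S, hS, hcard⟩ := hinf.exists_subset_card_eq (N + 1)
  obtain ⟨i, hi, j, hj, hij, hd⟩ := hN S (fun n => F^[n] x) (fun i _ => hx i) (by omega)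
  obtain ⟨R, hR⟩ := H.isCompact.isBounded.exists_norm_le
  have hshift : ∀ m n, F^[n] (F^[m] x) ∈ K := fun m n => by
    rw [← Function.iterate_add_apply]; exact hx _
  obtain ⟨p, hp, rfl⟩ : ∃ p, 0 < p ∧ j = p + i := ⟨j - i, by omega, by omega⟩
  have hcase := hclose (F^[i] x) (F^[p + i] x) (hshift i) (hshift _) hd
    (H.fderiv_le_of_growth hσ (hlow x hx i) (H.pos_fderiv hx i) (hS hi))
  have hstep : ∀ n k, F^[p * (k + 1)] (F^[n + i] x) =
      F^[p * k] (F^[n] (F^[p + i] x)) := by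
    intro n k
    simp only [← Function.iterate_add_apply]
    exact congrArg (fun t => F^[t] x) (by ring)
  have hstep0 : ∀ n k, F^[p * k] (F^[n + i] x) = F^[p * k] (F^[n] (F^[i] x)) := by
    intro n k
    rw [Function.iterate_add_apply F n i]
  rcases hcase with ⟨n, hn | hn⟩ | hsum
  · obtain ⟨z, hz⟩ := H.frame.exists_tendsto_of_monotone (a := fun k => F^[p * k] (F^[n + i] x))
      (fun k => by rw [hstep, hstep0]; exact H.iterate_monotone hn _) (fun k => hR _ (hshift _ _))
    exact ⟨n + i, p, z, hp, hz⟩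
  · obtain ⟨z, hz⟩ := H.frame.exists_tendsto_of_antitone (a := fun k => F^[p * k] (F^[n + i] x))
      (fun k => by rw [hstep, hstep0]; exact H.iterate_monotone hn _) (fun k => hR _ (hshift _ _))
    exact ⟨n + i, p, z, hp, hz⟩
  · obtain ⟨z, hz⟩ := cauchySeq_tendsto_of_complete
      (cauchySeq_of_summable_dist (f := fun k => F^[p * k] (F^[0 + i] x)) (by
        refine (hsum.comp_injective (i := fun k => p * k)
          (mul_right_injective₀ hp.ne')).congr fun k => ?_
        rw [dist_comm, dist_eq_norm, Nat.succ_eq_add_one, hstep, hstep0]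
        rfl))
    exact ⟨0 + i, p, z, hp, hz⟩

end PosMap

section OmegaLimit

variable {F : E → E}

omit [NormedSpace ℝ E] in
theorem omegaMap_iterate (F : E → E) (m : ℕ) (x : E) :
    omegaMap F (F^[m] x) = omegaMap F x := by
  refine Subset.antisymm (subset_iInter fun k => ?_) (subset_iInter fun k => ?_)
  · refine (iInter_subset _ k).trans (closure_mono ?_)
    rintro _ ⟨n, hn, rfl⟩
    exact ⟨n + m, by omega, (Function.iterate_add_apply F n m x).symm⟩
  · refine (iInter_subset _ (k + m)).trans (closure_mono ?_)
    rintro _ ⟨n, hn, rfl⟩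
    refine ⟨n - m, by omega, ?_⟩
    rw [← Function.iterate_add_apply, Nat.sub_add_cancel (by omega)]

omit [NormedSpace ℝ E] in
theorem tendsto_dist_iterate (hF : Continuous F) {y z : E} {p : ℕ} (hp : 0 < p)
    (hz : F^[p] z = z) (h : Tendsto (fun k => F^[p * k] y) atTop (𝓝 z)) :
    Tendsto (fun n => dist (F^[n] y) (F^[n] z)) atTop (𝓝 0) := by
  have hg : Continuous fun w => ∑ j ∈ Finset.range p, dist (F^[j] w) (F^[j] z) :=
    continuous_finsetSum _ fun j _ => (hF.iterate j).dist continuous_const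
  have h1 := (hg.tendsto z).comp (h.comp (Nat.tendsto_div_const_atTop hp.ne'))
  simp only [dist_self, Finset.sum_const_zero] at h1
  refine squeeze_zero (fun n => dist_nonneg) (fun n => ?_) h1
  have h2 : F^[n] y = F^[n % p] (F^[p * (n / p)] y) := by
    rw [← Function.iterate_add_apply, Nat.mod_add_div]
  have h3 : F^[n] z = F^[n % p] z :=
    (Function.IsPeriodicPt.iterate_mod_apply (f := F) (n := p) hz n).symm
  rw [h2, h3]
  exact Finset.single_le_sum (f := fun j => dist (F^[j] (F^[p * (n / p)] y)) (F^[j] z))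
    (fun j _ => dist_nonneg) (Finset.mem_range.2 (Nat.mod_lt n hp))

omit [NormedSpace ℝ E] in
theorem omegaMap_eq_of_tendsto (hF : Continuous F) {y z : E} {p : ℕ} (hp : 0 < p)
    (hz : F^[p] z = z) (h : Tendsto (fun k => F^[p * k] y) atTop (𝓝 z)) :
    omegaMap F y = {w | ∃ n, w = F^[n] z} := by
  have hdist := tendsto_dist_iterate hF hp hz h
  have hclosed : IsClosed {w | ∃ n, w = F^[n] z} := by
    refine (((Set.finite_lt_nat p).image fun n => F^[n] z).subset ?_).isClosed
    rintro _ ⟨n, rfl⟩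
    exact ⟨n % p, Nat.mod_lt n hp, Function.IsPeriodicPt.iterate_mod_apply (f := F) hz n⟩
  refine Subset.antisymm (fun w hw => ?_) ?_
  · rw [← hclosed.closure_eq, Metric.mem_closure_iff]
    intro ε hε
    obtain ⟨k, hk⟩ := eventually_atTop.1 (hdist.eventually_lt_const (half_pos hε))
    obtain ⟨_, ⟨n, hn, rfl⟩, hd⟩ := Metric.mem_closure_iff.1 (mem_iInter.1 hw k) _ (half_pos hε)
    refine ⟨_, ⟨n, rfl⟩, ?_⟩
    have := dist_triangle w (F^[n] y) (F^[n] z)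
    linarith [hk n hn]
  · rintro _ ⟨n, rfl⟩
    refine mem_iInter.2 fun k => mem_closure_of_tendsto (((hF.iterate n).tendsto z).comp h) ?_
    filter_upwards [eventually_ge_atTop k] with j hj
    refine ⟨n + p * j, ?_, (Function.iterate_add_apply F n _ y).symm⟩
    have := Nat.le_mul_of_pos_left j hp
    omega

theorem iterate_eq_of_iterate_eq {α : Type*} {f : α → α} {z : α} {p d n : ℕ} (hp : 0 < p)
    (hz : f^[p] z = z) (h : f^[d] (f^[n] z) = f^[n] z) : f^[d] z = z := by
  have h1 : f^[p * n] z = z := Function.IsPeriodicPt.mul_const (f := f) hz n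
  have h2 : n ≤ p * n := Nat.le_mul_of_pos_left n hp
  have h3 := congrArg f^[p * n - n] h
  rwa [iterate_comm, ← Function.iterate_add_apply f _ n, Nat.sub_add_cancel h2, h1] at h3

end OmegaLimit

theorem spectralRadius_le_one_of_norm_pow_le [CompleteSpace E] {T : E →L[ℝ] E} {R : ℝ}
    (hT : ∀ k, ‖T ^ k‖ ≤ R) : spectralRadius ℝ T ≤ 1 := by
  refine iSup₂_le fun μ hμ => ?_
  have h1 : ∀ k, ‖μ‖ ^ k ≤ R * ‖(1 : E →L[ℝ] E)‖ := fun k => by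
    rw [← norm_pow]
    exact (spectrum.norm_le_norm_mul_of_mem (spectrum.pow_mem_pow T k hμ)).trans
      (mul_le_mul_of_nonneg_right (hT k) (norm_nonneg _))
  have h2 : ‖μ‖ ≤ 1 := by
    by_contra! hcon
    obtain ⟨k, hk⟩ := pow_unbounded_of_one_lt (R * ‖(1 : E →L[ℝ] E)‖) hcon
    exact (h1 k).not_gt hk
  exact_mod_cast h2

namespace PosMap

variable {C : Set E} {e : E} {φ : E →L[ℝ] ℝ} {M c L : ℝ} {K : Set E} {F : E → E}

theorem norm_fderiv_iterate_le (H : PosMap C e φ M c L K F) (n : ℕ) (x : E) :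
    ‖fderiv ℝ F^[n] x‖ ≤ 3 * M * φ (fderiv ℝ F^[n] x e) := by
  have hM := H.frame.M_pos
  have h0 := H.nonneg_fderiv n x
  refine ContinuousLinearMap.opNorm_le_bound _ (by positivity) fun v => ?_
  have h1 := H.frame.norm_le_of_mem_interval (t := M * ‖v‖) (u := fderiv ℝ F^[n] x e)
    (w := fderiv ℝ F^[n] x v) (by positivity) (H.fderiv_iterate_mem n x H.frame.unit_mem)
    (by rw [← map_smul, ← map_add]; exact H.fderiv_iterate_mem n x (H.frame.add_unit_mem v))
    (by rw [← map_smul, ← map_sub]; exact H.fderiv_iterate_mem n x (H.frame.sub_mem v))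
  linarith

theorem spectralRadius_le_one [CompleteSpace E] (H : PosMap C e φ M c L K F) {z : E} {p : ℕ}
    (hz : F^[p] z = z) {B : ℝ} (hB : ∀ n, φ (fderiv ℝ F^[n] z e) ≤ B) :
    spectralRadius ℝ (fderiv ℝ F^[p] z) ≤ 1 := by
  have hpow : ∀ k, fderiv ℝ F^[p] z ^ k = fderiv ℝ F^[p * k] z := by
    intro k
    ext v
    induction k generalizing v with
    | zero => rw [mul_zero, fderiv_iterate_zero, pow_zero]; rfl
    | succ k ih =>
      rw [mul_add, mul_one, fderiv_iterate_add H.contDiff, hz, pow_succ]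
      exact ih _
  refine spectralRadius_le_one_of_norm_pow_le (R := 3 * M * B) fun k => ?_
  have hM := H.frame.M_pos
  rw [hpow]
  exact (H.norm_fderiv_iterate_le _ _).trans (by gcongr; exact hB _)

theorem pow_smul_unit_le (H : PosMap C e φ M c L K F) {x : E} {q : ℕ} {r : ℝ} (hr : 0 ≤ r)
    (h : ∀ k, fderiv ℝ F^[q] (F^[q * k] x) e - r • e ∈ C) (k : ℕ) :
    fderiv ℝ F^[q * k] x e - r ^ k • e ∈ C := by
  induction k with
  | zero => simpa [fderiv_iterate_zero] using H.frame.zero_mem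
  | succ k ih =>
    have h1 := H.fderiv_iterate_mem q (F^[q * k] x) ih
    have h2 := H.frame.smul_mem (pow_nonneg hr k) (h k)
    rw [mul_add, mul_one, add_comm, fderiv_iterate_add H.contDiff]
    convert H.frame.add_mem h1 h2 using 1
    rw [map_sub, map_smul, smul_sub, smul_smul, pow_succ]
    abel

theorem not_doubling (H : PosMap C e φ M c L K F) {y z : E} {p : ℕ} (hp : 0 < p)
    (hslow : SlowGrowth e φ F y) (hlim : Tendsto (fun k => F^[p * k] y) atTop (𝓝 z))
    {j : ℕ} (hj : 0 < j) (hz : F^[j] z = z) : fderiv ℝ F^[j] z e - (2 : ℝ) • e ∉ C := by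
  intro hdoub
  have hq : 0 < j * p := Nat.mul_pos hj hp
  have hM := H.frame.M_pos
  have h1 : fderiv ℝ F^[j * p] z e - (2 : ℝ) • e ∈ C := by
    have h2 := H.pow_smul_unit_le (x := z) zero_le_two
      (fun k => by rwa [Function.IsPeriodicPt.mul_const (f := F) hz k]) p
    have h3 : (2 : ℝ) ≤ 2 ^ p := by simpa using pow_le_pow_right₀ one_le_two hp
    convert H.frame.add_mem h2 (H.frame.smul_mem (sub_nonneg.2 h3) H.frame.unit_mem) using 1
    rw [sub_smul]
    abel
  have hcont : Continuous fun w => fderiv ℝ F^[j * p] w e :=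
    ((contDiff_iterate H.contDiff _).continuous_fderiv one_ne_zero).clm_apply continuous_const
  have hnear : ∀ᶠ w in 𝓝 z, fderiv ℝ F^[j * p] w e - (3 / 2 : ℝ) • e ∈ C := by
    filter_upwards [Metric.tendsto_nhds.1 (hcont.tendsto z) (1 / (2 * M)) (by positivity)]
      with w hw
    rw [dist_comm, dist_eq_norm, lt_div_iff₀ (by positivity)] at hw
    convert H.frame.add_mem h1 (H.frame.smul_unit_sub_mem (r := 1 / 2)
      (v := fderiv ℝ F^[j * p] z e - fderiv ℝ F^[j * p] w e) (by linarith)) using 1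
    module
  obtain ⟨k₀, hk₀⟩ := eventually_atTop.1 (hlim.eventually hnear)
  have h2 := H.pow_smul_unit_le (x := F^[p * (j * k₀)] y) (q := j * p) (r := 3 / 2) (by norm_num)
    fun k => by
      rw [← Function.iterate_add_apply]
      have h3 := hk₀ (j * k + j * k₀) (by
        have := Nat.le_mul_of_pos_left k₀ hj
        omega)
      rwa [show p * (j * k + j * k₀) = j * p * k + p * (j * k₀) by ring] at h3
  set θ : ℝ := (3 / 2 : ℝ) ^ ((j * p : ℕ) : ℝ)⁻¹ with hθ
  have hθ1 : 1 < θ := Real.one_lt_rpow (by norm_num) (by positivity)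
  have hθq : ∀ k, θ ^ (j * p * k) = (3 / 2 : ℝ) ^ k := fun k => by
    rw [pow_mul, hθ, Real.rpow_inv_natCast_pow (by norm_num) hq.ne']
  have h3 := ((H.slowGrowth_iterate hslow (p * (j * k₀))) θ hθ1).comp
    (tendsto_id.const_mul_atTop' hq)
  refine H.frame.pos.not_ge (ge_of_tendsto' h3 fun k => ?_)
  have h4 := H.frame.le_of_sub_mem (h2 k)
  rw [map_smul, smul_eq_mul] at h4
  simp only [Function.comp_apply, id_eq]
  rw [hθq, le_div_iff₀ (by positivity)]
  linarith

theorem exists_fderiv_le (H : PosMap C e φ M c L K F) {z : E} {p : ℕ} (hp : 0 < p)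
    (hz : F^[p] z = z) (hK : ∀ n, F^[n] z ∈ K)
    (hno : ∀ j, 0 < j → F^[j] z = z → fderiv ℝ F^[j] z e - (2 : ℝ) • e ∉ C) :
    ∃ B, ∀ n, φ (fderiv ℝ F^[n] z e) ≤ B := by
  obtain ⟨κ, hκ, hκ1, hgrow⟩ := H.exists_growth_lower_bound
  obtain ⟨σ, hσ, hlow⟩ := H.exists_lower_bound
  refine ⟨2 / σ / κ ^ p, fun n => ?_⟩
  have h1 : ∀ i, κ ^ i * φ (fderiv ℝ F^[n] z e) ≤ φ (fderiv ℝ F^[n + i] z e) := by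
    intro i
    induction i with
    | zero => simp
    | succ i ih =>
      refine le_trans ?_ (hgrow z hK (n + i))
      rw [pow_succ', mul_assoc]
      gcongr
  have h2 : ∀ k, σ * φ (fderiv ℝ F^[p * (k + 1)] z e) ≤ 2 := by
    intro k
    by_contra! hcon
    refine hno _ (Nat.mul_pos hp k.succ_pos) (Function.IsPeriodicPt.mul_const (f := F) hz _) ?_
    convert H.frame.add_mem (hlow z hK (p * (k + 1)))
      (H.frame.smul_mem (sub_nonneg.2 hcon.le) H.frame.unit_mem) using 1
    module
  have h3 : n % p + p * (n / p) = n := Nat.mod_add_div n p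
  have h4 := Nat.mod_lt n hp
  have h5 := h1 (p - n % p)
  rw [show n + (p - n % p) = p * (n / p + 1) by rw [mul_add]; omega] at h5
  have h6 := h2 (n / p)
  have h7 : κ ^ p ≤ κ ^ (p - n % p) := pow_le_pow_of_le_one hκ.le hκ1.le (by omega)
  rw [le_div_iff₀ (by positivity), le_div_iff₀ hσ]
  have h8 := mul_le_mul_of_nonneg_right h7 (H.nonneg_fderiv n z)
  nlinarith

/-- The residues modulo the period of slow times along a cycle give well separated points. -/
theorem exists_period_bound [CompleteSpace E] (H : PosMap C e φ M c L K F) :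
    ∃ m, 0 < m ∧ ∀ z p, 0 < p → F^[p] z = z → (∀ l, 0 < l → l < p → F^[l] z ≠ z) →
      (∀ n, F^[n] z ∈ K) → (∃ B, ∀ n, φ (fderiv ℝ F^[n] z e) ≤ B) → p ≤ m := by
  classical
  obtain ⟨κ, hκ, hκ1, hgrow⟩ := H.exists_growth_lower_bound
  obtain ⟨σ, hσ, hlow⟩ := H.exists_lower_bound
  obtain ⟨θ, hθ, hθε⟩ := H.exists_comparable_or_summable
  obtain ⟨ε, hε, hclose⟩ := hθε σ⁻¹ (inv_pos.2 hσ)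
  obtain ⟨N, hN⟩ := exists_card_bound H.isCompact hε
  have hθ0 : 0 < θ := one_pos.trans hθ
  have hρ0 : 0 < κ / θ := div_pos hκ hθ0
  have hρ1 : κ / θ ≤ 1 := (div_le_one hθ0).2 (hκ1.trans hθ).le
  obtain ⟨m, hm⟩ := pow_unbounded_of_one_lt ((κ / θ) ^ N)⁻¹ hθ
  refine ⟨m + 1, m.succ_pos, fun z p hp hz hmin hK ⟨B, hB⟩ => ?_⟩
  by_contra! hpm
  set s : ℕ → ℝ := fun n => φ (fderiv ℝ F^[n] z e) with hs
  have hspos : ∀ n, 0 < s n := H.pos_fderiv hK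
  have hmod : ∀ n, F^[n % p] z = F^[n] z :=
    Function.IsPeriodicPt.iterate_mod_apply (f := F) hz
  have hshift : ∀ m n, F^[n] (F^[m] z) ∈ K := fun m n => by
    rw [← Function.iterate_add_apply]; exact hK _
  have hres : ∀ k, (((Finset.range k).filter (IsSlowTime s θ)).image (· % p)).card ≤ N := by
    intro k
    by_contra! hcon
    obtain ⟨_, hi, _, hj, hij, hd⟩ := hN _ (fun n => F^[n] z) (fun i _ => hK i) hcon
    obtain ⟨i, hslow, rfl⟩ := Finset.mem_image.1 hi
    obtain ⟨j, -, rfl⟩ := Finset.mem_image.1 hj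
    obtain ⟨d, hd0, hdij⟩ : ∃ d, 0 < d ∧ j % p = d + i % p :=
      ⟨j % p - i % p, by omega, by omega⟩
    have hjp := Nat.mod_lt j hp
    have hab : F^[j % p] z = F^[d] (F^[i] z) := by
      rw [hdij, Function.iterate_add_apply, hmod i]
    simp only [hab, hmod i] at hd
    have hret : ∀ n, F^[d] (F^[n] z) ≠ F^[n] z := fun n hn =>
      hmin d hd0 (by omega) (iterate_eq_of_iterate_eq hp hz hn)
    have hper : ∀ n, F^[d * p] (F^[n] z) = F^[n] z := fun n => by
      rw [iterate_comm, mul_comm, Function.IsPeriodicPt.mul_const (f := F) hz d]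
    have hstep : ∀ n k, F^[d * (k + 1)] (F^[n] (F^[i] z)) =
        F^[d * k] (F^[n] (F^[d] (F^[i] z))) := fun n k => by
      rw [iterate_comm F n d, ← Function.iterate_add_apply F (d * k), mul_add, mul_one]
    rcases hclose (F^[i] z) (F^[d] (F^[i] z)) (hshift i)
      (fun n => by rw [← Function.iterate_add_apply F d]; exact hshift _ n) hd
      (H.fderiv_le_of_growth hσ (hlow z hK i) (hspos i) (Finset.mem_filter.1 hslow).2) with ⟨n, hn | hn⟩ | hsum
    · have := H.frame.eq_of_monotone_of_eq (a := fun k => F^[d * k] (F^[n] (F^[i] z)))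
        (fun k => by rw [hstep]; exact H.iterate_monotone hn _) hp (by
          simp only [← Function.iterate_add_apply F n i]
          exact hper _)
      simp only [← Function.iterate_add_apply F n i] at this
      exact hret (n + i) (by simpa using this)
    · have := H.frame.eq_of_antitone_of_eq (a := fun k => F^[d * k] (F^[n] (F^[i] z)))
        (fun k => by rw [hstep]; exact H.iterate_monotone hn _) hp (by
          simp only [← Function.iterate_add_apply F n i]
          exact hper _)
      simp only [← Function.iterate_add_apply F n i] at this
      exact hret (n + i) (by simpa using this)
    · have h1 := hsum.tendsto_atTop_zero.comp (tendsto_id.const_mul_atTop' hp)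
      have h2 : ∀ k n, F^[p * k] (F^[n] z) = F^[n] z := fun k n => by
        rw [iterate_comm, Function.IsPeriodicPt.mul_const (f := F) hz k]
      refine hret i (sub_eq_zero.1 (norm_eq_zero.1 (tendsto_nhds_unique
        (tendsto_const_nhds.congr fun k => ?_) h1)))
      simp only [Function.comp_apply, id_eq]
      rw [← Function.iterate_add_apply F d i, h2, h2]
  have hcard : ∀ k, ((Finset.range (p * k)).filter (IsSlowTime s θ)).card ≤ k * N := by
    intro k
    refine (Finset.card_le_mul_card_image (f := (· % p)) _ k fun a _ => ?_).trans
      (Nat.mul_le_mul_left k (hres _))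
    refine (Finset.card_le_card_of_injOn (t := Finset.range k) (· / p) (fun x hx => ?_)
      fun x hx y hy hxy => ?_).trans (Finset.card_range k).le
    · simp only [Finset.coe_filter, Finset.mem_filter, Finset.mem_range] at hx
      simpa using Nat.div_lt_of_lt_mul hx.1.1
    · simp only [Finset.coe_filter, Finset.mem_filter] at hx hy
      rw [← Nat.mod_add_div x p, ← Nat.mod_add_div y p, hx.2, hy.2]
      exact congrArg (fun t => a + p * t) hxy
  have hlam : 1 < (κ / θ) ^ N * θ ^ p := by
    rw [inv_lt_iff_one_lt_mul₀ (by positivity)] at hm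
    rw [mul_comm]
    exact hm.trans_le (mul_le_mul_of_nonneg_right
      (pow_le_pow_right₀ hθ.le (by omega)) (by positivity))
  obtain ⟨k, hk⟩ := pow_unbounded_of_one_lt (B / s 0) hlam
  obtain ⟨j, hkj, hj⟩ := exists_large_value hκ hκ1 hθ hspos (hgrow z hK) (p * k)
  rw [div_lt_iff₀ (hspos 0)] at hk
  have h1 := pow_le_pow_of_le_one hρ0.le hρ1 (hcard k)
  have h2 := pow_le_pow_right₀ hθ.le hkj
  have h3 := hB j
  have h0 := hspos 0
  have h4 : ((κ / θ) ^ N * θ ^ p) ^ k * s 0 ≤ s j := by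
    refine le_trans ?_ hj
    rw [mul_pow, ← pow_mul, ← pow_mul, mul_comm N k, mul_right_comm]
    gcongr
  exact hk.not_ge (h4.trans h3)

end PosMap

section SlowGrowthAlmostEverywhere

theorem ae_le_sq_of_integral_le {f : ℕ → ℝ → ℝ} (hf : ∀ n, Continuous (f n))
    (h0 : ∀ n t, 0 ≤ f n t) {a b B : ℝ} (hab : a ≤ b) (hB : ∀ n, ∫ t in a..b, f n t ≤ B) :
    ∀ᵐ t ∂volume.restrict (Ioc a b), ∃ k : ℕ, ∀ n : ℕ, f n t ≤ k * ((n : ℝ) + 1) ^ 2 := by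
  have hmeas : ∀ n : ℕ, Measurable fun t => ENNReal.ofReal (f n t / ((n : ℝ) + 1) ^ 2) :=
    fun n => ((hf n).div_const _).measurable.ennreal_ofReal
  have hB0 : 0 ≤ B := (intervalIntegral.integral_nonneg hab fun t _ => h0 0 t).trans (hB 0)
  have hle : ∀ n : ℕ, ∫⁻ t in Ioc a b, ENNReal.ofReal (f n t / ((n : ℝ) + 1) ^ 2) ≤
      ENNReal.ofReal (B / ((n : ℝ) + 1) ^ 2) := by
    intro n
    rw [← ofReal_integral_eq_lintegral_ofReal
      (((hf n).div_const _).integrableOn_Ioc)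
      (Eventually.of_forall fun t => div_nonneg (h0 n t) (by positivity)),
      ← intervalIntegral.integral_of_le hab, intervalIntegral.integral_div]
    exact ENNReal.ofReal_le_ofReal (div_le_div_of_nonneg_right (hB n) (by positivity))
  have hsum : Summable fun n : ℕ => B / ((n : ℝ) + 1) ^ 2 := by
    have h1 := (summable_nat_add_iff 1).2 (Real.summable_one_div_nat_pow.2 one_lt_two)
    simpa [div_eq_mul_inv] using h1.mul_left B
  have hfin : ∫⁻ t in Ioc a b, ∑' n : ℕ, ENNReal.ofReal (f n t / ((n : ℝ) + 1) ^ 2) ≠ ⊤ := by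
    rw [lintegral_tsum fun n => (hmeas n).aemeasurable]
    refine ne_top_of_le_ne_top ?_ (ENNReal.tsum_le_tsum hle)
    rw [← ENNReal.ofReal_tsum_of_nonneg (fun n => by positivity) hsum]
    exact ENNReal.ofReal_ne_top
  filter_upwards [ae_lt_top (Measurable.tsum hmeas) hfin] with t ht
  obtain ⟨k, hk⟩ := exists_nat_ge
    (∑' n : ℕ, ENNReal.ofReal (f n t / ((n : ℝ) + 1) ^ 2)).toReal
  refine ⟨k, fun n => ?_⟩
  have h1 := (ENNReal.ofReal_le_iff_le_toReal ht.ne).1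
    (ENNReal.le_tsum (f := fun n : ℕ => ENNReal.ofReal (f n t / ((n : ℝ) + 1) ^ 2)) n)
  exact (div_le_iff₀ (by positivity)).1 (h1.trans hk)

variable {C : Set E} {e : E} {φ : E →L[ℝ] ℝ} {M c L : ℝ} {K : Set E} {F : E → E}

theorem continuous_fderiv_iterate_apply (hF : ContDiff ℝ 1 F) (φ : E →L[ℝ] ℝ) (n : ℕ) (v : E) :
    Continuous fun x => φ (fderiv ℝ F^[n] x v) :=
  φ.continuous.comp
    (((contDiff_iterate hF n).continuous_fderiv one_ne_zero).clm_apply continuous_const)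

theorem PosMap.ae_line_le_sq (H : PosMap C e φ M c L K F)
    (hbdd : ∀ x, ∃ R, ∀ n, ‖F^[n] x‖ ≤ R) (x : E) :
    ∀ᵐ t : ℝ, ∃ k : ℕ, ∀ n : ℕ,
      φ (fderiv ℝ F^[n] (x + t • e) e) ≤ k * ((n : ℝ) + 1) ^ 2 := by
  have hline : Continuous fun t : ℝ => x + t • e := by fun_prop
  have hcont : ∀ n, Continuous fun t : ℝ => φ (fderiv ℝ F^[n] (x + t • e) e) := fun n =>
    (continuous_fderiv_iterate_apply H.contDiff φ n e).comp hline
  have hderiv : ∀ n (t : ℝ), HasDerivAt (fun t : ℝ => φ (F^[n] (x + t • e)))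
      (φ (fderiv ℝ F^[n] (x + t • e) e)) t := by
    intro n t
    have h1 : HasDerivAt (fun t : ℝ => x + t • e) e t := by
      simpa using ((hasDerivAt_id t).smul_const e).const_add x
    exact φ.hasFDerivAt.comp_hasDerivAt t
      (((contDiff_iterate H.contDiff n).differentiable one_ne_zero
        (x + t • e)).hasFDerivAt.comp_hasDerivAt t h1)
  have hloc : ∀ N : ℕ, ∀ᵐ t : ℝ, t ∈ Ioc (-(N : ℝ)) N → ∃ k : ℕ, ∀ n : ℕ,
      φ (fderiv ℝ F^[n] (x + t • e) e) ≤ k * ((n : ℝ) + 1) ^ 2 := by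
    intro N
    obtain ⟨R₁, hR₁⟩ := hbdd (x + (N : ℝ) • e)
    obtain ⟨R₂, hR₂⟩ := hbdd (x + (-(N : ℝ)) • e)
    refine (ae_restrict_iff' measurableSet_Ioc).1 (ae_le_sq_of_integral_le
      (B := ‖φ‖ * R₁ + ‖φ‖ * R₂) hcont (fun n t => H.nonneg_fderiv n _)
      (neg_le_self N.cast_nonneg) fun n => ?_)
    rw [intervalIntegral.integral_eq_sub_of_hasDerivAt (fun t _ => hderiv n t)
      ((hcont n).intervalIntegrable _ _)]
    have hφ : ∀ {y R}, ‖y‖ ≤ R → |φ y| ≤ ‖φ‖ * R := fun h =>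
      (φ.le_opNorm _).trans (mul_le_mul_of_nonneg_left h (norm_nonneg _))
    linarith [(abs_le.1 (hφ (hR₁ n))).2, (abs_le.1 (hφ (hR₂ n))).1]
  filter_upwards [ae_all_iff.2 hloc] with t ht
  obtain ⟨N, hN⟩ := exists_nat_gt |t|
  exact ht N ⟨(abs_lt.1 hN).1, (abs_lt.1 hN).2.le⟩

theorem PosMap.slowGrowth_of_le_sq (H : PosMap C e φ M c L K F) {x : E} {k : ℝ}
    (h : ∀ n : ℕ, φ (fderiv ℝ F^[n] x e) ≤ k * ((n : ℝ) + 1) ^ 2) : SlowGrowth e φ F x := by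
  intro θ hθ
  have hθ0 : 0 < θ := one_pos.trans hθ
  have h1 := ((tendsto_pow_const_div_const_pow_of_one_lt 2 hθ).comp
    (tendsto_add_atTop_nat 1)).const_mul (k * θ)
  rw [mul_zero] at h1
  refine squeeze_zero (fun n => div_nonneg (H.nonneg_fderiv n x) (by positivity))
    (fun n => ?_) h1
  calc _ ≤ k * ((n : ℝ) + 1) ^ 2 / θ ^ n := by gcongr; exact h n
    _ = _ := by
      simp only [Function.comp_apply, Nat.cast_add, Nat.cast_one, pow_succ θ n]
      field_simp

theorem PosMap.ae_slowGrowth [FiniteDimensional ℝ E] [MeasurableSpace E] [BorelSpace E]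
    (H : PosMap C e φ M c L K F) (hbdd : ∀ x, ∃ R, ∀ n, ‖F^[n] x‖ ≤ R) (μ : Measure E)
    [μ.IsAddHaarMeasure] : ∀ᵐ x ∂μ, SlowGrowth e φ F x := by
  have hmeas : MeasurableSet {x | ∃ k : ℕ, ∀ n : ℕ,
      φ (fderiv ℝ F^[n] x e) ≤ k * ((n : ℝ) + 1) ^ 2} := by
    simp only [ofPred_exists, ofPred_forall]
    exact .iUnion fun k => .iInter fun n => (isClosed_le
      (continuous_fderiv_iterate_apply H.contDiff φ n e) continuous_const).measurableSet
  filter_upwards [ae_mem_of_ae_add_linearMap_mem (LinearMap.toSpanSingleton ℝ E e) volume μ hmeas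
    (H.ae_line_le_sq hbdd)] with x hx
  obtain ⟨k, hk⟩ := hx
  exact H.slowGrowth_of_le_sq hk

end SlowGrowthAlmostEverywhere

section FiniteDimensional

variable {C : Set E} {F : E → E}

theorem exists_unifPos [FiniteDimensional ℝ E] (hC : IsCone C) (hF : ContDiff ℝ 1 F)
    (hpos : ∀ x, StronglyPositive C (fderiv ℝ F x)) {K : Set E} (hK : IsCompact K) (e : E) :
    ∃ c L, 0 < c ∧ c ≤ 1 ∧ 1 ≤ L ∧ ∀ x ∈ K, UnifPos C e c L (fderiv ℝ F x) := by
  have hDF : Continuous (fderiv ℝ F) := hF.continuous_fderiv one_ne_zero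
  have hcomp : IsCompact ((fun q : E × E => fderiv ℝ F q.1 q.2) ''
      K ×ˢ (C ∩ sphere 0 1)) :=
    (hK.prod ((isCompact_sphere 0 1).inter_left hC.1)).image
      ((hDF.comp continuous_fst).clm_apply continuous_snd)
  obtain ⟨δ, hδ, hsub⟩ := hcomp.exists_cthickening_subset_open (t := interior C) isOpen_interior
    (by
      rintro _ ⟨q, ⟨-, hv, hq⟩, rfl⟩
      refine hpos q.1 q.2 ⟨hv, fun h0 => ?_⟩
      rw [mem_singleton_iff.1 h0] at hq
      simp at hq)
  obtain ⟨L, hL⟩ := (hK.image hDF).isBounded.exists_norm_le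
  refine ⟨min 1 (δ / (‖e‖ + 1)), max 1 L, by positivity, min_le_left _ _, le_max_left _ _,
    fun x hx => ⟨fun v hv => ?_, (hL _ (mem_image_of_mem _ hx)).trans (le_max_right _ _)⟩⟩
  set c := min 1 (δ / (‖e‖ + 1)) with hc
  have hc0 : 0 ≤ c := by positivity
  rcases eq_or_ne v 0 with rfl | hv0
  · simpa using hv
  have hn : 0 < ‖v‖ := norm_pos_iff.2 hv0
  have h1 : fderiv ℝ F x (‖v‖⁻¹ • v) - c • e ∈ C := by
    refine interior_subset (hsub (mem_cthickening_of_dist_le _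
      (fderiv ℝ F x (‖v‖⁻¹ • v)) δ _ ⟨(x, ‖v‖⁻¹ • v), ⟨hx, ?_, ?_⟩, rfl⟩ ?_))
    · exact IsCone.smul_mem hC (by positivity) hv
    · rw [mem_sphere_zero_iff_norm, norm_smul, norm_inv, norm_norm, inv_mul_cancel₀ hn.ne']
    · rw [dist_eq_norm, sub_sub_cancel_left, norm_neg, norm_smul, Real.norm_of_nonneg hc0]
      calc c * ‖e‖ ≤ δ / (‖e‖ + 1) * (‖e‖ + 1) :=
            mul_le_mul (min_le_right _ _) (by linarith) (norm_nonneg _) (by positivity)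
        _ = δ := by field_simp
  have h2 := IsCone.smul_mem hC hn.le h1
  rwa [map_smul, smul_sub, smul_smul, mul_inv_cancel₀ hn.ne', one_smul, smul_smul,
    mul_comm] at h2

theorem exists_posMap [FiniteDimensional ℝ E] [Nontrivial E] (hC : StronglyOrderedCone C)
    (hF : ContDiff ℝ 1 F) (hpos : ∀ x, StronglyPositive C (fderiv ℝ F x)) (R : ℝ) :
    ∃ e φ M c L, PosMap C e φ M c L (closedBall 0 R) F := by
  obtain ⟨e, φ, M, he, h⟩ := exists_coneFrame hC
  obtain ⟨c, L, hc, hc1, hL, hu⟩ :=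
    exists_unifPos hC.1 hF hpos (isCompact_closedBall (0 : E) R) e
  have he0 : e ≠ 0 := by
    rintro rfl
    simpa using h.pos
  have hmap : ∀ x, ∀ v ∈ C, fderiv ℝ F x v ∈ C := fun x v hv => by
    rcases eq_or_ne v 0 with rfl | hv0
    · simpa using hv
    · exact interior_subset (hpos x v ⟨hv, hv0⟩)
  refine ⟨e, φ, M, c, L, h, hF, hc, hc1, hL, isCompact_closedBall 0 R, convex_closedBall 0 R,
    hu, hmap, fun x => ?_⟩
  obtain ⟨δ, hδ, hball⟩ := Metric.nhds_basis_closedBall.mem_iff.1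
    (mem_interior_iff_mem_nhds.1 (hpos x e ⟨interior_subset he, he0⟩))
  have hn : 0 < ‖e‖ := norm_pos_iff.2 he0
  refine ⟨‖e‖ / δ, by positivity, ?_⟩
  have h1 : fderiv ℝ F x e - (δ / ‖e‖) • e ∈ C := hball (by
    rw [mem_closedBall, dist_eq_norm, sub_sub_cancel_left, norm_neg, norm_smul,
      Real.norm_of_nonneg (by positivity), div_mul_cancel₀ _ hn.ne'])
  have h2 := h.smul_mem (r := ‖e‖ / δ) (by positivity) h1
  rwa [smul_sub, smul_smul, div_mul_div_cancel₀ hδ.ne', div_self hn.ne', one_smul] at h2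

omit [NormedSpace ℝ E] in
theorem PointwiseDissipative.exists_radius {F : E → E} (h : PointwiseDissipative F) :
    ∃ R, ∀ x, ∃ m, ∀ n, F^[n] (F^[m] x) ∈ closedBall 0 R := by
  obtain ⟨B, hne, hB, hlim⟩ := h
  obtain ⟨R, hR⟩ := hB.exists_norm_le
  refine ⟨R + 1, fun x => ?_⟩
  obtain ⟨m, hm⟩ := eventually_atTop.1 ((hlim x).eventually_lt_const one_pos)
  refine ⟨m, fun n => ?_⟩
  rw [← Function.iterate_add_apply, mem_closedBall_zero_iff]
  obtain ⟨b, hb, hd⟩ := (infDist_lt_iff hne).1 (hm (n + m) (by omega))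
  rw [dist_eq_norm] at hd
  have := norm_sub_norm_le (F^[n + m] x) b
  linarith [hR b hb]

omit [NormedSpace ℝ E] in
theorem exists_norm_iterate_le {x : E} {m : ℕ} {R : ℝ}
    (h : ∀ n, F^[n] (F^[m] x) ∈ closedBall 0 R) : ∃ R', ∀ n, ‖F^[n] x‖ ≤ R' := by
  have hb : IsBounded (range fun n => F^[n] x) := by
    refine (((Set.finite_lt_nat m).image fun n => F^[n] x).isBounded.union
      (isBounded_closedBall (x := (0 : E)) (r := R))).subset ?_
    rintro _ ⟨n, rfl⟩
    rcases lt_or_ge n m with hn | hn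
    · exact .inl ⟨n, hn, rfl⟩
    · refine .inr ?_
      have := h (n - m)
      rwa [← Function.iterate_add_apply, Nat.sub_add_cancel hn] at this
  obtain ⟨R', hR'⟩ := hb.exists_norm_le
  exact ⟨R', fun n => hR' _ ⟨n, rfl⟩⟩

theorem isLinStableCycleLe_of_subsingleton [Subsingleton E] (hF : Continuous F) (x : E) :
    IsLinStableCycleLe F 1 (omegaMap F x) :=
  ⟨1, one_pos, le_rfl, x, Subsingleton.elim _ _, fun l h0 h1 => absurd h1 (by omega),
    by rw [spectrum.SpectralRadius.of_subsingleton]; exact zero_le_one,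
    omegaMap_eq_of_tendsto hF one_pos (Subsingleton.elim _ _)
      (tendsto_const_nhds.congr fun _ => Subsingleton.elim _ _)⟩

theorem PosMap.exists_isLinStableCycleLe [CompleteSpace E] {e : E} {φ : E →L[ℝ] ℝ} {M c L : ℝ}
    {K : Set E} (H : PosMap C e φ M c L K F) :
    ∃ m, 0 < m ∧ ∀ y, (∀ n, F^[n] y ∈ K) → SlowGrowth e φ F y →
      IsLinStableCycleLe F m (omegaMap F y) := by
  obtain ⟨m, hm, hbound⟩ := H.exists_period_bound
  refine ⟨m, hm, fun y hy hslow => ?_⟩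
  have hF : Continuous F := H.contDiff.continuous
  obtain ⟨i, p, z, hp, hlim⟩ := H.exists_tendsto hy hslow
  have hz : F^[p] z = z := by
    refine tendsto_nhds_unique ((((hF.iterate p).tendsto z).comp hlim).congr fun k => ?_)
      (hlim.comp (tendsto_add_atTop_nat 1))
    simp only [Function.comp_apply]
    rw [← Function.iterate_add_apply F p, mul_add, mul_one, add_comm]
  have hzK : ∀ n, F^[n] z ∈ K := fun n =>
    H.isCompact.isClosed.mem_of_tendsto (((hF.iterate n).tendsto z).comp hlim)
      (Eventually.of_forall fun k => by
        simp only [Function.comp_apply, ← Function.iterate_add_apply]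
        exact hy _)
  obtain ⟨B, hB⟩ := H.exists_fderiv_le hp hz hzK fun j hj hjz =>
    H.not_doubling hp (H.slowGrowth_iterate hslow i) hlim hj hjz
  have hper : Function.IsPeriodicPt F p z := hz
  have hmin : ∀ l, 0 < l → l < Function.minimalPeriod F z → F^[l] z ≠ z := fun l h0 hl =>
    Function.not_isPeriodicPt_of_pos_of_lt_minimalPeriod h0.ne' hl
  have hmz : F^[Function.minimalPeriod F z] z = z := Function.iterate_minimalPeriod
  refine ⟨_, hper.minimalPeriod_pos hp,
    hbound z _ (hper.minimalPeriod_pos hp) hmz hmin hzK ⟨B, hB⟩, z, hmz, hmin,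
    H.spectralRadius_le_one hmz hB, ?_⟩
  rw [← omegaMap_iterate F i]
  exact omegaMap_eq_of_tendsto hF hp hz hlim

end FiniteDimensional

end MonotoneMap

/-- **Improved Prevalent Dynamics**, finite-dimensional form: `Q₀` has full Lebesgue
measure in `ℝ^d`. -/
theorem improved_prevalent_dynamics_Rd
    {d : ℕ} (C : Set (EuclideanSpace ℝ (Fin d))) (hC : StronglyOrderedCone C)
    (F₀ : EuclideanSpace ℝ (Fin d) → EuclideanSpace ℝ (Fin d))
    (hC1 : ContDiff ℝ 1 F₀)
    (hpos : ∀ x : EuclideanSpace ℝ (Fin d), StronglyPositive C (fderiv ℝ F₀ x))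
    (hdiss : PointwiseDissipative F₀) :
    ∃ m : ℕ, 0 < m ∧
      volume {x : EuclideanSpace ℝ (Fin d) | IsLinStableCycleLe F₀ m (omegaMap F₀ x)}ᶜ = 0 := by
  rcases subsingleton_or_nontrivial (EuclideanSpace ℝ (Fin d)) with h | h
  · exact ⟨1, one_pos, ae_iff.1 (Eventually.of_forall
      (MonotoneMap.isLinStableCycleLe_of_subsingleton hC1.continuous))⟩
  obtain ⟨R, hR⟩ := MonotoneMap.PointwiseDissipative.exists_radius hdiss
  obtain ⟨e, φ, M, c, L, H⟩ := MonotoneMap.exists_posMap hC hC1 hpos R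
  obtain ⟨m, hm, hcycle⟩ := H.exists_isLinStableCycleLe
  refine ⟨m, hm, ae_iff.1 ?_⟩
  filter_upwards [H.ae_slowGrowth (fun x => (hR x).elim fun _ h =>
    MonotoneMap.exists_norm_iterate_le h) volume] with x hx
  obtain ⟨i, hi⟩ := hR x
  rw [← MonotoneMap.omegaMap_iterate F₀ i]
  exact hcycle _ hi (H.slowGrowth_iterate hx i)

end
end

section
/- (Sharpened C¹-dynamics alternative) Let (X,C) be a strongly ordered separable Banach space and F₀ : X → X a compact C¹ map with DF₀(x) strongly positive for every x; assume F₀ is pointwise dissipative. Then there is an integer m > 0 such that for every x ∈ X, either (a) ω(x,F₀) is a linearly stable cycle of F₀ of minimal period at most m, or (b) there is δ > 0 such that for every y ∈ X with y < x or y > x one has limsup_{n→∞} ‖F₀ⁿx − F₀ⁿy‖ ≥ δ. -/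
open Filter Topology MeasureTheory Set Bornology Metric
open scoped ENNReal NNReal

noncomputable section

section ConeUnit

variable {X : Type*} [NormedAddCommGroup X] [NormedSpace ℝ X]

/-- A closed proper cone `C` together with an order unit `e`, with quantitative constants:
`β` bounds how fast multiples of `e` absorb vectors, and `γ` bounds from below the norm of
vectors dominating a multiple of `e`. -/
structure ConeUnit (C : Set X) (e : X) (β γ : ℝ) : Prop where
  closed : IsClosed C
  add : ∀ {x y : X}, x ∈ C → y ∈ C → x + y ∈ C
  smul : ∀ {r : ℝ} {x : X}, 0 ≤ r → x ∈ C → r • x ∈ C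
  antisymm : ∀ {x : X}, x ∈ C → -x ∈ C → x = 0
  unit_mem : e ∈ interior C
  pos : 0 < β
  pos' : 0 < γ
  absorb : ∀ w : X, (β * ‖w‖) • e + w ∈ C
  coercive : ∀ {a : ℝ} {d : X}, 0 ≤ a → d - a • e ∈ C → γ * a ≤ ‖d‖

namespace ConeUnit

variable {C : Set X} {e : X} {β γ : ℝ}

theorem unit_mem' (h : ConeUnit C e β γ) : e ∈ C := interior_subset h.unit_mem

theorem zero_mem (h : ConeUnit C e β γ) : (0 : X) ∈ C := by
  simpa using h.smul le_rfl h.unit_mem'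

/-- Vectors dominating `b • e` dominate `a • e` for `a ≤ b`. -/
theorem sub_smul_mono (h : ConeUnit C e β γ) {a b : ℝ} {d : X} (hab : a ≤ b)
    (hd : d - b • e ∈ C) : d - a • e ∈ C := by
  have := h.add hd (h.smul (sub_nonneg.2 hab) h.unit_mem')
  convert this using 1; module

theorem smul_add_mono (h : ConeUnit C e β γ) {a b : ℝ} {u : X} (hab : a ≤ b)
    (hd : a • e + u ∈ C) : b • e + u ∈ C := by
  have := h.add hd (h.smul (sub_nonneg.2 hab) h.unit_mem')
  convert this using 1; module

theorem absorb_le (h : ConeUnit C e β γ) {b : ℝ} {w : X} (hb : ‖w‖ ≤ b) :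
    (β * b) • e + w ∈ C :=
  h.smul_add_mono (mul_le_mul_of_nonneg_left hb h.pos.le) (h.absorb w)

theorem absorb_sub (h : ConeUnit C e β γ) {b : ℝ} {w : X} (hb : ‖w‖ ≤ b) :
    (β * b) • e - w ∈ C := by
  have := h.absorb_le (w := -w) (by simpa using hb)
  rwa [← sub_eq_add_neg] at this

theorem convex (h : ConeUnit C e β γ) : Convex ℝ C := fun _ hx _ hy _ _ ha hb _ =>
  h.add (h.smul ha hx) (h.smul hb hy)

theorem neg (h : ConeUnit C e β γ) : ConeUnit (-C) (-e) β γ where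
  closed := h.closed.neg
  add hx hy := by
    simp only [Set.mem_neg, neg_add] at *
    exact h.add hx hy
  smul hr hx := by
    simp only [Set.mem_neg, ← smul_neg] at *
    exact h.smul hr hx
  antisymm hx hx' := by
    simp only [Set.mem_neg, neg_neg] at *
    exact h.antisymm hx' hx
  unit_mem := by
    refine interior_maximal (Set.neg_subset_neg.2 interior_subset) isOpen_interior.neg ?_
    simpa using h.unit_mem
  pos := h.pos
  pos' := h.pos'
  absorb w := by
    have := h.absorb (-w)
    rw [Set.mem_neg]
    convert this using 1
    rw [norm_neg]; module
  coercive {a d} ha hd := by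
    rw [Set.mem_neg] at hd
    rw [← norm_neg]
    apply h.coercive ha
    convert hd using 1; module

/-- A compact subset of the interior of the cone is uniformly above a multiple of `e`. -/
theorem exists_smul_le_of_isCompact {C : Set X} (e : X) {Z : Set X} (hZ : IsCompact Z)
    (hZC : Z ⊆ interior C) : ∃ κ : ℝ, 0 < κ ∧ ∀ z ∈ Z, z - κ • e ∈ C := by
  obtain ⟨ε, hε, hsub⟩ := hZ.exists_thickening_subset_open isOpen_interior hZC
  have he : 0 < ‖e‖ + 1 := by positivity
  refine ⟨ε / (‖e‖ + 1) / 2, by positivity, fun z hz => interior_subset (hsub ?_)⟩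
  rw [mem_thickening_iff]
  refine ⟨z, hz, ?_⟩
  rw [dist_eq_norm, sub_sub_cancel_left, norm_neg, norm_smul, Real.norm_of_nonneg (by positivity)]
  calc ε / (‖e‖ + 1) / 2 * ‖e‖ ≤ ε / (‖e‖ + 1) / 2 * (‖e‖ + 1) := by gcongr; linarith
    _ = ε / 2 := by field_simp
    _ < ε := by linarith

/-- Small order norm forces small norm on compact sets. -/
theorem norm_lt_of_isCompact (h : ConeUnit C e β γ) {Q : Set X} (hQ : IsCompact Q) {ε : ℝ}
    (hε : 0 < ε) : ∃ s : ℝ, 0 < s ∧ ∀ w ∈ Q, s • e + w ∈ C → s • e - w ∈ C → ‖w‖ < ε := by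
  by_contra! hcon
  have hpos : ∀ n : ℕ, (0 : ℝ) < 1 / (n + 1) := fun n => by positivity
  choose w hwQ hw1 hw2 hw3 using fun n : ℕ => hcon (1 / ((n : ℝ) + 1)) (hpos n)
  obtain ⟨z, -, φ, hφ, hlim⟩ := hQ.tendsto_subseq hwQ
  have h0 : Tendsto (fun n : ℕ => (1 / ((φ n : ℝ) + 1)) • e) atTop (𝓝 ((0 : ℝ) • e)) :=
    (tendsto_one_div_add_atTop_nhds_zero_nat.comp hφ.tendsto_atTop).smul_const e
  have hz1 : (0 : ℝ) • e + z ∈ C :=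
    h.closed.mem_of_tendsto (h0.add hlim) (Eventually.of_forall fun n => hw1 (φ n))
  have hz2 : (0 : ℝ) • e - z ∈ C :=
    h.closed.mem_of_tendsto (h0.sub hlim) (Eventually.of_forall fun n => hw2 (φ n))
  have hz : z = 0 := h.antisymm (by simpa using hz1) (by simpa using hz2)
  have := ge_of_tendsto hlim.norm (Eventually.of_forall fun n => hw3 (φ n))
  rw [hz, norm_zero] at this
  linarith

/-- A monotone sequence with values in a compact set converges. -/
theorem exists_tendsto_of_monotone (h : ConeUnit C e β γ) {K : Set X} (hK : IsCompact K)
    {s : ℕ → X} (hs : ∀ n, s n ∈ K) (hmono : ∀ n, s (n + 1) - s n ∈ C) :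
    ∃ z, Tendsto s atTop (𝓝 z) := by
  have hle : ∀ n k, s (n + k) - s n ∈ C := by
    intro n k
    induction k with
    | zero => simpa using h.zero_mem
    | succ k ih =>
      have := h.add ih (hmono (n + k))
      convert this using 1
      rw [← add_assoc]; abel
  have hle' : ∀ n m, n ≤ m → s m - s n ∈ C := fun n m hnm => by
    obtain ⟨k, rfl⟩ := Nat.exists_eq_add_of_le hnm
    exact hle n k
  obtain ⟨z, -, φ, hφ, hlim⟩ := hK.tendsto_subseq hs
  refine ⟨z, tendsto_of_subseq_tendsto fun ns hns => ?_⟩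
  obtain ⟨z', -, ψ, hψ, hlim'⟩ := hK.tendsto_subseq fun n => hs (ns n)
  refine ⟨ψ, ?_⟩
  have key : ∀ (a b : ℕ → ℕ) (y y' : X), Tendsto a atTop atTop → Tendsto b atTop atTop →
      Tendsto (s ∘ a) atTop (𝓝 y) → Tendsto (s ∘ b) atTop (𝓝 y') → y' - y ∈ C := by
    intro a b y y' ha hb hy hy'
    have h1 : ∀ n, y' - s n ∈ C := fun n =>
      h.closed.mem_of_tendsto (hy'.sub_const (s n))
        ((hb.eventually_ge_atTop n).mono fun m hm => hle' n _ hm)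
    exact h.closed.mem_of_tendsto (hy.const_sub y') (Eventually.of_forall fun n => h1 _)
  have e1 := key φ (ns ∘ ψ) z z' hφ.tendsto_atTop (hns.comp hψ.tendsto_atTop) hlim hlim'
  have e2 := key (ns ∘ ψ) φ z' z (hns.comp hψ.tendsto_atTop) hφ.tendsto_atTop hlim' hlim
  have : z' - z = 0 := h.antisymm e1 (by simpa using e2)
  rw [sub_eq_zero.1 this] at hlim'
  exact hlim'

/-- For a nonzero `v`, vectors `g` with `g ± v ≥ 0` are bounded away from zero. -/
theorem exists_norm_ge (h : ConeUnit C e β γ) {v : X} (hv : v ≠ 0) :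
    ∃ c : ℝ, 0 < c ∧ ∀ g : X, g + v ∈ C → g - v ∈ C → c ≤ ‖g‖ := by
  have key : ∀ y : X, y ∉ C → ∃ c : ℝ, 0 < c ∧ ∀ g : X, g + y ∈ C → c ≤ ‖g‖ := by
    intro y hy
    obtain ⟨c, hc, hball⟩ := Metric.isOpen_iff.1 h.closed.isOpen_compl y hy
    refine ⟨c, hc, fun g hg => ?_⟩
    by_contra! hlt
    exact hball (by simpa [dist_eq_norm] using hlt) hg
  by_cases hvC : v ∈ C
  · obtain ⟨c, hc, H⟩ := key (-v) fun hn => hv (h.antisymm hvC hn)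
    exact ⟨c, hc, fun g _ hg => H g (by rwa [← sub_eq_add_neg])⟩
  · obtain ⟨c, hc, H⟩ := key v hvC
    exact ⟨c, hc, fun g hg _ => H g hg⟩

end ConeUnit

/-- A strongly ordered cone in a nontrivial space has an order unit with quantitative constants. -/
theorem StronglyOrderedCone.exists_coneUnit [Nontrivial X] {C : Set X}
    (hC : StronglyOrderedCone C) : ∃ e : X, ∃ β γ : ℝ, ConeUnit C e β γ := by
  obtain ⟨⟨hcl, hconv, hsmul, hneg⟩, e, he⟩ := hC
  have heC : e ∈ C := interior_subset he
  have h0 : (0 : X) ∈ C := by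
    have : (0 : X) ∈ C ∩ -C := by rw [hneg]; rfl
    exact this.1
  have anti : ∀ {x : X}, x ∈ C → -x ∈ C → x = 0 := fun {x} hx hx' => by
    have : x ∈ C ∩ -C := ⟨hx, hx'⟩
    rwa [hneg] at this
  have smul' : ∀ {r : ℝ} {x : X}, 0 ≤ r → x ∈ C → r • x ∈ C := fun {r x} hr hx => by
    rcases hr.eq_or_lt with rfl | hr
    · simpa using h0
    · exact hsmul r hr x hx
  have add' : ∀ {x y : X}, x ∈ C → y ∈ C → x + y ∈ C := fun {x y} hx hy => by
    have := hsmul 2 two_pos _ (hconv hx hy (a := 1 / 2) (b := 1 / 2) (by norm_num) (by norm_num)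
      (by norm_num))
    convert this using 1; module
  obtain ⟨r, hr, hball⟩ := Metric.isOpen_iff.1 isOpen_interior e he
  have hball' : ∀ w : X, ‖w‖ < r → e + w ∈ C := fun w hw =>
    interior_subset (hball (by simpa [dist_eq_norm] using hw))
  have he0 : -e ∉ C := by
    intro hne
    have e0 : e = 0 := anti heC hne
    obtain ⟨y, hy⟩ := exists_ne (0 : X)
    have hyn : 0 < ‖y‖ := norm_pos_iff.2 hy
    have hsm : ‖(r / 2 / ‖y‖) • y‖ < r := by
      rw [norm_smul, Real.norm_of_nonneg (by positivity)]
      field_simp; linarith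
    have h1 := hball' _ hsm
    have h2 := hball' (-((r / 2 / ‖y‖) • y)) (by rwa [norm_neg])
    rw [e0, zero_add] at h1 h2
    have := anti h1 h2
    rcases smul_eq_zero.1 this with h | h
    · have : 0 < r / 2 / ‖y‖ := by positivity
      exact this.ne' h
    · exact hy h
  obtain ⟨γ, hγ, hγball⟩ := Metric.isOpen_iff.1 hcl.isOpen_compl (-e) he0
  refine ⟨e, 2 / r, γ, hcl, add', smul', anti, he, by positivity, hγ, fun w => ?_,
    fun {a d} ha hd => ?_⟩
  · by_cases hw : w = 0
    · simpa [hw] using h0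
    have hwn : 0 < ‖w‖ := norm_pos_iff.2 hw
    have hsm : ‖(r / 2 / ‖w‖) • w‖ < r := by
      rw [norm_smul, Real.norm_of_nonneg (by positivity)]
      field_simp; linarith
    have := smul' (r := 2 / r * ‖w‖) (by positivity) (hball' _ hsm)
    convert this using 1
    rw [smul_add, smul_smul]
    congr 1
    have : 2 / r * ‖w‖ * (r / 2 / ‖w‖) = 1 := by field_simp
    rw [this, one_smul]
  · rcases ha.eq_or_lt with rfl | ha
    · simp
    by_contra! hlt
    have hmem : a⁻¹ • (d - a • e) ∈ C := smul' (by positivity) hd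
    refine hγball ?_ hmem
    have : a⁻¹ • (d - a • e) - -e = a⁻¹ • d := by
      rw [smul_sub, smul_smul, inv_mul_cancel₀ ha.ne']; module
    rw [mem_ball, dist_eq_norm, this, norm_smul, norm_inv, Real.norm_of_nonneg ha.le]
    rw [inv_mul_lt_iff₀ ha]; linarith

end ConeUnit

section OpFamily

variable {X : Type*} [NormedAddCommGroup X] [NormedSpace ℝ X]

/-- A family `S` of positive operators, uniformly bounded by `M`, with `L e ≥ ρ₀ e`, whose
two-step compositions are uniformly interior on vectors that are not shrunk (`inner`) and which
satisfies an Ehrling-type inequality for the order norm (`ehrling`). -/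
structure OpFamily (C : Set X) (e : X) (S : Set (X →L[ℝ] X)) (M ρ₀ : ℝ) : Prop where
  map_mem : ∀ L ∈ S, ∀ v ∈ C, L v ∈ C
  nonneg : 0 ≤ M
  bound : ∀ L ∈ S, ∀ v, ‖L v‖ ≤ M * ‖v‖
  pos : 0 < ρ₀
  unit : ∀ L ∈ S, L e - ρ₀ • e ∈ C
  inner : ∀ c : ℝ, 0 < c → ∃ κ : ℝ, 0 < κ ∧ ∀ L ∈ S, ∀ L' ∈ S, ∀ v ∈ C, ∀ s : ℝ, 0 ≤ s →
    ‖v‖ ≤ s → c * s ≤ ‖L v‖ → L' (L v) - (κ * s) • e ∈ C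
  ehrling : ∀ ε : ℝ, 0 < ε → ∃ D : ℝ, 0 < D ∧ ∀ L ∈ S, ∀ u : X, ∀ a : ℝ, 0 ≤ a →
    a • e + u ∈ C → a • e - u ∈ C → ‖L u‖ ≤ ε * ‖u‖ + D * a

theorem exists_isCompact_of_isCompactOperator [CompleteSpace X] {S : Set (X →L[ℝ] X)}
    (hS : IsCompact S) (hcpt : ∀ L ∈ S, IsCompactOperator L) :
    ∃ Q : Set X, IsCompact Q ∧ ∀ L ∈ S, ∀ v : X, ‖v‖ ≤ 1 → L v ∈ Q := by
  refine ⟨closure (⋃ L ∈ S, L '' closedBall 0 1), ?_, fun L hL v hv => subset_closure ?_⟩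
  swap
  · exact mem_biUnion hL ⟨v, by simpa using hv, rfl⟩
  refine TotallyBounded.isCompact_of_isClosed (TotallyBounded.closure ?_) isClosed_closure
  rw [Metric.totallyBounded_iff]
  intro ε hε
  obtain ⟨t, htS, htf, htc⟩ := hS.finite_cover_balls (half_pos hε)
  have hTB : TotallyBounded (⋃ L ∈ t, L '' closedBall (0 : X) 1) := by
    refine (totallyBounded_biUnion htf).2 fun L hL => ?_
    exact ((hcpt L (htS hL)).isCompact_closure_image_closedBall 1).totallyBounded.subset
      subset_closure
  obtain ⟨t', ht'f, ht'c⟩ := Metric.totallyBounded_iff.1 hTB (ε / 2) (half_pos hε)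
  refine ⟨t', ht'f, fun y hy => ?_⟩
  obtain ⟨L, hL, v, hv, rfl⟩ := mem_iUnion₂.1 hy
  obtain ⟨L', hL', hLL'⟩ := mem_iUnion₂.1 (htc hL)
  obtain ⟨y', hy', hyy'⟩ := mem_iUnion₂.1 (ht'c (mem_biUnion hL' ⟨v, hv, rfl⟩))
  refine mem_biUnion hy' ?_
  rw [mem_ball, dist_eq_norm] at *
  have h1 : ‖(L - L') v‖ < ε / 2 := by
    refine lt_of_le_of_lt ((L - L').le_opNorm v) ?_
    have : ‖v‖ ≤ 1 := by simpa using hv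
    nlinarith [norm_nonneg (L - L')]
  calc ‖L v - y'‖ = ‖(L - L') v + (L' v - y')‖ := by
        congr 1; rw [sub_apply]; abel
    _ ≤ ‖(L - L') v‖ + ‖L' v - y'‖ := norm_add_le _ _
    _ < ε := by linarith

theorem ConeUnit.exists_opFamily [CompleteSpace X] {C : Set X} {e : X} {β γ : ℝ}
    (h : ConeUnit C e β γ) {S : Set (X →L[ℝ] X)} (hS : IsCompact S)
    (hcpt : ∀ L ∈ S, IsCompactOperator L) (hpos : ∀ L ∈ S, StronglyPositive C L) :
    ∃ M ρ₀ : ℝ, OpFamily C e S M ρ₀ := by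
  have he0 : e ≠ 0 := by
    have := h.coercive (a := 1) (d := e) zero_le_one (by simpa using h.zero_mem)
    have h' := h.pos'
    exact norm_pos_iff.1 (by linarith)
  have hmap : ∀ L ∈ S, ∀ v ∈ C, L v ∈ C := fun L hL v hv => by
    by_cases hv0 : v = 0
    · simpa [hv0] using h.zero_mem
    · exact interior_subset (hpos L hL v ⟨hv, hv0⟩)
  obtain ⟨Q, hQ, hQS⟩ := exists_isCompact_of_isCompactOperator hS hcpt
  obtain ⟨M, hM⟩ := hS.isBounded.exists_norm_le
  have hM0 : 0 ≤ max M 0 := le_max_right _ _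
  have hbound : ∀ L ∈ S, ∀ v, ‖L v‖ ≤ max M 0 * ‖v‖ := fun L hL v =>
    L.le_of_opNorm_le ((hM L hL).trans (le_max_left _ _)) v
  have hinner : ∀ Z : Set X, IsCompact Z → Z ⊆ C \ {0} →
      ∃ κ : ℝ, 0 < κ ∧ ∀ L ∈ S, ∀ z ∈ Z, L z - κ • e ∈ C := by
    intro Z hZ hZC
    have hc : IsCompact ((fun p : (X →L[ℝ] X) × X => p.1 p.2) '' (S ×ˢ Z)) :=
      (hS.prod hZ).image (by fun_prop)
    obtain ⟨κ, hκ, H⟩ := ConeUnit.exists_smul_le_of_isCompact (C := C) e hc (by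
      rintro _ ⟨⟨L, z⟩, ⟨hL, hz⟩, rfl⟩
      exact hpos L hL z (hZC hz))
    exact ⟨κ, hκ, fun L hL z hz => H _ ⟨(L, z), ⟨hL, hz⟩, rfl⟩⟩
  obtain ⟨ρ₀, hρ₀, hunit⟩ := hinner {e} isCompact_singleton (by
    rintro _ rfl; exact ⟨h.unit_mem', he0⟩)
  refine ⟨max M 0, ρ₀, hmap, hM0, hbound, hρ₀, fun L hL => hunit L hL e rfl, ?_, ?_⟩
  · intro c hc
    obtain ⟨κ, hκ, H⟩ := hinner (Q ∩ (C ∩ {z | c ≤ ‖z‖}))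
      (hQ.inter_right (h.closed.inter (isClosed_le continuous_const continuous_norm))) (by
        rintro z ⟨-, hzC, hz⟩
        refine ⟨hzC, fun h0 => ?_⟩
        rw [mem_singleton_iff.1 h0] at hz
        simp at hz; linarith)
    refine ⟨κ, hκ, fun L hL L' hL' v hv s hs hvs hcs => ?_⟩
    rcases hs.eq_or_lt with rfl | hs
    · have : v = 0 := norm_le_zero_iff.1 hvs
      simpa [this] using h.zero_mem
    have hnorm : ‖s⁻¹ • v‖ ≤ 1 := by
      rw [norm_smul, norm_inv, Real.norm_of_nonneg hs.le, inv_mul_le_iff₀ hs]; linarith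
    have hz : L (s⁻¹ • v) ∈ Q ∩ (C ∩ {z | c ≤ ‖z‖}) := by
      refine ⟨hQS L hL _ hnorm, hmap L hL _ (h.smul (by positivity) hv), ?_⟩
      rw [mem_ofPred_eq, map_smul, norm_smul, norm_inv, Real.norm_of_nonneg hs.le,
        le_inv_mul_iff₀ hs]
      linarith
    have := h.smul hs.le (H L' hL' _ hz)
    convert this using 1
    rw [map_smul, map_smul, smul_sub, smul_smul, smul_smul, mul_inv_cancel₀ hs.ne', one_smul,
      mul_comm]
  · intro ε hε
    obtain ⟨s, hs, H⟩ := h.norm_lt_of_isCompact hQ hε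
    set D' := β * (max M 0 * ‖e‖ + 1) with hD'
    have hD'pos : 0 < D' := mul_pos h.pos (by positivity)
    have hLe : ∀ L ∈ S, D' • e - L e ∈ C := fun L hL =>
      h.absorb_sub ((hbound L hL e).trans (by linarith))
    refine ⟨max M 0 * D' / s + 1, by positivity, fun L hL u a ha h1 h2 => ?_⟩
    by_cases hu : u = 0
    · simp only [hu, map_zero, norm_zero, mul_zero, zero_add]; positivity
    have hun : 0 < ‖u‖ := norm_pos_iff.2 hu
    by_contra! hlt
    have hnorm : ‖‖u‖⁻¹ • u‖ ≤ 1 := by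
      rw [norm_smul, norm_inv, norm_norm, inv_mul_cancel₀ hun.ne']
    have hea : 0 ≤ (max M 0 * D' / s + 1) * a := by positivity
    have hLu : ε ≤ ‖L (‖u‖⁻¹ • u)‖ := by
      rw [map_smul, norm_smul, norm_inv, norm_norm, le_inv_mul_iff₀ hun]
      linarith
    have hle : ‖u‖⁻¹ * a * D' ≤ s := by
      have h3 : (max M 0 * D' / s) * a < max M 0 * ‖u‖ := by
        have := hbound L hL u
        nlinarith
      have hMpos : 0 < max M 0 := by
        by_contra! h0
        have : max M 0 = 0 := le_antisymm h0 hM0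
        rw [this] at h3; simp at h3
      have h4 : max M 0 * (D' * a) < max M 0 * (‖u‖ * s) := by
        have : max M 0 * D' / s * a = max M 0 * (D' * a) / s := by ring
        rw [this, div_lt_iff₀ hs] at h3
        linarith
      have h5 := lt_of_mul_lt_mul_left h4 hM0
      rw [mul_assoc, inv_mul_le_iff₀ hun]; linarith
    have key : ∀ w : X, a • e + w ∈ C → s • e + L (‖u‖⁻¹ • w) ∈ C := by
      intro w hw
      refine h.smul_add_mono hle ?_
      have h3 := hmap L hL _ (h.smul (inv_nonneg.2 hun.le) hw)
      have h4 := h.smul (mul_nonneg (inv_nonneg.2 hun.le) ha) (hLe L hL)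
      have := h.add h3 h4
      convert this using 1
      simp only [map_smul, map_add]; module
    have k1 := key u h1
    have k2 := key (-u) (by rwa [← sub_eq_add_neg])
    have := H _ (hQS L hL _ hnorm) k1 (by
      convert k2 using 1
      simp only [smul_neg, map_neg, sub_eq_add_neg])
    linarith

end OpFamily

section Domination

variable {X : Type*} [NormedAddCommGroup X] [NormedSpace ℝ X] {C : Set X} {e : X} {β γ M ρ₀ : ℝ}
  {S : Set (X →L[ℝ] X)}

theorem OpFamily.norm_le_of_approx (hS : OpFamily C e S M ρ₀) {L : X →L[ℝ] X} (hL : L ∈ S)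
    {η : ℝ} {u u' : X} (hη : η ≤ 1) (hu : ‖u' - L u‖ ≤ η * ‖u‖) : ‖u'‖ ≤ (M + 1) * ‖u‖ := by
  have h1 : ‖u'‖ ≤ ‖L u‖ + ‖u' - L u‖ := by
    simpa using norm_add_le (L u) (u' - L u)
  have h2 := hS.bound L hL u
  nlinarith [norm_nonneg u]

theorem OpFamily.norm_two_step_le (hS : OpFamily C e S M ρ₀) {L L' : X →L[ℝ] X} (hL : L ∈ S)
    (hL' : L' ∈ S) {η : ℝ} {u u' u'' : X} (hη0 : 0 ≤ η) (hη : η ≤ 1)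
    (hu : ‖u' - L u‖ ≤ η * ‖u‖) (hu' : ‖u'' - L' u'‖ ≤ η * ‖u'‖) :
    ‖u'' - L' (L u)‖ ≤ η * (2 * M + 1) * ‖u‖ := by
  have h1 := hS.norm_le_of_approx hL hη hu
  have h2 := hS.bound L' hL' (u' - L u)
  have h3 : ‖u'' - L' (L u)‖ ≤ ‖u'' - L' u'‖ + ‖L' (u' - L u)‖ := by
    refine le_trans (le_of_eq ?_) (norm_add_le _ _)
    congr 1; rw [map_sub]; abel
  have h4 : M * ‖u' - L u‖ ≤ M * (η * ‖u‖) := mul_le_mul_of_nonneg_left hu hS.nonneg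
  have h5 : η * ‖u'‖ ≤ η * ((M + 1) * ‖u‖) := mul_le_mul_of_nonneg_left h1 hη0
  linarith

/-- Along an approximate orbit of positive vectors, the vectors eventually dominate `e`
uniformly relative to their norm. -/
theorem OpFamily.exists_eventually_dominated (h : ConeUnit C e β γ) (hS : OpFamily C e S M ρ₀)
    {ρ₁ : ℝ} (hρ₁ : 0 < ρ₁) :
    ∃ ρ : ℝ, 0 < ρ ∧ ∃ η : ℝ, 0 < η ∧ ∀ (L : ℕ → X →L[ℝ] X) (d : ℕ → X),
      (∀ j, L j ∈ S) → (∀ j, d j ∈ C) → (∀ j, d j ≠ 0) →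
      (∀ j, ‖d (j + 1) - L j (d j)‖ ≤ η * ‖d j‖) →
      (∀ j a, 0 ≤ a → d j - a • e ∈ C → d (j + 1) - (ρ₁ * a) • e ∈ C) →
      (∃ a : ℝ, 0 < a ∧ d 0 - a • e ∈ C) →
      ∃ J, ∀ j, J ≤ j → d j - (ρ * ‖d j‖) • e ∈ C := by
  obtain ⟨κ, hκ, hinner⟩ := hS.inner (ρ₁ / 4) (by positivity)
  have hM := hS.nonneg
  have hβ := h.pos
  have hγ := h.pos'
  set ρ₂ := κ / 2 / (M + 1) ^ 2 with hρ₂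
  have hρ₂pos : 0 < ρ₂ := by positivity
  set ρ := min ρ₂ (ρ₁ / (M + 1) * ρ₂) with hρ
  set η := min (min 1 (ρ₁ / 4)) (κ / 2 / (β * (2 * M + 1))) with hη
  have hηpos : 0 < η := by positivity
  have hη1 : η ≤ 1 := (min_le_left _ _).trans (min_le_left _ _)
  have hη2 : η ≤ ρ₁ / 4 := (min_le_left _ _).trans (min_le_right _ _)
  have hη3 : β * (η * (2 * M + 1)) ≤ κ / 2 := by
    have : η ≤ κ / 2 / (β * (2 * M + 1)) := min_le_right _ _
    rw [le_div_iff₀ (by positivity)] at this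
    linarith
  refine ⟨ρ, by positivity, η, hηpos, fun L d hL hdC hd0 happ hmono hinit => ?_⟩
  have hdn : ∀ j, 0 < ‖d j‖ := fun j => norm_pos_iff.2 (hd0 j)
  have hgrow : ∀ j, ‖d (j + 1)‖ ≤ (M + 1) * ‖d j‖ := fun j =>
    hS.norm_le_of_approx (hL j) hη1 (happ j)
  have hbig : ∀ j, ρ₁ / 2 * ‖d j‖ ≤ ‖d (j + 1)‖ →
      d (j + 2) - (ρ₂ * ‖d (j + 2)‖) • e ∈ C := by
    intro j hj
    have h1 : ρ₁ / 4 * ‖d j‖ ≤ ‖L j (d j)‖ := by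
      have := norm_sub_norm_le (d (j + 1)) (L j (d j))
      have := happ j
      nlinarith [hdn j]
    have h2 := hinner (L j) (hL j) (L (j + 1)) (hL _) (d j) (hdC j) ‖d j‖ (hdn j).le le_rfl h1
    have h3 := h.absorb_le
      (hS.norm_two_step_le (hL j) (hL (j + 1)) hηpos.le hη1 (happ j) (happ (j + 1)))
    have h4 := h.add h2 h3
    refine h.sub_smul_mono (b := (κ - β * (η * (2 * M + 1))) * ‖d j‖) ?_ ?_
    · have h5 : ‖d (j + 2)‖ ≤ (M + 1) * ((M + 1) * ‖d j‖) :=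
        (hgrow (j + 1)).trans (mul_le_mul_of_nonneg_left (hgrow j) (by positivity))
      have h6 : ρ₂ * ‖d (j + 2)‖ ≤ κ / 2 * ‖d j‖ := by
        calc ρ₂ * ‖d (j + 2)‖ ≤ ρ₂ * ((M + 1) * ((M + 1) * ‖d j‖)) := by gcongr
          _ = κ / 2 * ‖d j‖ := by rw [hρ₂]; field_simp
      have h7 : κ / 2 * ‖d j‖ ≤ (κ - β * (η * (2 * M + 1))) * ‖d j‖ := by
        gcongr; linarith
      linarith
    · convert h4 using 1; module
  have hstep : ∀ t j, 0 ≤ t → d j - (t * ‖d j‖) • e ∈ C →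
      d (j + 1) - (ρ₁ / (M + 1) * t * ‖d (j + 1)‖) • e ∈ C := by
    intro t j ht hj
    refine h.sub_smul_mono ?_ (hmono j _ (by positivity) hj)
    calc ρ₁ / (M + 1) * t * ‖d (j + 1)‖ ≤ ρ₁ / (M + 1) * t * ((M + 1) * ‖d j‖) := by
          gcongr; exact hgrow j
      _ = ρ₁ * (t * ‖d j‖) := by field_simp
  have hsmall : ∀ t j, 0 ≤ t → ‖d (j + 1)‖ < ρ₁ / 2 * ‖d j‖ → d j - (t * ‖d j‖) • e ∈ C →
      d (j + 1) - (2 * t * ‖d (j + 1)‖) • e ∈ C := by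
    intro t j ht hlt hj
    refine h.sub_smul_mono ?_ (hmono j _ (by positivity) hj)
    nlinarith
  have hex : ∃ J, ρ₁ / 2 * ‖d J‖ ≤ ‖d (J + 1)‖ := by
    by_contra! hcon
    obtain ⟨a, ha, had⟩ := hinit
    set t := a / ‖d 0‖ with ht
    have htpos : 0 < t := div_pos ha (hdn 0)
    have hall : ∀ j, d j - (2 ^ j * t * ‖d j‖) • e ∈ C := by
      intro j
      induction j with
      | zero =>
        rw [ht, pow_zero, one_mul, div_mul_cancel₀ _ (hdn 0).ne']; exact had
      | succ j ih =>
        have := hsmall _ j (by positivity) (hcon j) ih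
        convert this using 4; ring
    have hbd : ∀ j : ℕ, (2 : ℝ) ^ j ≤ 1 / (γ * t) := by
      intro j
      have h1 := h.coercive (by have := hdn j; positivity) (hall j)
      rw [le_div_iff₀ (by positivity)]
      have h2 := hdn j
      have : 2 ^ j * (γ * t) * ‖d j‖ ≤ 1 * ‖d j‖ := by linarith
      exact le_of_mul_le_mul_right this h2
    obtain ⟨j, hj⟩ := pow_unbounded_of_one_lt (1 / (γ * t)) (one_lt_two : (1 : ℝ) < 2)
    exact absurd (hbd j) (not_le.2 hj)
  obtain ⟨J, hJ⟩ := hex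
  have hind : ∀ k, d (J + 2 + k) - (ρ * ‖d (J + 2 + k)‖) • e ∈ C ∧
      (d (J + 2 + k) - (ρ₂ * ‖d (J + 2 + k)‖) • e ∈ C ∨
        ρ₁ / 2 * ‖d (J + 1 + k)‖ ≤ ‖d (J + 1 + k + 1)‖) := by
    have hle : ∀ i, d i - (ρ₂ * ‖d i‖) • e ∈ C → d i - (ρ * ‖d i‖) • e ∈ C := fun i hi =>
      h.sub_smul_mono (mul_le_mul_of_nonneg_right (min_le_left _ _) (norm_nonneg _)) hi
    intro k
    induction k with
    | zero => exact ⟨hle _ (hbig J hJ), Or.inl (hbig J hJ)⟩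
    | succ k ih =>
      have e1 : J + 2 + (k + 1) = J + 1 + k + 2 := by ring
      have e2 : J + 2 + k = J + 1 + k + 1 := by ring
      have e3 : J + 1 + (k + 1) = J + 1 + k + 1 := by ring
      rw [e1, e3]
      rw [e2] at ih
      by_cases hA : ρ₁ / 2 * ‖d (J + 1 + k)‖ ≤ ‖d (J + 1 + k + 1)‖
      · exact ⟨hle _ (hbig _ hA), Or.inl (hbig _ hA)⟩
      · have hg : d (J + 1 + k + 1) - (ρ₂ * ‖d (J + 1 + k + 1)‖) • e ∈ C :=
          ih.2.resolve_right hA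
        refine ⟨h.sub_smul_mono (mul_le_mul_of_nonneg_right (min_le_right _ _) (norm_nonneg _))
          (hstep _ _ hρ₂pos.le hg), ?_⟩
        by_cases hB : ρ₁ / 2 * ‖d (J + 1 + k + 1)‖ ≤ ‖d (J + 1 + k + 1 + 1)‖
        · exact Or.inr hB
        · refine Or.inl (h.sub_smul_mono ?_ (hsmall _ _ hρ₂pos.le (not_le.1 hB) hg))
          have := norm_nonneg (d (J + 1 + k + 1 + 1))
          have e4 : J + 1 + k + 2 = J + 1 + k + 1 + 1 := rfl
          rw [e4]; nlinarith
  refine ⟨J + 2, fun j hj => ?_⟩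
  obtain ⟨k, rfl⟩ := Nat.exists_eq_add_of_le hj
  exact (hind k).1

end Domination

section Contraction

variable {X : Type*} [NormedAddCommGroup X] [NormedSpace ℝ X] {C : Set X} {e : X} {β γ M ρ₀ : ℝ}
  {S : Set (X →L[ℝ] X)}

set_option maxHeartbeats 1000000 in
/-- Two steps along approximate orbits contract the size and the oscillation of a vector `u`,
measured relative to a dominated vector `d`, as long as `u` stays unordered. -/
theorem OpFamily.exists_contraction (h : ConeUnit C e β γ) (hS : OpFamily C e S M ρ₀)
    {ρ c : ℝ} (hρ : 0 < ρ) (hc : 0 < c) :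
    ∃ B : ℝ, 1 ≤ B ∧ ∃ μ : ℝ, 0 < μ ∧ μ < 1 ∧ ∃ η : ℝ, 0 < η ∧ η ≤ 1 ∧
      ∀ L ∈ S, ∀ L' ∈ S, ∀ u u' u'' d d' d'' : X, d ∈ C →
      d - (ρ * ‖d‖) • e ∈ C → d'' - (ρ * ‖d''‖) • e ∈ C → c * ‖d‖ ≤ ‖d''‖ →
      ‖u' - L u‖ ≤ η * ‖u‖ → ‖u'' - L' u'‖ ≤ η * ‖u'‖ →
      ‖d' - L d‖ ≤ η * ‖d‖ → ‖d'' - L' d'‖ ≤ η * ‖d'‖ →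
      u'' ∉ C → -u'' ∉ C →
      ∀ V a b : ℝ, 0 ≤ a → 0 ≤ b → ‖u‖ ≤ V * ‖d‖ → a • d + u ∈ C → b • d - u ∈ C →
      B * (a + b) ≤ V →
      ‖u''‖ ≤ μ ^ 2 * V * ‖d''‖ ∧ ∃ a'' b'' : ℝ, 0 ≤ a'' ∧ 0 ≤ b'' ∧ a'' • d'' + u'' ∈ C ∧
        b'' • d'' - u'' ∈ C ∧ B * (a'' + b'') ≤ μ ^ 2 * V := by
  have hM := hS.nonneg
  have hβ := h.pos
  have hγ := h.pos'
  have hρ₀ := hS.pos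
  obtain ⟨D, hD, hehr⟩ := hS.ehrling (c / (8 * (M + 1))) (by positivity)
  set B := max 1 (D * β * (8 * (M + 1)) / c) with hB
  have hB1 : 1 ≤ B := le_max_left _ _
  have hBpos : 0 < B := by linarith
  have hBD : D * β * (8 * (M + 1)) ≤ B * c := by
    have : D * β * (8 * (M + 1)) / c ≤ B := le_max_right _ _
    rwa [div_le_iff₀ hc] at this
  set c₂ := γ * (ρ₀ * ρ) with hc₂
  have hc₂pos : 0 < c₂ := by positivity
  obtain ⟨κ, hκ, hinner⟩ := hS.inner (c₂ / (8 * B)) (by positivity)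
  set τ := 2 * κ / (β * (M + 1) ^ 2) with hτ
  have hτpos : 0 < τ := by positivity
  set σ := 2 * β * (2 * M + 1) / (c * ρ) with hσ
  have hσpos : 0 < σ := by positivity
  set η := min (min 1 (c / (8 * (M + 1)))) (min (1 / (8 * B * σ)) (τ / (4 * σ))) with hη
  have hηpos : 0 < η := by positivity
  have hη1 : η ≤ 1 := (min_le_left _ _).trans (min_le_left _ _)
  have hη2 : η * (8 * (M + 1)) ≤ c := by
    have : η ≤ c / (8 * (M + 1)) := (min_le_left _ _).trans (min_le_right _ _)
    rwa [le_div_iff₀ (by positivity)] at this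
  have hη3 : η * (8 * B * σ) ≤ 1 := by
    have : η ≤ 1 / (8 * B * σ) := (min_le_right _ _).trans (min_le_left _ _)
    rwa [le_div_iff₀ (by positivity)] at this
  have hη4 : η * (4 * σ) ≤ τ := by
    have : η ≤ τ / (4 * σ) := (min_le_right _ _).trans (min_le_right _ _)
    rwa [le_div_iff₀ (by positivity)] at this
  set ν := max (3 / 4) (1 - B * τ / 2) with hν
  have hν1 : 3 / 4 ≤ ν := le_max_left _ _
  have hν2 : 1 - B * τ / 2 ≤ ν := le_max_right _ _
  have hν3 : ν < 1 := max_lt (by norm_num) (by linarith [mul_pos hBpos hτpos])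
  refine ⟨B, hB1, √ν, Real.sqrt_pos.2 (by linarith), ?_, η, hηpos, hη1, ?_⟩
  · rw [Real.sqrt_lt' one_pos]; linarith
  intro L hL L' hL' u u' u'' d d' d'' hdC hd hd'' hcd hu hu' hd1 hd2 hn1 hn2 V a b ha hb huV
    hau hbu hBV
  rw [Real.sq_sqrt (by linarith)]
  have hdn := norm_nonneg d
  have hV : 0 ≤ V := le_trans (by positivity) hBV
  have haV : a ≤ V := by nlinarith
  have hbV : b ≤ V := by nlinarith
  have hd''C : d'' ∈ C := by
    have := h.add hd'' (h.smul (r := ρ * ‖d''‖) (by positivity) h.unit_mem')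
    simpa using this
  -- the norm estimate
  have hnorm : ‖u''‖ ≤ 1 / 2 * V * ‖d''‖ := by
    have hsd : ((a + b) * (β * ‖d‖)) • e + u ∈ C ∧ ((a + b) * (β * ‖d‖)) • e - u ∈ C := by
      have h1 := h.smul (add_nonneg ha hb) (h.absorb_sub (w := d) le_rfl)
      constructor
      · have := h.add h1 (h.add hau (h.smul hb hdC))
        convert this using 1; module
      · have := h.add h1 (h.add hbu (h.smul ha hdC))
        convert this using 1; module
    have h2 := hehr L hL u _ (by positivity) hsd.1 hsd.2
    have h3 : ‖u'‖ ≤ ‖L u‖ + ‖u' - L u‖ := by simpa using norm_add_le (L u) (u' - L u)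
    have h4 := hS.norm_le_of_approx hL' hη1 hu'
    have h5 : ‖u'‖ * (8 * (M + 1)) ≤ 3 * c * (V * ‖d‖) := by
      have e1 : c / (8 * (M + 1)) * ‖u‖ * (8 * (M + 1)) = c * ‖u‖ := by field_simp
      have e2 : D * ((a + b) * (β * ‖d‖)) * (8 * (M + 1)) ≤ c * (V * ‖d‖) := by
        calc D * ((a + b) * (β * ‖d‖)) * (8 * (M + 1))
            = (D * β * (8 * (M + 1))) * ((a + b) * ‖d‖) := by ring
          _ ≤ (B * c) * ((a + b) * ‖d‖) := by gcongr
          _ = c * ((B * (a + b)) * ‖d‖) := by ring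
          _ ≤ c * (V * ‖d‖) := by gcongr
      have e3 : η * ‖u‖ * (8 * (M + 1)) ≤ c * (V * ‖d‖) := by
        calc η * ‖u‖ * (8 * (M + 1)) = (η * (8 * (M + 1))) * ‖u‖ := by ring
          _ ≤ c * (V * ‖d‖) := by gcongr
      have e4 : c * ‖u‖ ≤ c * (V * ‖d‖) := by gcongr
      have e5 : ‖u'‖ * (8 * (M + 1)) ≤
          (c / (8 * (M + 1)) * ‖u‖ + D * ((a + b) * (β * ‖d‖)) + η * ‖u‖) * (8 * (M + 1)) := by
        gcongr; linarith
      linarith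
    have h6 : c * (V * ‖d‖) ≤ V * ‖d''‖ := by
      calc c * (V * ‖d‖) = V * (c * ‖d‖) := by ring
        _ ≤ V * ‖d''‖ := by gcongr
    have h7 := mul_nonneg hV (norm_nonneg d'')
    linarith
  -- the perturbation of the order bounds
  have hpert : ∀ x y : ℝ, 0 ≤ x → x ≤ V → |y| ≤ 1 →
      (x + η * σ * V) • d'' + y • u'' - L' (L (x • d + y • u)) ∈ C := by
    intro x y hx hxV hy
    have h1 := hS.norm_two_step_le hL hL' hηpos.le hη1 hu hu'
    have h2 := hS.norm_two_step_le hL hL' hηpos.le hη1 hd1 hd2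
    have h3 : ‖x • (d'' - L' (L d)) + y • (u'' - L' (L u))‖ ≤
        η * (2 * M + 1) * (2 * V * ‖d‖) := by
      refine (norm_add_le _ _).trans ?_
      rw [norm_smul, norm_smul, Real.norm_of_nonneg hx, Real.norm_eq_abs]
      have k1 : x * ‖d'' - L' (L d)‖ ≤ V * (η * (2 * M + 1) * ‖d‖) := by gcongr
      have k2 : |y| * ‖u'' - L' (L u)‖ ≤ 1 * (η * (2 * M + 1) * (V * ‖d‖)) := by
        gcongr; exact h1.trans (by gcongr)
      linarith
    have h4 := h.absorb_le h3
    have h5 := h.smul (r := η * σ * V) (by positivity) hd''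
    have h6 : β * (η * (2 * M + 1) * (2 * V * ‖d‖)) ≤ η * σ * V * (ρ * ‖d''‖) := by
      have : η * σ * V * (ρ * ‖d''‖) = β * (η * (2 * M + 1) * (2 * V * (‖d''‖ / c))) := by
        rw [hσ]; field_simp
      rw [this]
      gcongr
      rw [le_div_iff₀ hc]; linarith
    have h7 := h.add h5 (h.smul_add_mono h6 h4)
    convert h7 using 1
    simp only [map_add, map_smul]; module
  have hpa := hpert a 1 ha haV (by simp)
  have hpb := hpert b (-1) hb hbV (by simp)
  have hLLa : L' (L (a • d + (1 : ℝ) • u)) ∈ C :=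
    hS.map_mem L' hL' _ (hS.map_mem L hL _ (by rwa [one_smul]))
  have hLLb : L' (L (b • d + (-1 : ℝ) • u)) ∈ C :=
    hS.map_mem L' hL' _ (hS.map_mem L hL _ (by rwa [neg_one_smul, ← sub_eq_add_neg]))
  have hbda : (a + η * σ * V) • d'' + u'' ∈ C := by
    have := h.add hpa hLLa
    convert this using 1; module
  have hbdb : (b + η * σ * V) • d'' - u'' ∈ C := by
    have := h.add hpb hLLb
    convert this using 1; module
  have hησ : 0 ≤ η * σ * V := by positivity
  have hBη : B * (2 * (η * σ * V)) ≤ 1 / 4 * V := by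
    have : B * (2 * (η * σ * V)) = (η * (8 * B * σ)) * V / 4 := by ring
    rw [this]
    have := mul_le_mul_of_nonneg_right hη3 hV
    linarith
  have hVd'' : 0 ≤ V * ‖d''‖ := mul_nonneg hV (norm_nonneg _)
  refine ⟨hnorm.trans (by nlinarith), ?_⟩
  by_cases hsmall : B * (a + b) ≤ V / 2
  · refine ⟨a + η * σ * V, b + η * σ * V, by positivity, by positivity, hbda, hbdb, ?_⟩
    nlinarith
  -- the oscillation is comparable to `V`, so one of the two halves gains
  have hLd : c₂ * ‖d‖ ≤ ‖L d‖ := by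
    have h1 := hS.map_mem L hL _ hd
    have h2 := h.smul (r := ρ * ‖d‖) (by positivity) (hS.unit L hL)
    have h3 := h.add h1 h2
    have := h.coercive (a := ρ₀ * ρ * ‖d‖) (d := L d) (by positivity) (by
      convert h3 using 1
      simp only [map_sub, map_smul]; module)
    rw [hc₂]; linarith
  have hgain : ∀ w ∈ C, ‖w‖ ≤ 2 * V * ‖d‖ → (a + b) * ‖L d‖ / 2 ≤ ‖L w‖ →
      L' (L w) - (τ * V) • d'' ∈ C := by
    intro w hw hwn hLw
    have h1 : c₂ / (8 * B) * (2 * V * ‖d‖) ≤ ‖L w‖ := by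
      have k1 : V / 2 * (c₂ * ‖d‖) ≤ B * (a + b) * ‖L d‖ := by
        gcongr; linarith
      have k2 : c₂ / (8 * B) * (2 * V * ‖d‖) = (V / 2 * (c₂ * ‖d‖)) / (2 * B) := by field_simp; ring
      rw [k2, div_le_iff₀ (by positivity)]
      have : ‖L w‖ * (2 * B) ≥ (a + b) * ‖L d‖ / 2 * (2 * B) := by gcongr
      linarith
    have h2 := hinner L hL L' hL' w hw _ (by positivity) hwn h1
    have h3 : ‖d''‖ ≤ (M + 1) ^ 2 * ‖d‖ := by
      have k1 := hS.norm_le_of_approx hL hη1 hd1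
      have k2 := hS.norm_le_of_approx hL' hη1 hd2
      calc ‖d''‖ ≤ (M + 1) * ((M + 1) * ‖d‖) := k2.trans (by gcongr)
        _ = _ := by ring
    have h4 := h.smul (r := τ * V) (by positivity) (h.absorb_sub h3)
    have h5 := h.add h2 h4
    have h6 : τ * V * (β * ((M + 1) ^ 2 * ‖d‖)) = κ * (2 * V * ‖d‖) := by
      rw [hτ]; field_simp
    rw [smul_sub, smul_smul, h6] at h5
    convert h5 using 1; abel
  have hwn : ∀ x y : ℝ, 0 ≤ x → x ≤ V → |y| ≤ 1 → ‖x • d + y • u‖ ≤ 2 * V * ‖d‖ := by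
    intro x y hx hxV hy
    refine (norm_add_le _ _).trans ?_
    rw [norm_smul, norm_smul, Real.norm_of_nonneg hx, Real.norm_eq_abs]
    have k1 : x * ‖d‖ ≤ V * ‖d‖ := by gcongr
    have k2 : |y| * ‖u‖ ≤ 1 * (V * ‖d‖) := by gcongr
    linarith
  have hητ : 2 * (η * σ * V) ≤ τ * V / 2 := by
    have := mul_le_mul_of_nonneg_right hη4 hV
    linarith
  have hfinal : B * (a + η * σ * V - τ * V + (b + η * σ * V)) ≤ ν * V := by
    have : B * (a + η * σ * V - τ * V + (b + η * σ * V)) =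
        B * (a + b) + B * (2 * (η * σ * V)) - B * (τ * V) := by ring
    rw [this]
    have k1 : B * (2 * (η * σ * V)) ≤ B * (τ * V / 2) := by gcongr
    nlinarith
  have hsum : (a + b) * ‖L d‖ ≤
      ‖L (a • d + (1 : ℝ) • u)‖ + ‖L (b • d + (-1 : ℝ) • u)‖ := by
    refine le_trans (le_of_eq ?_) (norm_add_le _ _)
    rw [← map_add]
    have : a • d + (1 : ℝ) • u + (b • d + (-1 : ℝ) • u) = (a + b) • d := by module
    rw [this, map_smul, norm_smul, Real.norm_of_nonneg (by positivity)]
  by_cases hhalf : (a + b) * ‖L d‖ / 2 ≤ ‖L (a • d + (1 : ℝ) • u)‖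
  · have h1 := h.add hpa (hgain _ (by rwa [one_smul]) (hwn a 1 ha haV (by simp)) hhalf)
    have h2 : (a + η * σ * V - τ * V) • d'' + u'' ∈ C := by
      convert h1 using 1; module
    refine ⟨a + η * σ * V - τ * V, b + η * σ * V, ?_, by positivity, h2, hbdb, hfinal⟩
    by_contra! hneg
    refine hn1 ?_
    have := h.add h2 (h.smul (r := -(a + η * σ * V - τ * V)) (by linarith) hd''C)
    convert this using 1; module
  · have hhalf' : (a + b) * ‖L d‖ / 2 ≤ ‖L (b • d + (-1 : ℝ) • u)‖ := by linarith
    have h1 := h.add hpb (hgain _ (by rwa [neg_one_smul, ← sub_eq_add_neg])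
      (hwn b (-1) hb hbV (by simp)) hhalf')
    have h2 : (b + η * σ * V - τ * V) • d'' - u'' ∈ C := by
      convert h1 using 1; module
    refine ⟨a + η * σ * V, b + η * σ * V - τ * V, by positivity, ?_, hbda, h2, by linarith⟩
    by_contra! hneg
    refine hn2 ?_
    have := h.add h2 (h.smul (r := -(b + η * σ * V - τ * V)) (by linarith) hd''C)
    convert this using 1; module

end Contraction

section Auxiliary

/-- A positive bounded sequence with `w (j + 1) ≥ c * w j` has `N + 1` times within a window of
uniform length after which it grows at most at rate `θ`. -/
theorem exists_good_times {c θ : ℝ} (hc : 0 < c) (hθ : 1 < θ) (N : ℕ) :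
    ∃ m : ℕ, 0 < m ∧ ∀ (w : ℕ → ℝ) (δ : ℝ), (∀ j, 0 < w j) → (∀ j, c * w j ≤ w (j + 1)) →
      (∀ j, w j ≤ δ) → ∃ f : ℕ → ℕ, StrictMono f ∧ f N ≤ f 0 + m ∧
        ∀ i j, w (f i + j) ≤ θ ^ j * w (f i) := by
  have hθ0 : 0 < θ := by linarith
  have hq : 0 < (c / θ) ^ N := by positivity
  obtain ⟨m₀, hm₀⟩ := pow_unbounded_of_one_lt (1 / (c / θ) ^ N) hθ
  have hm : 1 < θ ^ (m₀ + 1) * (c / θ) ^ N := by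
    rw [div_lt_iff₀ hq] at hm₀
    have : θ ^ m₀ ≤ θ ^ (m₀ + 1) := pow_le_pow_right₀ hθ.le (Nat.le_succ _)
    nlinarith
  refine ⟨m₀ + 1, Nat.succ_pos _, fun w δ hw hcw hwδ => ?_⟩
  set v : ℕ → ℝ := fun j => w j / θ ^ j with hv
  have hvpos : ∀ j, 0 < v j := fun j => div_pos (hw j) (by positivity)
  have hvδ : ∀ j, v j ≤ δ / θ ^ j := fun j => by
    simp only [hv]; gcongr; exact hwδ j
  have hδ : 0 < δ := (hw 0).trans_le (hwδ 0)
  have hstep : ∀ j, c / θ * v j ≤ v (j + 1) := fun j => by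
    simp only [hv]
    rw [pow_succ, div_mul_div_comm, mul_comm (θ ^ j)]
    gcongr; exact hcw j
  have hnext : ∀ g : ℕ, ∃ g', g < g' ∧ ∀ l, g < l → v l ≤ v g' := by
    intro g
    obtain ⟨L, hL⟩ := pow_unbounded_of_one_lt (δ / v (g + 1)) hθ
    obtain ⟨g', hg', hmax⟩ := Finset.exists_max_image (Finset.Ioc g (g + 1 + L)) v
      ⟨g + 1, by simp⟩
    rw [Finset.mem_Ioc] at hg'
    refine ⟨g', hg'.1, fun l hl => ?_⟩
    by_cases hlL : l ≤ g + 1 + L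
    · exact hmax l (Finset.mem_Ioc.2 ⟨hl, hlL⟩)
    · have h1 : v l ≤ v (g + 1) := by
        refine (hvδ l).trans ?_
        rw [div_le_iff₀ (by positivity)]
        rw [div_lt_iff₀ (hvpos _)] at hL
        have : θ ^ L ≤ θ ^ l := pow_le_pow_right₀ hθ.le (by omega)
        nlinarith [hvpos (g + 1)]
      exact h1.trans (hmax (g + 1) (Finset.mem_Ioc.2 ⟨by omega, by omega⟩))
  choose nxt hlt hmax using hnext
  set g : ℕ → ℕ := fun i => nxt^[i + 1] 0 with hg
  have hgs : ∀ i, g (i + 1) = nxt (g i) := fun i => Function.iterate_succ_apply' _ _ _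
  have hmono : StrictMono g := strictMono_nat_of_lt_succ fun i => by rw [hgs]; exact hlt _
  have hgood : ∀ i l, g i ≤ l → v l ≤ v (g i) := by
    intro i l hl
    rcases i with _ | i
    · exact hmax 0 l ((hlt 0).trans_le hl)
    · rw [hgs] at hl ⊢
      exact hmax _ l ((hlt _).trans_le hl)
  have hgood' : ∀ i j, w (g i + j) ≤ θ ^ j * w (g i) := by
    intro i j
    have := hgood i (g i + j) (by omega)
    simp only [hv] at this
    rw [pow_add, div_le_div_iff₀ (by positivity) (by positivity)] at this
    have h2 : 0 < θ ^ g i := by positivity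
    have h3 : w (g i + j) * θ ^ g i ≤ (θ ^ j * w (g i)) * θ ^ g i := by linarith
    exact le_of_mul_le_mul_right h3 h2
  have hlow : ∀ i, (c / θ) ^ i * v (g 0) ≤ v (g i) := by
    intro i
    induction i with
    | zero => simp
    | succ i ih =>
      calc (c / θ) ^ (i + 1) * v (g 0) = c / θ * ((c / θ) ^ i * v (g 0)) := by ring
        _ ≤ c / θ * v (g i) := by gcongr
        _ ≤ v (g i + 1) := hstep _
        _ ≤ v (g (i + 1)) := by rw [hgs]; exact hmax _ _ (Nat.lt_succ_self _)
  have hex : ∃ i, g ((i + 1) * N) ≤ g (i * N) + (m₀ + 1) := by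
    by_contra! hcon
    have hlin : ∀ i, i * (m₀ + 1) ≤ g (i * N) := by
      intro i
      induction i with
      | zero => simp
      | succ i ih =>
        have := hcon i
        rw [Nat.succ_mul]; omega
    obtain ⟨i, hi⟩ := pow_unbounded_of_one_lt (δ / v (g 0)) hm
    rw [div_lt_iff₀ (hvpos _)] at hi
    have h1 := (hlow (i * N)).trans (hvδ _)
    have h2 : θ ^ (i * (m₀ + 1)) ≤ θ ^ g (i * N) := pow_le_pow_right₀ hθ.le (hlin i)
    rw [le_div_iff₀ (by positivity)] at h1
    have h3 : (θ ^ (m₀ + 1) * (c / θ) ^ N) ^ i * v (g 0) =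
        (c / θ) ^ (i * N) * v (g 0) * θ ^ (i * (m₀ + 1)) := by
      rw [mul_pow, ← pow_mul, ← pow_mul, Nat.mul_comm N, Nat.mul_comm (m₀ + 1), mul_right_comm,
        mul_comm (θ ^ _), mul_right_comm, mul_comm (v _)]
    have h4 : 0 < (c / θ) ^ (i * N) * v (g 0) := mul_pos (by positivity) (hvpos _)
    nlinarith
  obtain ⟨i, hi⟩ := hex
  refine ⟨fun j => g (i * N + j), fun a b hab => hmono (by simpa using hab), ?_,
    fun a b => hgood' _ _⟩
  simpa [Nat.succ_mul] using hi

theorem IsCompact.exists_card_pigeonhole {X : Type*} [PseudoMetricSpace X] {K : Set X}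
    (hK : IsCompact K) {r : ℝ} (hr : 0 < r) :
    ∃ N : ℕ, ∀ f : ℕ → X, (∀ i, f i ∈ K) → ∃ i j, i < j ∧ j ≤ N ∧ dist (f i) (f j) < r := by
  obtain ⟨t, -, htf, htc⟩ := hK.finite_cover_balls (half_pos hr)
  refine ⟨htf.toFinset.card, fun f hf => ?_⟩
  have hch : ∀ i, ∃ y ∈ t, dist (f i) y < r / 2 := fun i => by
    obtain ⟨y, hy, hfy⟩ := mem_iUnion₂.1 (htc (hf i))
    exact ⟨y, hy, hfy⟩
  choose c hct hcd using hch
  obtain ⟨i, hi, j, hj, hij, heq⟩ := Finset.exists_ne_map_eq_of_card_lt_of_maps_to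
    (s := Finset.range (htf.toFinset.card + 1)) (t := htf.toFinset) (by simp)
    (f := c) (fun i _ => by simpa using hct i)
  have key : ∀ i j, c i = c j → dist (f i) (f j) < r := fun i j h => by
    have h1 := hcd i
    have h2 := hcd j
    rw [h] at h1
    rw [dist_comm] at h2
    linarith [dist_triangle (f i) (c j) (f j)]
  simp only [Finset.mem_range] at hi hj
  rcases lt_or_gt_of_ne hij with h | h
  · exact ⟨i, j, h, by omega, key i j heq⟩
  · exact ⟨j, i, h, by omega, key j i heq.symm⟩

variable {X : Type*} [NormedAddCommGroup X] [NormedSpace ℝ X]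

/-- A mean value principle: increments lie in a closed convex set containing the derivatives. -/
theorem sub_sub_mem_of_fderiv_sub_mem {C : Set X} (hconv : Convex ℝ C) (hcl : IsClosed C)
    {F : X → X} (hF : Differentiable ℝ F) {x v w : X}
    (hmem : ∀ t ∈ Icc (0 : ℝ) 1, fderiv ℝ F (x + t • v) v - w ∈ C) :
    F (x + v) - F x - w ∈ C := by
  by_contra hnot
  obtain ⟨f, s, hfs, hsf⟩ := geometric_hahn_banach_closed_point hconv hcl hnot
  set g : ℝ → ℝ := fun t => f (F (x + t • v) - t • w) with hg
  have hder : ∀ t : ℝ, HasDerivAt g (f (fderiv ℝ F (x + t • v) v - w)) t := by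
    intro t
    have h1 : HasDerivAt (fun t : ℝ => x + t • v) v t := by
      simpa using ((hasDerivAt_id t).smul_const v).const_add x
    have h2 : HasDerivAt (fun t : ℝ => F (x + t • v)) (fderiv ℝ F (x + t • v) v) t :=
      (hF (x + t • v)).hasFDerivAt.comp_hasDerivAt t h1
    have h3 : HasDerivAt (fun t : ℝ => t • w) w t := by
      simpa using (hasDerivAt_id t).smul_const w
    exact f.hasFDerivAt.comp_hasDerivAt t (h2.sub h3)
  obtain ⟨t, ht, hgt⟩ := exists_hasDerivAt_eq_slope g _ (zero_lt_one' ℝ)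
    (fun t _ => (hder t).continuousAt.continuousWithinAt) (fun t _ => hder t)
  have h1 := hfs _ (hmem t (Ioo_subset_Icc_self ht))
  rw [hgt] at h1
  have h2 : g 1 - g 0 = f (F (x + v) - F x - w) := by
    simp only [hg, one_smul, zero_smul, add_zero, sub_zero, map_sub, map_zero]; ring
  rw [h2] at h1
  simp only [sub_zero, div_one] at h1
  linarith

/-- The derivative of a compact map is a compact operator. -/
theorem IsCompactMap.isCompactOperator_fderiv [CompleteSpace X] {F : X → X} (hF : IsCompactMap F)
    {p : X} (hd : DifferentiableAt ℝ F p) : IsCompactOperator (fderiv ℝ F p) := by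
  refine (isCompactOperator_iff_isCompact_closure_image_closedBall
    (fderiv ℝ F p : X →ₗ[ℝ] X) zero_lt_one).2 ?_
  refine TotallyBounded.isCompact_of_isClosed (TotallyBounded.closure ?_) isClosed_closure
  rw [Metric.totallyBounded_iff]
  intro ε hε
  have hlittle := hd.hasFDerivAt.isLittleO.def (half_pos hε)
  obtain ⟨r, hr, hball⟩ := Metric.eventually_nhds_iff.1 hlittle
  set t := r / 2 with ht
  have htpos : 0 < t := by positivity
  have hB := hF (closedBall p t) isBounded_closedBall
  have hB' : IsCompact ((fun y => t⁻¹ • (y - F p)) '' closure (F '' closedBall p t)) :=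
    hB.image (by fun_prop)
  obtain ⟨T, hTf, hTc⟩ := Metric.totallyBounded_iff.1 hB'.totallyBounded (ε / 2) (half_pos hε)
  refine ⟨T, hTf, ?_⟩
  rintro _ ⟨v, hv, rfl⟩
  have hv1 : ‖v‖ ≤ 1 := by simpa using hv
  have hpv : p + t • v ∈ closedBall p t := by
    rw [mem_closedBall, dist_eq_norm, add_sub_cancel_left, norm_smul, Real.norm_of_nonneg htpos.le]
    nlinarith
  obtain ⟨y, hy, hyd⟩ := mem_iUnion₂.1 (hTc ⟨F (p + t • v), subset_closure ⟨_, hpv, rfl⟩, rfl⟩)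
  refine mem_biUnion hy ?_
  have h1 := hball (y := p + t • v) (by
    rw [mem_closedBall] at hpv; linarith)
  rw [add_sub_cancel_left] at h1
  have h2 : ‖fderiv ℝ F p v - t⁻¹ • (F (p + t • v) - F p)‖ ≤ ε / 2 := by
    have : fderiv ℝ F p v - t⁻¹ • (F (p + t • v) - F p) =
        (-t⁻¹) • (F (p + t • v) - F p - fderiv ℝ F p (t • v)) := by
      rw [map_smul, smul_sub _ _ (t • _), smul_smul]
      have : -t⁻¹ * t = -1 := by field_simp
      rw [this]; module
    rw [this, norm_smul, norm_neg, norm_inv, Real.norm_of_nonneg htpos.le,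
      inv_mul_le_iff₀ htpos]
    refine h1.trans ?_
    rw [norm_smul, Real.norm_of_nonneg htpos.le]
    have : t * ‖v‖ ≤ t * 1 := by gcongr
    nlinarith
  rw [mem_ball, dist_eq_norm] at *
  calc ‖fderiv ℝ F p v - y‖ = ‖(fderiv ℝ F p v - t⁻¹ • (F (p + t • v) - F p)) +
        (t⁻¹ • (F (p + t • v) - F p) - y)‖ := by congr 1; abel
    _ ≤ _ := norm_add_le _ _
    _ < ε := by linarith

/-- A `C¹` map is uniformly differentiable near a compact set. -/
theorem exists_norm_sub_sub_le_of_contDiff {F : X → X} (hF : ContDiff ℝ 1 F) {K : Set X}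
    (hK : IsCompact K) {η : ℝ} (hη : 0 < η) :
    ∃ r : ℝ, 0 < r ∧ ∀ p ∈ K, ∀ w : X, ‖w‖ ≤ r →
      ‖F (p + w) - F p - fderiv ℝ F p w‖ ≤ η * ‖w‖ := by
  have hcont : Continuous (fderiv ℝ F) := hF.continuous_fderiv (by norm_num)
  have := hK.uniformContinuousAt_of_continuousAt (fderiv ℝ F)
    (fun p _ => hcont.continuousAt) (Metric.dist_mem_uniformity hη)
  obtain ⟨r, hr, hsub⟩ := Metric.mem_uniformity_dist.1 this
  refine ⟨r / 2, half_pos hr, fun p hp w hw => ?_⟩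
  have hd : Differentiable ℝ F := hF.differentiable (by norm_num)
  have := (convex_closedBall p (r / 2)).norm_image_sub_le_of_norm_fderiv_le'
    (f := F) (φ := fderiv ℝ F p) (C := η) (x := p) (y := p + w) (fun q _ => hd q)
    (fun q hq => by
      have h1 : dist p q < r := by
        rw [dist_comm]; rw [mem_closedBall] at hq; linarith
      have h2 : dist (fderiv ℝ F p) (fderiv ℝ F q) < η := hsub h1 hp
      rw [dist_comm, dist_eq_norm] at h2
      exact h2.le)
    (mem_closedBall_self (half_pos hr).le)
    (by simpa [dist_eq_norm] using hw)
  simpa using this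

end Auxiliary

section MonotoneSystem

variable {X : Type*} [NormedAddCommGroup X] [NormedSpace ℝ X] {C : Set X} {e : X} {β γ M ρ₀ : ℝ}

/-- A vector dominated by `d` and approximately propagated along operators of the family decays
geometrically as long as it stays unordered, provided `d` grows slowly. -/
theorem OpFamily.exists_geometric_decay {S : Set (X →L[ℝ] X)} (h : ConeUnit C e β γ)
    (hS : OpFamily C e S M ρ₀) {ρ c : ℝ} (hρ : 0 < ρ) (hc : 0 < c) :
    ∃ θ : ℝ, 1 < θ ∧ ∃ l : ℝ, 0 < l ∧ l < 1 ∧ ∃ η : ℝ, 0 < η ∧ ∀ r : ℝ, 0 < r →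
      ∃ r' : ℝ, 0 < r' ∧ ∀ (L : ℕ → X →L[ℝ] X) (u d : ℕ → X), (∀ j, L j ∈ S) →
        (∀ j, d j ∈ C) → (∀ j, d j ≠ 0) → (∀ j, d j - (ρ * ‖d j‖) • e ∈ C) →
        (∀ j, c * ‖d j‖ ≤ ‖d (j + 1)‖) → (∀ j, ‖d (j + 1) - L j (d j)‖ ≤ η * ‖d j‖) →
        (∀ j, ‖d j‖ ≤ θ ^ j * ‖d 0‖) →
        (∀ j, ‖u j‖ ≤ r → ‖u (j + 1) - L j (u j)‖ ≤ η * ‖u j‖) →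
        (∀ j, u j ∉ C ∧ -u j ∉ C) → ‖u 0‖ ≤ r' → ∃ D : ℝ, ∀ j, ‖u j‖ ≤ D * l ^ j := by
  have hM := hS.nonneg
  have hβ := h.pos
  obtain ⟨B, hB, μ, hμ0, hμ1, η, hη, hη1, hcon⟩ :=
    hS.exists_contraction h hρ (c := c ^ 2) (by positivity)
  have hθ1 : 1 < 2 / (1 + μ) := by rw [lt_div_iff₀ (by positivity)]; linarith
  have hl1 : μ * (2 / (1 + μ)) < 1 := by
    rw [mul_div_assoc', div_lt_one (by positivity)]; linarith
  set θ := 2 / (1 + μ) with hθ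
  have hθ0 : 0 < θ := by positivity
  have hl0 : 0 < μ * θ := by positivity
  set l := μ * θ with hl
  set Γ := 1 + 2 * B * β / ρ with hΓ
  have hΓ1 : 1 ≤ Γ := by
    have : 0 ≤ 2 * B * β / ρ := by positivity
    linarith
  have hΓ0 : 0 < Γ := by linarith
  refine ⟨θ, hθ1, l, hl0, hl1, η, hη, fun r hr => ⟨r / ((M + 1) * Γ), by positivity, ?_⟩⟩
  intro L u d hL hdC hd0 hdom hgrow hdapp hdθ huapp hun hu0
  rw [le_div_iff₀ (by positivity)] at hu0
  have hd0' : 0 < ‖d 0‖ := norm_pos_iff.2 (hd0 0)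
  set V := Γ * ‖u 0‖ / ‖d 0‖ with hV
  have hVpos : 0 ≤ V := by positivity
  have hVd : V * ‖d 0‖ = Γ * ‖u 0‖ := by rw [hV]; field_simp
  have hsmall : ∀ i, ‖u (2 * i)‖ ≤ μ ^ (2 * i) * V * ‖d (2 * i)‖ →
      ‖u (2 * i)‖ ≤ Γ * ‖u 0‖ * l ^ (2 * i) := by
    intro i hi
    calc ‖u (2 * i)‖ ≤ μ ^ (2 * i) * V * ‖d (2 * i)‖ := hi
      _ ≤ μ ^ (2 * i) * V * (θ ^ (2 * i) * ‖d 0‖) := by gcongr; exact hdθ _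
      _ = (V * ‖d 0‖) * l ^ (2 * i) := by rw [hl, mul_pow]; ring
      _ = _ := by rw [hVd]
  have hsmall' : ∀ i, ‖u (2 * i)‖ ≤ Γ * ‖u 0‖ * l ^ (2 * i) → ‖u (2 * i)‖ ≤ r ∧
      ‖u (2 * i + 1)‖ ≤ (M + 1) * ‖u (2 * i)‖ ∧ ‖u (2 * i + 1)‖ ≤ r := by
    intro i hi
    have h1 : ‖u (2 * i)‖ ≤ Γ * ‖u 0‖ :=
      hi.trans (mul_le_of_le_one_right (by positivity) (pow_le_one₀ hl0.le hl1.le))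
    have h2 : ‖u (2 * i)‖ ≤ r := by nlinarith [norm_nonneg (u (2 * i))]
    have h3 := hS.norm_le_of_approx (hL _) hη1 (huapp _ h2)
    refine ⟨h2, h3, h3.trans ?_⟩
    calc (M + 1) * ‖u (2 * i)‖ ≤ (M + 1) * (Γ * ‖u 0‖) := by gcongr
      _ ≤ r := by linarith
  have hind : ∀ i, ‖u (2 * i)‖ ≤ μ ^ (2 * i) * V * ‖d (2 * i)‖ ∧ ∃ a b : ℝ, 0 ≤ a ∧ 0 ≤ b ∧
      a • d (2 * i) + u (2 * i) ∈ C ∧ b • d (2 * i) - u (2 * i) ∈ C ∧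
      B * (a + b) ≤ μ ^ (2 * i) * V := by
    intro i
    induction i with
    | zero =>
      refine ⟨?_, β * ‖u 0‖ / (ρ * ‖d 0‖), β * ‖u 0‖ / (ρ * ‖d 0‖), by positivity,
        by positivity, ?_, ?_, ?_⟩
      · simp only [mul_zero, pow_zero, one_mul, hVd]
        nlinarith [norm_nonneg (u 0)]
      · have h1 := h.add (h.smul (r := β * ‖u 0‖ / (ρ * ‖d 0‖)) (by positivity) (hdom 0))
          (h.absorb (u 0))
        have h2 : β * ‖u 0‖ / (ρ * ‖d 0‖) * (ρ * ‖d 0‖) = β * ‖u 0‖ := by field_simp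
        rw [smul_sub, smul_smul, h2] at h1
        convert h1 using 1; simp only [mul_zero]; abel
      · have h1 := h.add (h.smul (r := β * ‖u 0‖ / (ρ * ‖d 0‖)) (by positivity) (hdom 0))
          (h.absorb (-u 0))
        have h2 : β * ‖u 0‖ / (ρ * ‖d 0‖) * (ρ * ‖d 0‖) = β * ‖u 0‖ := by field_simp
        rw [smul_sub, smul_smul, h2, norm_neg] at h1
        convert h1 using 1; simp only [mul_zero]; abel
      · simp only [mul_zero, pow_zero, one_mul]
        rw [hV, hΓ, le_div_iff₀ hd0']
        have : B * (β * ‖u 0‖ / (ρ * ‖d 0‖) + β * ‖u 0‖ / (ρ * ‖d 0‖)) * ‖d 0‖ =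
          2 * B * β / ρ * ‖u 0‖ := by field_simp; ring
        rw [this]
        nlinarith [norm_nonneg (u 0)]
    | succ i ih =>
      obtain ⟨ih1, a, b, ha, hb, hau, hbu, hab⟩ := ih
      obtain ⟨s1, s2, s3⟩ := hsmall' i (hsmall i ih1)
      have hg2 : c ^ 2 * ‖d (2 * i)‖ ≤ ‖d (2 * i + 1 + 1)‖ := by
        have := hgrow (2 * i)
        have := hgrow (2 * i + 1)
        nlinarith
      have key := hcon (L (2 * i)) (hL _) (L (2 * i + 1)) (hL _) (u (2 * i)) (u (2 * i + 1))
        (u (2 * i + 1 + 1)) (d (2 * i)) (d (2 * i + 1)) (d (2 * i + 1 + 1)) (hdC _) (hdom _)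
        (hdom _) hg2 (huapp _ s1) (huapp _ s3) (hdapp _) (hdapp _) (hun _).1 (hun _).2
        (μ ^ (2 * i) * V) a b ha hb ih1 hau hbu hab
      have e1 : μ ^ 2 * (μ ^ (2 * i) * V) = μ ^ (2 * (i + 1)) * V := by ring
      rw [e1] at key
      exact key
  refine ⟨(M + 1) * Γ * ‖u 0‖ / l, fun j => ?_⟩
  rcases Nat.even_or_odd' j with ⟨i, rfl | rfl⟩
  · refine (hsmall i (hind i).1).trans ?_
    gcongr
    rw [le_div_iff₀ hl0]
    have : 0 ≤ Γ * ‖u 0‖ := by positivity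
    nlinarith
  · have h1 := hsmall i (hind i).1
    refine (hsmall' i h1).2.1.trans ?_
    calc (M + 1) * ‖u (2 * i)‖ ≤ (M + 1) * (Γ * ‖u 0‖ * l ^ (2 * i)) := by gcongr
      _ = (M + 1) * Γ * ‖u 0‖ / l * l ^ (2 * i + 1) := by
        rw [pow_succ]; field_simp

/-- A `C¹` strongly monotone map together with a compact set `K` on which its derivatives form a
controlled family of positive operators. -/
structure MonotoneSystem (F : X → X) (K : Set X) (C : Set X) (e : X) (β γ M ρ₀ : ℝ) : Prop where
  unit : ConeUnit C e β γ
  ops : OpFamily C e (fderiv ℝ F '' K) M ρ₀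
  compact : IsCompact K
  smooth : ContDiff ℝ 1 F
  mono : ∀ {x y : X}, y - x ∈ C → F y - F x ∈ C
  strict : ∀ {x y : X}, y - x ∈ C → y ≠ x → ∃ a : ℝ, 0 < a ∧ F y - F x - a • e ∈ C

theorem ConeUnit.exists_monotoneSystem [CompleteSpace X] (h : ConeUnit C e β γ) {F : X → X}
    (hF : ContDiff ℝ 1 F) (hcpt : IsCompactMap F) (hpos : ∀ x, StronglyPositive C (fderiv ℝ F x))
    {K : Set X} (hK : IsCompact K) : ∃ M ρ₀ : ℝ, MonotoneSystem F K C e β γ M ρ₀ := by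
  have hd : Differentiable ℝ F := hF.differentiable (by norm_num)
  have hcont : Continuous (fderiv ℝ F) := hF.continuous_fderiv (by norm_num)
  obtain ⟨M, ρ₀, hop⟩ := h.exists_opFamily (hK.image hcont)
    (by rintro _ ⟨p, -, rfl⟩; exact hcpt.isCompactOperator_fderiv (hd p))
    (by rintro _ ⟨p, -, rfl⟩; exact hpos p)
  have hstrict : ∀ {x y : X}, y - x ∈ C → y ≠ x → ∃ a : ℝ, 0 < a ∧ F y - F x - a • e ∈ C := by
    intro x y hxy hne
    have hv : y - x ∈ C \ {0} := ⟨hxy, by simpa [sub_eq_zero] using hne⟩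
    have hZ : IsCompact ((fun t : ℝ => fderiv ℝ F (x + t • (y - x)) (y - x)) '' Icc 0 1) := by
      refine isCompact_Icc.image ?_
      exact (hcont.comp (by fun_prop)).clm_apply continuous_const
    obtain ⟨a, ha, H⟩ := ConeUnit.exists_smul_le_of_isCompact e hZ (C := C) (by
      rintro _ ⟨t, -, rfl⟩; exact hpos _ _ hv)
    refine ⟨a, ha, ?_⟩
    have := sub_sub_mem_of_fderiv_sub_mem h.convex h.closed hd (x := x) (v := y - x)
      (w := a • e) fun t ht => H _ ⟨t, ht, rfl⟩
    simpa using this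
  refine ⟨M, ρ₀, h, hop, hK, hF, fun {x y} hxy => ?_, hstrict⟩
  by_cases hne : y = x
  · simpa [hne] using h.zero_mem
  · obtain ⟨a, ha, H⟩ := hstrict hxy hne
    simpa using h.add H (h.smul ha.le h.unit_mem')

namespace MonotoneSystem

variable {F : X → X} {K : Set X}

theorem iterate_mono (h : MonotoneSystem F K C e β γ M ρ₀) {x y : X} (hxy : y - x ∈ C) (n : ℕ) :
    F^[n] y - F^[n] x ∈ C := by
  induction n with
  | zero => simpa using hxy
  | succ n ih => rw [Function.iterate_succ_apply', Function.iterate_succ_apply']; exact h.mono ih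

theorem iterate_ne (h : MonotoneSystem F K C e β γ M ρ₀) {x y : X} (hxy : y - x ∈ C)
    (hne : y ≠ x) (n : ℕ) : F^[n] y ≠ F^[n] x := by
  induction n with
  | zero => simpa using hne
  | succ n ih =>
    rw [Function.iterate_succ_apply', Function.iterate_succ_apply']
    obtain ⟨a, ha, H⟩ := h.strict (h.iterate_mono hxy n) ih
    intro heq
    have := h.unit.coercive ha.le H
    rw [heq, sub_self, norm_zero] at this
    nlinarith [h.unit.pos']

/-- Nearby ordered orbits are eventually uniformly strongly ordered, and their difference is an
approximate orbit of the linearization. -/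
theorem exists_dominated (h : MonotoneSystem F K C e β γ M ρ₀) :
    ∃ ρ : ℝ, 0 < ρ ∧ ∃ c : ℝ, 0 < c ∧ ∀ η : ℝ, 0 < η → ∃ δ : ℝ, 0 < δ ∧ ∀ x y : X,
      (∀ᶠ n in atTop, F^[n] x ∈ K) → y - x ∈ C → y ≠ x →
      (∀ᶠ n in atTop, ‖F^[n] y - F^[n] x‖ < δ) →
      ∃ J, ∀ j, J ≤ j → F^[j] x ∈ K ∧ ‖F^[j] y - F^[j] x‖ < δ ∧
        F^[j] y - F^[j] x - (ρ * ‖F^[j] y - F^[j] x‖) • e ∈ C ∧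
        ‖F^[j + 1] y - F^[j + 1] x - fderiv ℝ F (F^[j] x) (F^[j] y - F^[j] x)‖ ≤
          η * ‖F^[j] y - F^[j] x‖ ∧
        c * ‖F^[j] y - F^[j] x‖ ≤ ‖F^[j + 1] y - F^[j + 1] x‖ := by
  have hβ := h.unit.pos
  have hγ := h.unit.pos'
  have hρ₀ := h.ops.pos
  have hρ₁ : 0 < ρ₀ / 2 := half_pos hρ₀
  obtain ⟨ρ, hρ, η₀, hη₀, hdom⟩ := h.ops.exists_eventually_dominated h.unit hρ₁
  refine ⟨ρ, hρ, γ * (ρ₀ / 2 * ρ), by positivity, fun η hη => ?_⟩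
  set η₁ := ρ₀ / 2 / (β * (‖e‖ + 1)) with hη₁
  have hη₁pos : 0 < η₁ := by positivity
  have hη₁' : β * (η₁ * ‖e‖) ≤ ρ₀ / 2 := by
    have : η₁ * (β * (‖e‖ + 1)) = ρ₀ / 2 := by rw [hη₁]; field_simp
    nlinarith [mul_pos hη₁pos hβ]
  obtain ⟨r, hr, hunif⟩ := exists_norm_sub_sub_le_of_contDiff h.smooth h.compact
    (η := min (min η η₀) η₁) (by positivity)
  refine ⟨min r (γ * r / (‖e‖ + 1)), by positivity, fun x y hxK hxy hne hclose => ?_⟩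
  obtain ⟨J, hJ⟩ := eventually_atTop.1 (hxK.and hclose)
  have hstep : ∀ j, J ≤ j →
      ‖F^[j + 1] y - F^[j + 1] x - fderiv ℝ F (F^[j] x) (F^[j] y - F^[j] x)‖ ≤
        min (min η η₀) η₁ * ‖F^[j] y - F^[j] x‖ := by
    intro j hj
    have := hunif _ (hJ j hj).1 (F^[j] y - F^[j] x) ((hJ j hj).2.le.trans (min_le_left _ _))
    rwa [add_sub_cancel, ← Function.iterate_succ_apply' F, ← Function.iterate_succ_apply' F] at this
  have hlow : ∀ j, J ≤ j → ∀ a : ℝ, 0 ≤ a → F^[j] y - F^[j] x - a • e ∈ C →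
      F^[j + 1] y - F^[j + 1] x - (ρ₀ / 2 * a) • e ∈ C := by
    intro j hj a ha hda
    have h1 : γ * a ≤ ‖F^[j] y - F^[j] x‖ := h.unit.coercive ha hda
    have h2 : γ * a * (‖e‖ + 1) ≤ γ * r := by
      rw [← le_div_iff₀ (by positivity)]
      exact h1.trans ((hJ j hj).2.le.trans (min_le_right _ _))
    have h3 : ‖a • e‖ ≤ r := by
      rw [norm_smul, Real.norm_of_nonneg ha]
      have : γ * (a * (‖e‖ + 1)) ≤ γ * r := by linarith
      have := le_of_mul_le_mul_left this hγ
      linarith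
    have h4 := hunif _ (hJ j hj).1 (a • e) h3
    have h5 : ‖F (F^[j] x + a • e) - F (F^[j] x) - fderiv ℝ F (F^[j] x) (a • e)‖ ≤
        η₁ * ‖a • e‖ := h4.trans (by gcongr; exact min_le_right _ _)
    have h6 := h.unit.absorb_le h5
    have h7 : β * (η₁ * ‖a • e‖) ≤ ρ₀ / 2 * a := by
      rw [norm_smul, Real.norm_of_nonneg ha]
      nlinarith
    have h8 := h.unit.smul_add_mono h7 h6
    have h9 := h.unit.smul ha (h.ops.unit _ ⟨_, (hJ j hj).1, rfl⟩)
    have h10 : F (F^[j] y) - F (F^[j] x + a • e) ∈ C := h.mono (by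
      convert hda using 1; abel)
    have h11 := h.unit.add (h.unit.add h8 h9) h10
    rw [Function.iterate_succ_apply', Function.iterate_succ_apply']
    convert h11 using 1
    rw [map_smul]; module
  obtain ⟨J', hJ'⟩ := hdom (fun j => fderiv ℝ F (F^[j + (J + 1)] x))
    (fun j => F^[j + (J + 1)] y - F^[j + (J + 1)] x) (fun j => ⟨_, (hJ _ (by omega)).1, rfl⟩)
    (fun j => h.iterate_mono hxy _) (fun j => sub_ne_zero.2 (h.iterate_ne hxy hne _))
    (fun j => by
      have := hstep (j + (J + 1)) (by omega)
      have h2 : j + 1 + (J + 1) = j + (J + 1) + 1 := by omega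
      rw [h2]
      refine this.trans ?_
      gcongr
      exact (min_le_left _ _).trans (min_le_right _ _))
    (fun j a ha hda => by
      have h2 : j + 1 + (J + 1) = j + (J + 1) + 1 := by omega
      rw [h2]
      exact hlow _ (by omega) a ha hda)
    (by
      obtain ⟨a, ha, H⟩ := h.strict (h.iterate_mono hxy J) (h.iterate_ne hxy hne J)
      refine ⟨a, ha, ?_⟩
      simpa only [zero_add, Function.iterate_succ_apply'] using H)
  refine ⟨J' + (J + 1), fun j hj => ?_⟩
  have hjJ : J ≤ j := by omega
  have hd : F^[j] y - F^[j] x - (ρ * ‖F^[j] y - F^[j] x‖) • e ∈ C := by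
    obtain ⟨i, rfl⟩ := Nat.exists_eq_add_of_le' (by omega : J + 1 ≤ j)
    exact hJ' i (by omega)
  refine ⟨(hJ j hjJ).1, (hJ j hjJ).2, hd, ?_, ?_⟩
  · refine (hstep j hjJ).trans ?_
    gcongr
    exact (min_le_left _ _).trans (min_le_left _ _)
  · have := h.unit.coercive (by positivity) (hlow j hjJ _ (by positivity) hd)
    linarith

/-- If `F^[n] x` and `F^[n + k] x` are ordered, then `F^[n + i * k] x` converges. -/
theorem exists_tendsto_of_mem (h : MonotoneSystem F K C e β γ M ρ₀) {x : X} {n k : ℕ}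
    (hK : ∀ j, n ≤ j → F^[j] x ∈ K)
    (hor : F^[n + k] x - F^[n] x ∈ C ∨ -(F^[n + k] x - F^[n] x) ∈ C) :
    ∃ z, Tendsto (fun i => F^[n + i * k] x) atTop (𝓝 z) := by
  have key : ∀ i, F^[n + (i + 1) * k] x = F^[i * k] (F^[n + k] x) ∧
      F^[n + i * k] x = F^[i * k] (F^[n] x) := fun i => by
    rw [← Function.iterate_add_apply, ← Function.iterate_add_apply,
      show n + (i + 1) * k = i * k + (n + k) by ring, Nat.add_comm n (i * k)]
    exact ⟨rfl, rfl⟩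
  rcases hor with hor | hor
  · refine h.unit.exists_tendsto_of_monotone h.compact (fun i => hK _ (by omega)) fun i => ?_
    rw [(key i).1, (key i).2]
    exact h.iterate_mono hor _
  · refine h.unit.neg.exists_tendsto_of_monotone h.compact (fun i => hK _ (by omega)) fun i => ?_
    rw [(key i).1, (key i).2, Set.mem_neg, neg_sub]
    exact h.iterate_mono (by simpa using hor) _

/-- An orbit that is not sensitive from above converges to a cycle, of uniformly bounded
period. -/
theorem exists_tendsto [CompleteSpace X] (h : MonotoneSystem F K C e β γ M ρ₀) :
    ∃ m : ℕ, 0 < m ∧ ∃ δ : ℝ, 0 < δ ∧ ∀ x y : X, (∀ᶠ n in atTop, F^[n] x ∈ K) → y - x ∈ C →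
      y ≠ x → (∀ᶠ n in atTop, ‖F^[n] y - F^[n] x‖ < δ) →
      ∃ n k z, 0 < k ∧ k ≤ m ∧ Tendsto (fun i => F^[n + i * k] x) atTop (𝓝 z) := by
  obtain ⟨ρ, hρ, c, hc, hdom⟩ := h.exists_dominated
  obtain ⟨θ, hθ, l, hl0, hl1, η, hη, hdecay⟩ := h.ops.exists_geometric_decay h.unit hρ hc
  obtain ⟨r, hr, hunif⟩ := exists_norm_sub_sub_le_of_contDiff h.smooth h.compact hη
  obtain ⟨r', hr', hdecay⟩ := hdecay r hr
  obtain ⟨N, hN⟩ := h.compact.exists_card_pigeonhole hr'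
  obtain ⟨m, hm, hgood⟩ := exists_good_times hc hθ N
  obtain ⟨δ, hδ, hdom⟩ := hdom η hη
  refine ⟨m, hm, δ, hδ, fun x y hxK hxy hne hclose => ?_⟩
  obtain ⟨J, hJ⟩ := hdom x y hxK hxy hne hclose
  have hdne : ∀ j, F^[j] y - F^[j] x ≠ 0 := fun j => sub_ne_zero.2 (h.iterate_ne hxy hne j)
  obtain ⟨f, hfmono, hfN, hfθ⟩ := hgood (fun j => ‖F^[J + j] y - F^[J + j] x‖) δ
    (fun j => norm_pos_iff.2 (hdne _)) (fun j => (hJ (J + j) (by omega)).2.2.2.2)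
    (fun j => (hJ (J + j) (by omega)).2.1.le)
  obtain ⟨i, j, hij, hjN, hdist⟩ := hN (fun i => F^[J + f i] x) fun i => (hJ _ (by omega)).1
  have hfij := hfmono hij
  have hfi := hfmono.monotone (Nat.zero_le i)
  have hfj := hfmono.monotone hjN
  obtain ⟨k, hk⟩ := Nat.exists_eq_add_of_lt hfij
  set n := J + f i with hn
  have hnk : J + f j = n + (k + 1) := by omega
  rw [hnk] at hdist
  have hKn : ∀ j, n ≤ j → F^[j] x ∈ K := fun j hj => (hJ j (by omega)).1
  by_cases hor : ∃ q, F^[n + q + (k + 1)] x - F^[n + q] x ∈ C ∨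
      -(F^[n + q + (k + 1)] x - F^[n + q] x) ∈ C
  · obtain ⟨q, hq⟩ := hor
    obtain ⟨z, hz⟩ := h.exists_tendsto_of_mem (fun j hj => hKn j (by omega)) hq
    exact ⟨n + q, k + 1, z, by omega, by omega, hz⟩
  · push Not at hor
    obtain ⟨D, hD⟩ := hdecay (fun q => fderiv ℝ F (F^[n + q] x))
      (fun q => F^[n + q + (k + 1)] x - F^[n + q] x) (fun q => F^[n + q] y - F^[n + q] x)
      (fun q => ⟨_, hKn _ (by omega), rfl⟩) (fun q => h.iterate_mono hxy _) (fun q => hdne _)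
      (fun q => (hJ (n + q) (by omega)).2.2.1) (fun q => (hJ (n + q) (by omega)).2.2.2.2)
      (fun q => (hJ (n + q) (by omega)).2.2.2.1)
      (fun q => by simpa only [add_zero, hn, add_assoc] using hfθ i q)
      (fun q hq => by
        have := hunif _ (hKn (n + q) (by omega)) _ hq
        rw [add_sub_cancel, ← Function.iterate_succ_apply' F,
          ← Function.iterate_succ_apply' F] at this
        have h2 : n + (q + 1) + (k + 1) = (n + q + (k + 1)).succ := by omega
        rw [h2]
        exact this)
      hor (by
        rw [dist_comm, dist_eq_norm] at hdist
        simpa using hdist.le)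
    have hcauchy : CauchySeq fun i => F^[n + i * (k + 1)] x := by
      refine cauchySeq_of_le_geometric (l ^ (k + 1)) D
        (pow_lt_one₀ hl0.le hl1 (Nat.succ_ne_zero k)) fun i => ?_
      have := hD (i * (k + 1))
      rw [dist_comm, dist_eq_norm, ← pow_mul, Nat.mul_comm (k + 1)]
      have h2 : n + (i + 1) * (k + 1) = n + i * (k + 1) + (k + 1) := by ring
      rw [h2]
      exact this
    obtain ⟨z, hz⟩ := cauchySeq_tendsto_of_complete hcauchy
    exact ⟨n, k + 1, z, by omega, by omega, hz⟩

end MonotoneSystem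

end MonotoneSystem

section Cycle

theorem tendsto_iterate_add {X : Type*} [TopologicalSpace X] {F : X → X} (hF : Continuous F) {x z : X} {n k : ℕ}
    (hz : Tendsto (fun i => F^[n + i * k] x) atTop (𝓝 z)) (j : ℕ) :
    Tendsto (fun i => F^[n + j + i * k] x) atTop (𝓝 (F^[j] z)) := by
  have := ((hF.iterate j).tendsto z).comp hz
  refine this.congr fun i => ?_
  rw [Function.comp_apply, ← Function.iterate_add_apply,
    show j + (n + i * k) = n + j + i * k by ring]

theorem iterate_eq_of_tendsto {X : Type*} [TopologicalSpace X] [T2Space X] {F : X → X} (hF : Continuous F) {x z : X} {n k : ℕ}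
    (hz : Tendsto (fun i => F^[n + i * k] x) atTop (𝓝 z)) : F^[k] z = z := by
  refine tendsto_nhds_unique (tendsto_iterate_add hF hz k) ?_
  refine (hz.comp (tendsto_add_atTop_nat 1)).congr fun i => ?_
  rw [Function.comp_apply, show n + (i + 1) * k = n + k + i * k by ring]

theorem omegaMap_eq_of_tendsto {X : Type*} [NormedAddCommGroup X] {F : X → X} (hF : Continuous F) {x z : X} {n k : ℕ} (hk : 0 < k)
    (hz : Tendsto (fun i => F^[n + i * k] x) atTop (𝓝 z)) :
    omegaMap F x = {y | ∃ j : ℕ, y = F^[j] z} := by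
  apply Subset.antisymm
  · intro y hy
    have hO : ((fun q => F^[q] z) '' Iio k).Finite := (finite_Iio k).image _
    suffices hcl : y ∈ closure ((fun q => F^[q] z) '' Iio k) by
      rw [hO.isClosed.closure_eq] at hcl
      obtain ⟨q, -, rfl⟩ := hcl
      exact ⟨q, rfl⟩
    rw [Metric.mem_closure_iff]
    intro ε hε
    have hev : ∀ᶠ i in atTop, ∀ q ∈ Finset.range k,
        dist (F^[n + q + i * k] x) (F^[q] z) < ε / 2 :=
      (Filter.eventually_all_finset _).2 fun q _ =>
        Metric.tendsto_nhds.1 (tendsto_iterate_add hF hz q) _ (half_pos hε)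
    obtain ⟨I, hI⟩ := eventually_atTop.1 hev
    obtain ⟨w, ⟨t, ht, rfl⟩, hyw⟩ :=
      Metric.mem_closure_iff.1 (mem_iInter.1 hy (n + I * k)) _ (half_pos hε)
    have hq : (t - n) % k < k := Nat.mod_lt _ hk
    have hI' : I ≤ (t - n) / k := (Nat.le_div_iff_mul_le hk).2 (by omega)
    have := hI _ hI' _ (Finset.mem_range.2 hq)
    have ht' : n + (t - n) % k + (t - n) / k * k = t := by
      have := Nat.mod_add_div (t - n) k
      rw [Nat.mul_comm] at this
      omega
    rw [ht'] at this
    exact ⟨_, ⟨_, hq, rfl⟩, by linarith [dist_triangle y (F^[t] x) (F^[(t - n) % k] z)]⟩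
  · rintro _ ⟨j, rfl⟩
    refine mem_iInter.2 fun q => ?_
    refine mem_closure_of_tendsto (tendsto_iterate_add hF hz j) ?_
    filter_upwards [eventually_ge_atTop q] with i hi
    exact ⟨_, by nlinarith, rfl⟩

variable {X : Type*} [NormedAddCommGroup X] [NormedSpace ℝ X]

theorem fderiv_iterate_add {F : X → X} (hF : Differentiable ℝ F) (a b : ℕ) (x v : X) :
    fderiv ℝ F^[a + b] x v = fderiv ℝ F^[a] (F^[b] x) (fderiv ℝ F^[b] x v) := by
  rw [Function.iterate_add, fderiv_comp x ((hF.iterate a) _) ((hF.iterate b) _)]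
  rfl

variable {C : Set X} {e : X} {β γ M ρ₀ : ℝ} {F : X → X} {K : Set X}

namespace MonotoneSystem

theorem fderiv_iterate_mem (h : MonotoneSystem F K C e β γ M ρ₀) {z : X}
    (hzK : ∀ j, F^[j] z ∈ K) {v : X} (hv : v ∈ C) (j : ℕ) : fderiv ℝ F^[j] z v ∈ C := by
  induction j with
  | zero => simpa using hv
  | succ j ih =>
    rw [Nat.add_comm, fderiv_iterate_add (h.smooth.differentiable (by norm_num))]
    exact h.ops.map_mem _ ⟨_, hzK j, rfl⟩ _ ih

/-- Iterates of the linearization along an orbit in `K` eventually send `e` to vectors uniformly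
dominating `e`. -/
theorem exists_fderiv_iterate_dominated (h : MonotoneSystem F K C e β γ M ρ₀) {z : X}
    (hzK : ∀ j, F^[j] z ∈ K) : ∃ ρ : ℝ, 0 < ρ ∧ ∃ J, ∀ j, J ≤ j →
      fderiv ℝ F^[j] z e - (ρ * ‖fderiv ℝ F^[j] z e‖) • e ∈ C := by
  have hd : Differentiable ℝ F := h.smooth.differentiable (by norm_num)
  have hρ₀ := h.ops.pos
  obtain ⟨ρ, hρ, η, hη, H⟩ := h.ops.exists_eventually_dominated h.unit hρ₀
  have hsucc : ∀ j, fderiv ℝ F^[j + 1] z e = fderiv ℝ F (F^[j] z) (fderiv ℝ F^[j] z e) :=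
    fun j => by rw [Nat.add_comm, fderiv_iterate_add hd]; rfl
  have hlow : ∀ j (a : ℝ), 0 ≤ a → fderiv ℝ F^[j] z e - a • e ∈ C →
      fderiv ℝ F^[j + 1] z e - (ρ₀ * a) • e ∈ C := by
    intro j a ha hda
    have h1 := h.ops.map_mem _ ⟨_, hzK j, rfl⟩ _ hda
    have h2 := h.unit.smul ha (h.ops.unit _ ⟨_, hzK j, rfl⟩)
    have h3 := h.unit.add h1 h2
    rw [hsucc]
    convert h3 using 1
    rw [map_sub, map_smul]; module
  have hpow : ∀ j, fderiv ℝ F^[j] z e - (ρ₀ ^ j) • e ∈ C := by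
    intro j
    induction j with
    | zero => simpa using h.unit.zero_mem
    | succ j ih => rw [pow_succ']; exact hlow j _ (by positivity) ih
  refine ⟨ρ, hρ, H (fun j => fderiv ℝ F (F^[j] z)) (fun j => fderiv ℝ F^[j] z e)
    (fun j => ⟨_, hzK j, rfl⟩) (fun j => h.fderiv_iterate_mem hzK h.unit.unit_mem' j) ?_
    (fun j => ?_) hlow ⟨1, one_pos, by simpa using hpow 0⟩⟩
  · intro j hj
    have h1 := h.unit.coercive (by positivity) (hpow j)
    have h2 := h.unit.pos'
    rw [hj, norm_zero] at h1
    have : 0 < γ * ρ₀ ^ j := by positivity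
    linarith
  · rw [hsucc, sub_self, norm_zero]; positivity

/-- An orbit converging to a cycle along which some iterate of the linearization expands `e`
threefold is sensitive from above. -/
theorem sensitive_of_fderiv_iterate (h : MonotoneSystem F K C e β γ M ρ₀) {x z : X} {n k s : ℕ}
    (hk : 0 < k) (hz : Tendsto (fun i => F^[n + i * k] x) atTop (𝓝 z))
    (hexp : fderiv ℝ F^[s * k] z e - (3 : ℝ) • e ∈ C) :
    ∃ δ : ℝ, 0 < δ ∧ ∀ y, y - x ∈ C → y ≠ x → ¬ ∀ᶠ n in atTop, ‖F^[n] y - F^[n] x‖ < δ := by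
  have hβ := h.unit.pos
  have hγ := h.unit.pos'
  set ε := 1 / (β * (‖e‖ + 1)) with hε
  have hεpos : 0 < ε := by positivity
  have hε' : β * (ε * ‖e‖) ≤ 1 := by
    have : ε * (β * (‖e‖ + 1)) = 1 := by rw [hε]; field_simp
    nlinarith [mul_pos hεpos hβ]
  have hsmooth : ∀ j, ContDiff ℝ 1 F^[j] := fun j => by
    induction j with
    | zero => exact contDiff_id
    | succ j ih => exact ih.comp h.smooth
  have hstrict : HasStrictFDerivAt F^[s * k] (fderiv ℝ F^[s * k] z) z :=
    (hsmooth _).contDiffAt.hasStrictFDerivAt (by norm_num)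
  have hev := hstrict.isLittleO.def hεpos
  rw [nhds_prod_eq] at hev
  obtain ⟨r, hr, hball⟩ := Metric.eventually_nhds_iff.1 (by rwa [nhds_prod_eq] :
    ∀ᶠ q in 𝓝 (z, z), ‖F^[s * k] q.1 - F^[s * k] q.2 - fderiv ℝ F^[s * k] z (q.1 - q.2)‖ ≤
      ε * ‖q.1 - q.2‖)
  have hgrow : ∀ q a, dist q z < r / 2 → 0 ≤ a → a * ‖e‖ < r / 2 →
      F^[s * k] (q + a • e) - F^[s * k] q - (2 * a) • e ∈ C := by
    intro q a hq ha har
    have hae : ‖a • e‖ = a * ‖e‖ := by rw [norm_smul, Real.norm_of_nonneg ha]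
    have h1 := hball (y := (q + a • e, q)) (by
      rw [Prod.dist_eq, max_lt_iff]
      refine ⟨?_, by simp only; linarith⟩
      have h2 := dist_triangle (q + a • e) q z
      have h3 : dist (q + a • e) q = a * ‖e‖ := by rw [dist_eq_norm, add_sub_cancel_left, hae]
      simp only; linarith)
    simp only [add_sub_cancel_left] at h1
    have h2 := h.unit.absorb_le h1
    rw [hae] at h2
    have h3 := h.unit.smul_add_mono (b := a) (by nlinarith) h2
    have h4 := h.unit.add h3 (h.unit.smul ha hexp)
    convert h4 using 1
    rw [map_smul]; module
  refine ⟨γ * (r / 2) / (‖e‖ + 1), by positivity, fun y hxy hne hclose => ?_⟩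
  obtain ⟨T, hT⟩ := eventually_atTop.1 hclose
  obtain ⟨I, hI⟩ := eventually_atTop.1 (Metric.tendsto_nhds.1 hz (r / 2) (half_pos hr))
  have hidx : ∀ i, T + I + 1 ≤ n + (T + I + 1 + i * s) * k := fun i => by
    have := Nat.le_mul_of_pos_right (T + I + 1 + i * s) hk
    linarith [Nat.zero_le (i * s)]
  obtain ⟨a, ha, h0⟩ : ∃ a : ℝ, 0 < a ∧ F^[n + (T + I + 1 + 0 * s) * k] y -
      F^[n + (T + I + 1 + 0 * s) * k] x - a • e ∈ C := by
    obtain ⟨q, hq⟩ := Nat.exists_eq_add_of_le' ((by omega : 1 ≤ T + I + 1).trans (hidx 0))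
    rw [hq, Function.iterate_succ_apply', Function.iterate_succ_apply']
    exact h.strict (h.iterate_mono hxy q) (h.iterate_ne hxy hne q)
  have hsmall : ∀ i (b : ℝ), 0 ≤ b → F^[n + (T + I + 1 + i * s) * k] y -
      F^[n + (T + I + 1 + i * s) * k] x - b • e ∈ C → b * (‖e‖ + 1) < r / 2 := by
    intro i b hb hdb
    have h1 := h.unit.coercive hb hdb
    have h2 := h1.trans_lt (hT _ (by linarith [hidx i]))
    rw [lt_div_iff₀ (by positivity), mul_assoc] at h2
    exact lt_of_mul_lt_mul_left h2 hγ.le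
  have hind : ∀ i, F^[n + (T + I + 1 + i * s) * k] y - F^[n + (T + I + 1 + i * s) * k] x -
      (2 ^ i * a) • e ∈ C := by
    intro i
    induction i with
    | zero => simpa using h0
    | succ i ih =>
      have h1 := hsmall i _ (by positivity) ih
      have hb : 0 ≤ 2 ^ i * a := by positivity
      have h2 := hgrow (F^[n + (T + I + 1 + i * s) * k] x) (2 ^ i * a)
        (hI _ (by nlinarith [Nat.zero_le (i * s)])) hb (by linarith)
      have h3 := h.iterate_mono (x := F^[n + (T + I + 1 + i * s) * k] x + (2 ^ i * a) • e)
        (y := F^[n + (T + I + 1 + i * s) * k] y) (by convert ih using 1; abel) (s * k)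
      have h4 := h.unit.add h2 h3
      have e1 : n + (T + I + 1 + (i + 1) * s) * k =
        s * k + (n + (T + I + 1 + i * s) * k) := by ring
      rw [e1, Function.iterate_add_apply F (s * k), Function.iterate_add_apply F (s * k), pow_succ']
      convert h4 using 1
      module
  obtain ⟨i, hi⟩ := pow_unbounded_of_one_lt (r / 2 / a) one_lt_two
  rw [div_lt_iff₀ ha] at hi
  have h1 := hsmall i _ (by positivity) (hind i)
  have : 0 ≤ 2 ^ i * a * ‖e‖ := by positivity
  linarith

theorem spectralRadius_le_one [CompleteSpace X] (h : MonotoneSystem F K C e β γ M ρ₀)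
    (hcpt : ∀ p, IsCompactOperator (fderiv ℝ F p)) {x z : X} {n k p : ℕ} (hk : 0 < k)
    (hp : 0 < p) (hz : Tendsto (fun i => F^[n + i * k] x) atTop (𝓝 z)) (hpz : F^[p] z = z)
    (hzK : ∀ j, F^[j] z ∈ K)
    (hns : ∀ δ : ℝ, 0 < δ → ∃ y, y - x ∈ C ∧ y ≠ x ∧ ∀ᶠ n in atTop, ‖F^[n] y - F^[n] x‖ < δ) :
    spectralRadius ℝ (fderiv ℝ F^[p] z) ≤ 1 := by
  have hd : Differentiable ℝ F := h.smooth.differentiable (by norm_num)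
  have hβ := h.unit.pos
  refine iSup₂_le fun μ hμ => ?_
  by_contra! hcon
  have hμ1 : 1 < |μ| := by
    have : (1 : ℝ≥0) < ‖μ‖₊ := by exact_mod_cast hcon
    exact_mod_cast this
  have hμ0 : μ ≠ 0 := by rintro rfl; simp at hμ1; linarith
  have hAcpt : IsCompactOperator (fderiv ℝ F^[p] z) := by
    obtain ⟨q, rfl⟩ := Nat.exists_eq_add_of_le hp
    have e1 : fderiv ℝ F^[Nat.succ 0 + q] z =
        (fderiv ℝ F (F^[q] z)).comp (fderiv ℝ F^[q] z) := by
      ext v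
      exact fderiv_iterate_add hd 1 q z v
    rw [e1]
    exact (hcpt _).comp_clm _
  obtain ⟨v, hv⟩ := ((hAcpt.hasEigenvalue_iff_mem_spectrum hμ0).2 hμ).exists_hasEigenvector
  have hv0 : v ≠ 0 := hv.2
  have hAv : fderiv ℝ F^[p] z v = μ • v := hv.apply_eq_smul
  have hpow : ∀ i, fderiv ℝ F^[p * i] z v = μ ^ i • v := by
    intro i
    induction i with
    | zero => simp
    | succ i ih =>
      rw [Nat.mul_succ, fderiv_iterate_add hd, hpz, hAv, map_smul, ih, smul_smul, pow_succ']
  obtain ⟨c, hc, hcv⟩ := h.unit.exists_norm_ge hv0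
  have hcv' : ∀ (t : ℝ) (g : X), t ≠ 0 → g + t • v ∈ C → g - t • v ∈ C → c * |t| ≤ ‖g‖ := by
    intro t g ht h1 h2
    have ht' : 0 < |t| := abs_pos.2 ht
    have h3 := h.unit.smul (inv_nonneg.2 ht'.le) h1
    have h4 := h.unit.smul (inv_nonneg.2 ht'.le) h2
    have h5 : c ≤ ‖|t|⁻¹ • g‖ := by
      rw [smul_add, smul_smul] at h3
      rw [smul_sub, smul_smul] at h4
      rcases lt_or_gt_of_ne ht with hneg | hpos
      · rw [abs_of_neg hneg] at h3 h4 ⊢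
        have e1 : (-t)⁻¹ * t = -1 := by field_simp
        rw [e1] at h3 h4
        exact hcv _ (by simpa using h4) (by simpa [sub_eq_add_neg] using h3)
      · rw [abs_of_pos hpos] at h3 h4 ⊢
        rw [inv_mul_cancel₀ ht, one_smul] at h3 h4
        exact hcv _ h3 h4
    rw [norm_smul, norm_inv, Real.norm_of_nonneg ht'.le, inv_mul_eq_div, le_div_iff₀ ht'] at h5
    exact h5
  have hgrow : ∀ i, c * |μ| ^ i ≤ β * ‖v‖ * ‖fderiv ℝ F^[p * i] z e‖ := by
    intro i
    have h1 := h.fderiv_iterate_mem hzK (h.unit.absorb v) (p * i)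
    have h2 := h.fderiv_iterate_mem hzK (h.unit.absorb (-v)) (p * i)
    rw [map_add, map_smul] at h1 h2
    rw [map_neg, norm_neg, ← sub_eq_add_neg] at h2
    rw [hpow] at h1 h2
    have := hcv' _ _ (pow_ne_zero i hμ0) h1 h2
    rwa [abs_pow, norm_smul, Real.norm_of_nonneg (by positivity)] at this
  obtain ⟨ρ, hρ, J, hJ⟩ := h.exists_fderiv_iterate_dominated hzK
  have hvpos : 0 < ‖v‖ := norm_pos_iff.2 hv0
  obtain ⟨i, hi⟩ := pow_unbounded_of_one_lt (3 / ρ * (β * ‖v‖) / c) hμ1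
  have hile : i ≤ k * (i + J) := by nlinarith
  have hi' : 3 / ρ * (β * ‖v‖) < c * |μ| ^ (k * (i + J)) := by
    rw [div_lt_iff₀ hc] at hi
    have := pow_le_pow_right₀ hμ1.le hile
    nlinarith
  have h3 : 3 ≤ ρ * ‖fderiv ℝ F^[p * (k * (i + J))] z e‖ := by
    have h4 := hi'.trans_le (hgrow (k * (i + J)))
    rw [mul_comm (β * ‖v‖)] at h4
    have h5 := (lt_of_mul_lt_mul_right h4 (by positivity)).le
    rw [div_le_iff₀ hρ] at h5
    linarith
  have hJle : J ≤ p * (k * (i + J)) := by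
    have : J ≤ k * (i + J) := by nlinarith
    nlinarith
  have hexp := h.unit.sub_smul_mono h3 (hJ _ hJle)
  rw [show p * (k * (i + J)) = p * (i + J) * k by ring] at hexp
  obtain ⟨δ, hδ, H⟩ := h.sensitive_of_fderiv_iterate hk hz hexp
  obtain ⟨y, hy1, hy2, hy3⟩ := hns δ hδ
  exact H y hy1 hy2 hy3

theorem exists_isLinStableCycleLe [CompleteSpace X] (h : MonotoneSystem F K C e β γ M ρ₀)
    (hcpt : ∀ p, IsCompactOperator (fderiv ℝ F p)) (hK : ∀ x, ∀ᶠ n in atTop, F^[n] x ∈ K) :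
    ∃ m : ℕ, 0 < m ∧ ∀ x, (∀ δ : ℝ, 0 < δ → ∃ y, y - x ∈ C ∧ y ≠ x ∧
      ∀ᶠ n in atTop, ‖F^[n] y - F^[n] x‖ < δ) → IsLinStableCycleLe F m (omegaMap F x) := by
  have hc : Continuous F := h.smooth.continuous
  obtain ⟨m, hm, δ, hδ, H⟩ := h.exists_tendsto
  refine ⟨m, hm, fun x hx => ?_⟩
  obtain ⟨y, hy1, hy2, hy3⟩ := hx δ hδ
  obtain ⟨n, k, z, hk, hkm, hz⟩ := H x y (hK x) hy1 hy2 hy3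
  have hkz : Function.IsPeriodicPt F k z := iterate_eq_of_tendsto hc hz
  have hzK : ∀ j, F^[j] z ∈ K := by
    intro j
    obtain ⟨N, hN⟩ := eventually_atTop.1 (hK x)
    refine h.compact.isClosed.mem_of_tendsto (tendsto_iterate_add hc hz j) ?_
    filter_upwards [eventually_ge_atTop N] with i hi
    exact hN _ (by nlinarith)
  have hppos := hkz.minimalPeriod_pos hk
  have hpz : F^[Function.minimalPeriod F z] z = z := Function.iterate_minimalPeriod
  refine ⟨Function.minimalPeriod F z, hppos, (hkz.minimalPeriod_le hk).trans hkm, z, hpz,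
    fun l hl hlp => ?_, h.spectralRadius_le_one hcpt hk hppos hz hpz hzK hx,
    omegaMap_eq_of_tendsto hc hk hz⟩
  exact Function.not_isPeriodicPt_of_pos_of_lt_minimalPeriod hl.ne' hlp

end MonotoneSystem

end Cycle

theorem IsLinStableCycleLe.mono {X : Type*} [NormedAddCommGroup X] [NormedSpace ℝ X] {F : X → X}
    {m m' : ℕ} {S : Set X} (hm : m ≤ m') (h : IsLinStableCycleLe F m S) :
    IsLinStableCycleLe F m' S := by
  obtain ⟨p, hp, hpm, H⟩ := h
  exact ⟨p, hp, hpm.trans hm, H⟩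

theorem StronglyPositive.neg_cone {X : Type*} [NormedAddCommGroup X] [NormedSpace ℝ X] {C : Set X}
    {T : X →L[ℝ] X} (hT : StronglyPositive C T) : StronglyPositive (-C) T := by
  rintro v ⟨hv, hv0⟩
  have := hT (-v) ⟨hv, by simpa using hv0⟩
  rw [map_neg] at this
  rw [← Set.image_neg_eq_neg, ← Homeomorph.coe_neg, ← (Homeomorph.neg X).image_interior]
  exact ⟨_, this, by simp⟩

/-- The orbits of a compact pointwise dissipative map eventually stay in a compact set. -/
theorem PointwiseDissipative.exists_isCompact {X : Type*} [NormedAddCommGroup X]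
    [NormedSpace ℝ X] {F : X → X} (hdiss : PointwiseDissipative F) (hcpt : IsCompactMap F) :
    ∃ K : Set X, IsCompact K ∧ ∀ x, ∀ᶠ n in atTop, F^[n] x ∈ K := by
  obtain ⟨B, hBne, hB, hattr⟩ := hdiss
  refine ⟨closure (F '' thickening 1 B), hcpt _ hB.thickening, fun x => ?_⟩
  obtain ⟨N, hN⟩ := eventually_atTop.1 ((hattr x).eventually_lt_const one_pos)
  filter_upwards [eventually_ge_atTop (N + 1)] with n hn
  obtain ⟨q, rfl⟩ := Nat.exists_eq_add_of_le' (by omega : 1 ≤ n)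
  rw [Function.iterate_succ_apply']
  refine subset_closure ⟨_, ?_, rfl⟩
  rw [mem_thickening_iff_infDist_lt hBne]
  exact hN q (by omega)

/-- Failure of sensitivity at `x` on one side or the other yields arbitrarily close companion orbits
on a fixed side. -/
theorem exists_close_orbits_of_not_sensitive {X : Type*} [NormedAddCommGroup X] [NormedSpace ℝ X]
    {C : Set X} {F : X → X} {x : X}
    (hx : ∀ δ : ℝ≥0, 0 < δ → ∃ y, (coneLT C y x ∨ coneLT C x y) ∧
      (atTop.limsup fun n : ℕ => (‖F^[n] x - F^[n] y‖₊ : ℝ≥0∞)) < δ) :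
    (∀ δ : ℝ, 0 < δ → ∃ y, y - x ∈ C ∧ y ≠ x ∧ ∀ᶠ n in atTop, ‖F^[n] y - F^[n] x‖ < δ) ∨
      ∀ δ : ℝ, 0 < δ → ∃ y, y - x ∈ -C ∧ y ≠ x ∧ ∀ᶠ n in atTop, ‖F^[n] y - F^[n] x‖ < δ := by
  by_contra! hcon
  obtain ⟨⟨δ₁, hδ₁, H₁⟩, δ₂, hδ₂, H₂⟩ := hcon
  have hδ : 0 < min δ₁ δ₂ := lt_min hδ₁ hδ₂
  obtain ⟨y, hy, hlim⟩ := hx ⟨min δ₁ δ₂, hδ.le⟩ hδ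
  have hev : ∀ᶠ n in atTop, ‖F^[n] y - F^[n] x‖ < min δ₁ δ₂ := by
    filter_upwards [eventually_lt_of_limsup_lt hlim] with n hn
    rw [norm_sub_rev]
    exact NNReal.coe_lt_coe.2 (ENNReal.coe_lt_coe.1 hn)
  rcases hy with ⟨hy, hne⟩ | ⟨hy, hne⟩
  · have hne' : y ≠ x := fun heq => hne (by simp [heq])
    obtain ⟨n, hn1, hn2⟩ := ((H₂ y (by simpa using hy) hne').and_eventually hev).exists
    exact absurd (hn2.trans_le (min_le_right _ _)) (not_lt.2 hn1)
  · have hne' : y ≠ x := fun heq => hne (by simp [heq])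
    obtain ⟨n, hn1, hn2⟩ := ((H₁ y hy hne').and_eventually hev).exists
    exact absurd (hn2.trans_le (min_le_left _ _)) (not_lt.2 hn1)

/-- **Sharpened `C¹`-dynamics alternative**: there is an integer `m > 0` such that for
every `x`, either `ω(x,F₀)` is a linearly stable cycle of minimal period at most `m`,
or there is `δ > 0` with `limsupₙ ‖F₀ⁿ x - F₀ⁿ y‖ ≥ δ` for all `y` with `y < x` or
`y > x`. -/
theorem sharpened_C1_dynamics_alternative
    {X : Type*} [NormedAddCommGroup X] [NormedSpace ℝ X] [CompleteSpace X]
    [TopologicalSpace.SeparableSpace X]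
    (C : Set X) (hC : StronglyOrderedCone C)
    (F₀ : X → X) (hC1 : ContDiff ℝ 1 F₀) (hcpt : IsCompactMap F₀)
    (hpos : ∀ x : X, StronglyPositive C (fderiv ℝ F₀ x))
    (hdiss : PointwiseDissipative F₀) :
    ∃ m : ℕ, 0 < m ∧ ∀ x : X,
      IsLinStableCycleLe F₀ m (omegaMap F₀ x) ∨
        ∃ δ : ℝ≥0, 0 < δ ∧ ∀ y : X, (coneLT C y x ∨ coneLT C x y) →
          (δ : ℝ≥0∞) ≤ atTop.limsup
            fun n : ℕ => (‖F₀^[n] x - F₀^[n] y‖₊ : ℝ≥0∞) := by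
  rcases subsingleton_or_nontrivial X with hX | hX
  · refine ⟨1, one_pos, fun x => Or.inr ⟨1, one_pos, fun y hy => ?_⟩⟩
    rcases hy with hy | hy <;> exact absurd (Subsingleton.elim _ _) hy.2
  obtain ⟨e, β, γ, hunit⟩ := hC.exists_coneUnit
  obtain ⟨K, hK, hattr⟩ := hdiss.exists_isCompact hcpt
  obtain ⟨M₁, ρ₁, h₁⟩ := hunit.exists_monotoneSystem hC1 hcpt hpos hK
  obtain ⟨M₂, ρ₂, h₂⟩ := hunit.neg.exists_monotoneSystem hC1 hcpt (fun x => (hpos x).neg_cone) hK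
  have hop : ∀ p, IsCompactOperator (fderiv ℝ F₀ p) := fun p =>
    hcpt.isCompactOperator_fderiv ((hC1.differentiable (by norm_num)) p)
  obtain ⟨m₁, hm₁, H₁⟩ := h₁.exists_isLinStableCycleLe hop hattr
  obtain ⟨m₂, -, H₂⟩ := h₂.exists_isLinStableCycleLe hop hattr
  refine ⟨max m₁ m₂, lt_max_of_lt_left hm₁, fun x => ?_⟩
  by_contra! hcon
  rcases exists_close_orbits_of_not_sensitive hcon.2 with hx | hx
  · exact hcon.1 ((H₁ x hx).mono (le_max_left _ _))
  · exact hcon.1 ((H₂ x hx).mono (le_max_right _ _))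

end
end
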